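/- arXiv:2006.04717 — 3 statements merged into one kernel-verified Lean document; each statement's English description precedes it below -/
import Mathlib

section
/- Let M, N, P ≥ 3 be integers. Then there exist a free group A of rank 3, a free group B of rank 4, a free group C of rank 7, and injective group homomorphisms i : C → A and j : C → B such that the image j(C) has index 2 in B and the Artin group A_{MNP} is isomorphic to the amalgamated free product A *_C B formed along i and j. -/
/-- The alternating word (a,b)_M = abab⋯ of length M in the free group. -/
def altWord {V : Type} (a b : V) (M : ℕ) : FreeGroup V :=
  ((List.range M).map fun i => if i % 2 = 0 then FreeGroup.of a else FreeGroup.of b).prod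

/-- The relators of the Artin group A_{MNP} on three generators a = 0, b = 1, c = 2. -/
def artinRels3 (M N P : ℕ) : Set (FreeGroup (Fin 3)) :=
  {altWord 0 1 M * (altWord 1 0 M)⁻¹,
   altWord 1 2 N * (altWord 2 1 N)⁻¹,
   altWord 2 0 P * (altWord 0 2 P)⁻¹}

/-- The Artin group A_{MNP}. -/
abbrev Artin3 (M N P : ℕ) : Type := PresentedGroup (artinRels3 M N P)

/-- A family of two groups indexed by `Bool`. -/
def twoFam (A B : Type) : Bool → Type := fun b => bif b then A else B

instance twoFamGroup {A B : Type} [Group A] [Group B] : ∀ b, Group (twoFam A B b) :=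
  fun b => match b with
  | false => (inferInstance : Group B)
  | true => (inferInstance : Group A)

/-- The pair of maps from `C` into the two-element family of groups, packaging
homomorphisms `i : C →* A` and `j : C →* B`. -/
def twoMaps {A B C : Type} [Group A] [Group B] [Group C] (i : C →* A) (j : C →* B) :
    ∀ b, C →* twoFam A B b := fun b => match b with
  | false => j
  | true => i

/-- The amalgamated free product `A *_C B` (pushout) along `i : C →* A` and `j : C →* B`. -/
abbrev AmalgamatedProduct {A B C : Type} [Group A] [Group B] [Group C]
    (i : C →* A) (j : C →* B) : Type :=
  Monoid.PushoutI (twoMaps i j)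

/-! ### Elementary group theory -/

section GroupLemmas
variable {K : Type*} [Group K]

def altK (a b : K) (M : ℕ) : K :=
  ((List.range M).map fun i => if i % 2 = 0 then a else b).prod

lemma altK_even (a b : K) (m : ℕ) : altK a b (2 * m) = (a * b) ^ m := by
  induction m with
  | zero => simp [altK]
  | succ k ih =>
    have h : 2 * (k + 1) = 2 * k + 1 + 1 := by ring
    unfold altK at *
    rw [h, List.range_succ, List.range_succ, pow_succ, ← ih]
    simp [Nat.add_mod]

lemma altK_odd (a b : K) (m : ℕ) : altK a b (2 * m + 1) = (a * b) ^ m * a := by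
  rw [← altK_even]
  unfold altK
  rw [List.range_succ]
  simp

lemma map_altWord {V : Type} (f : FreeGroup V →* K) (a b : V) (M : ℕ) :
    f (altWord a b M) = altK (f (FreeGroup.of a)) (f (FreeGroup.of b)) M := by
  unfold altWord altK
  rw [map_list_prod, List.map_map]
  congr 2
  funext i
  simp only [Function.comp]
  split_ifs <;> rfl

def uOne (M : ℕ) (x y _z : K) : K := if M % 2 = 0 then x ^ (M / 2) else x ^ (M / 2) * y⁻¹
def wOne (M : ℕ) (x y z : K) : K :=
  if M % 2 = 0 then y * x ^ (M / 2) * y⁻¹ else y * x ^ (M / 2 + 1) * z⁻¹ * x⁻¹ * y⁻¹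
def uTwo (N : ℕ) (_x y z : K) : K := if N % 2 = 0 then y ^ (N / 2) else z⁻¹ * y ^ (N / 2)
def wTwo (N : ℕ) (x y _z : K) : K :=
  if N % 2 = 0 then y * x * y ^ (N / 2) * x⁻¹ * y⁻¹ else y ^ (N / 2 + 1) * x⁻¹ * y⁻¹
def uThree (P : ℕ) (_x y z : K) : K := if P % 2 = 0 then z ^ (P / 2) else z ^ (P / 2) * y⁻¹
def wThree (P : ℕ) (x y z : K) : K :=
  if P % 2 = 0 then y * z ^ (P / 2) * y⁻¹ else y * z ^ (P / 2) * x⁻¹ * y⁻¹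

variable {L : Type*} [Group L]
lemma map_uOne (f : K →* L) (M : ℕ) (x y z : K) :
    f (uOne M x y z) = uOne M (f x) (f y) (f z) := by
  unfold uOne; split_ifs <;> simp
lemma map_wOne (f : K →* L) (M : ℕ) (x y z : K) :
    f (wOne M x y z) = wOne M (f x) (f y) (f z) := by
  unfold wOne; split_ifs <;> simp
lemma map_uTwo (f : K →* L) (M : ℕ) (x y z : K) :
    f (uTwo M x y z) = uTwo M (f x) (f y) (f z) := by
  unfold uTwo; split_ifs <;> simp
lemma map_wTwo (f : K →* L) (M : ℕ) (x y z : K) :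
    f (wTwo M x y z) = wTwo M (f x) (f y) (f z) := by
  unfold wTwo; split_ifs <;> simp
lemma map_uThree (f : K →* L) (M : ℕ) (x y z : K) :
    f (uThree M x y z) = uThree M (f x) (f y) (f z) := by
  unfold uThree; split_ifs <;> simp
lemma map_wThree (f : K →* L) (M : ℕ) (x y z : K) :
    f (wThree M x y z) = wThree M (f x) (f y) (f z) := by
  unfold wThree; split_ifs <;> simp

/-- `(ba)^m = a⁻¹ (ab)^m a`. -/
lemma swap_pow (a b : K) (m : ℕ) : (b * a) ^ m = a⁻¹ * (a * b) ^ m * a := by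
  have := conj_pow (a := a⁻¹) (b := a * b) (i := m)
  simp only [inv_inv] at this
  rw [← this]; congr 1; group

lemma swap_pow_odd (a b : K) (m : ℕ) : (b * a) ^ m * b = b * (a * b) ^ m := by
  have h : (a * b) * (a * b) ^ m = (a * b) ^ m * (a * b) := (Commute.pow_right rfl m).eq
  rw [swap_pow]
  have : a⁻¹ * (a * b) ^ m * a * b = a⁻¹ * ((a * b) ^ m * (a * b)) := by group
  rw [this, ← h, ← mul_assoc, ← mul_assoc, inv_mul_cancel, one_mul]

lemma rel_conj (l r : K) {A B C D : K} (h1 : C = l * A * r) (h2 : D = l * B * r) :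
    A = B ↔ C = D := by
  subst h1 h2; simp

lemma rel_one (M : ℕ) (a b c : K) : altK a b M = altK b a M ↔
    (b * c * a) * uOne M (a * b) (b * c) (c * a) * (b * c * a)⁻¹ =
      wOne M (a * b) (b * c) (c * a) := by
  rcases Nat.even_or_odd' M with ⟨m, rfl | rfl⟩
  · have h : (2 * m) % 2 = 0 := by omega
    have h' : 2 * m / 2 = m := by omega
    simp only [altK_even, uOne, wOne, h, h', if_true]
    rw [swap_pow a b]
    generalize (a * b) ^ m = X
    refine rel_conj (b * c * a) (a⁻¹ * (b * c)⁻¹) ?_ ?_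
    · group
    · group
  · rw [altK_odd, altK_odd, swap_pow_odd a b]
    have h : ¬ (2 * m + 1) % 2 = 0 := by omega
    have h' : (2 * m + 1) / 2 = m := by omega
    simp only [uOne, wOne, h, h', if_false]
    have hc : (a * b) * (a * b) ^ m = (a * b) ^ m * (a * b) := (Commute.pow_right rfl m).eq
    try rw [pow_succ]
    generalize (a * b) ^ m = X at *
    rw [← hc]
    refine rel_conj (b * c * a) (a⁻¹ * c⁻¹ * b⁻¹ * a⁻¹ * (b * c)⁻¹) ?_ ?_
    · group
    · group

lemma rel_two (M : ℕ) (a b c : K) : altK b c M = altK c b M ↔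
    (b * c * a) * uTwo M (a * b) (b * c) (c * a) * (b * c * a)⁻¹ =
      wTwo M (a * b) (b * c) (c * a) := by
  rcases Nat.even_or_odd' M with ⟨m, rfl | rfl⟩
  · have h : (2 * m) % 2 = 0 := by omega
    have h' : 2 * m / 2 = m := by omega
    simp only [altK_even, uTwo, wTwo, h, h', if_true]
    rw [swap_pow b c]
    generalize (b * c) ^ m = X
    refine Iff.trans eq_comm (rel_conj (b * c * a * b) (b⁻¹ * a⁻¹ * (b * c)⁻¹) ?_ ?_)
    · group
    · group
  · rw [altK_odd, altK_odd, swap_pow_odd b c]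
    have h : ¬ (2 * m + 1) % 2 = 0 := by omega
    have h' : (2 * m + 1) / 2 = m := by omega
    simp only [uTwo, wTwo, h, h', if_false]
    have hc : (b * c) * (b * c) ^ m = (b * c) ^ m * (b * c) := (Commute.pow_right rfl m).eq
    try rw [pow_succ]
    generalize (b * c) ^ m = X at *
    rw [← hc]
    refine rel_conj (b) (b⁻¹ * a⁻¹ * (b * c)⁻¹) ?_ ?_
    · group
    · group

lemma rel_three (M : ℕ) (a b c : K) : altK c a M = altK a c M ↔
    (b * c * a) * uThree M (a * b) (b * c) (c * a) * (b * c * a)⁻¹ =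
      wThree M (a * b) (b * c) (c * a) := by
  rcases Nat.even_or_odd' M with ⟨m, rfl | rfl⟩
  · have h : (2 * m) % 2 = 0 := by omega
    have h' : 2 * m / 2 = m := by omega
    simp only [altK_even, uThree, wThree, h, h', if_true]
    rw [swap_pow a c]
    generalize (a * c) ^ m = X
    refine Iff.trans eq_comm (rel_conj (b * c) ((b * c)⁻¹) ?_ ?_)
    · group
    · group
  · rw [altK_odd, altK_odd, swap_pow_odd c a]
    have h : ¬ (2 * m + 1) % 2 = 0 := by omega
    have h' : (2 * m + 1) / 2 = m := by omega
    simp only [uThree, wThree, h, h', if_false]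
    have hc : (c * a) * (c * a) ^ m = (c * a) ^ m * (c * a) := (Commute.pow_right rfl m).eq
    try rw [pow_succ]
    generalize (c * a) ^ m = X at *
    refine Iff.trans eq_comm (rel_conj (b * c) (c⁻¹ * b⁻¹ * a⁻¹ * (b * c)⁻¹) ?_ ?_)
    · group
    · group

end GroupLemmas

/-! ### The index two subgroup -/

def jGen : Fin 7 → FreeGroup (Fin 4) :=
  ![FreeGroup.of 0 * FreeGroup.of 0, FreeGroup.of 1, FreeGroup.of 2, FreeGroup.of 3,
    FreeGroup.of 0 * FreeGroup.of 1 * (FreeGroup.of 0)⁻¹,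
    FreeGroup.of 0 * FreeGroup.of 2 * (FreeGroup.of 0)⁻¹,
    FreeGroup.of 0 * FreeGroup.of 3 * (FreeGroup.of 0)⁻¹]

def jHom : FreeGroup (Fin 7) →* FreeGroup (Fin 4) := FreeGroup.lift jGen

/-- If a hom from a free group acts by left translations on some fibre, it is injective. -/
lemma injective_of_action {α V : Type} {H : Type} [Group H] (f : FreeGroup α →* H)
    (ρ : H →* Equiv.Perm (V × FreeGroup α)) (p : V)
    (h : ∀ k g, ρ (f (FreeGroup.of k)) (p, g) = (p, FreeGroup.of k * g)) :
    Function.Injective f := by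
  have key : ∀ w g, ρ (f w) (p, g) = (p, w * g) := by
    intro w
    induction w using FreeGroup.induction_on with
    | C1 => intro g; simp
    | of k => exact h k
    | inv_of k _ =>
      intro g
      rw [map_inv, map_inv, Equiv.Perm.inv_eq_iff_eq, h]
      simp
    | mul x y hx hy =>
      intro g
      rw [map_mul, map_mul, Equiv.Perm.mul_apply, hy, hx, mul_assoc]
  rw [injective_iff_map_eq_one]
  intro w hw
  have := key w 1
  rw [hw] at this
  simpa using this.symm

/-- The skew product permutation. -/
def skew {V G : Type} [Group G] (σ : Equiv.Perm V) (c : V → G) : Equiv.Perm (V × G) where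
  toFun q := (σ q.1, c q.1 * q.2)
  invFun q := (σ.symm q.1, (c (σ.symm q.1))⁻¹ * q.2)
  left_inv q := by simp
  right_inv q := by simp

lemma skew_apply {V G : Type} [Group G] (σ : Equiv.Perm V) (c : V → G) (v : V) (g : G) :
    skew σ c (v, g) = (σ v, c v * g) := rfl

def jAct : Fin 4 → Equiv.Perm (Bool × FreeGroup (Fin 7)) :=
  ![skew Equiv.boolNot (fun b => bif b then FreeGroup.of 0 else 1),
    skew 1 (fun b => bif b then (FreeGroup.of 0)⁻¹ * FreeGroup.of 4 * FreeGroup.of 0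
      else FreeGroup.of 1),
    skew 1 (fun b => bif b then (FreeGroup.of 0)⁻¹ * FreeGroup.of 5 * FreeGroup.of 0
      else FreeGroup.of 2),
    skew 1 (fun b => bif b then (FreeGroup.of 0)⁻¹ * FreeGroup.of 6 * FreeGroup.of 0
      else FreeGroup.of 3)]

lemma jHom_injective : Function.Injective jHom := by
  refine injective_of_action jHom (FreeGroup.lift jAct) false ?_
  have h0 : ∀ g, (jAct 0)⁻¹ (false, g) = (true, (FreeGroup.of 0)⁻¹ * g) := by
    intro g
    rw [Equiv.Perm.inv_eq_iff_eq]
    simp [jAct, skew_apply]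
  intro k g
  fin_cases k <;>
    simp only [jHom, jGen, FreeGroup.lift_apply_of] <;>
    simp [h0, -Equiv.Perm.coe_inv] <;>
    simp [jAct, skew_apply, mul_assoc]

lemma jHom_index : jHom.range.index = 2 := by
  rw [Subgroup.index_eq_two_iff']
  refine ⟨FreeGroup.of 0, ?_⟩
  have ht : FreeGroup.of 0 * FreeGroup.of 0 ∈ jHom.range := ⟨FreeGroup.of 0, by simp [jHom, jGen]⟩
  have hu : ∀ k : Fin 4, k ≠ 0 → FreeGroup.of k ∈ jHom.range := by
    intro k hk
    fin_cases k
    · exact absurd rfl hk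
    · exact ⟨FreeGroup.of 1, by simp [jHom, jGen]⟩
    · exact ⟨FreeGroup.of 2, by simp [jHom, jGen]⟩
    · exact ⟨FreeGroup.of 3, by simp [jHom, jGen]⟩
  have hw : ∀ k : Fin 4, k ≠ 0 →
      FreeGroup.of 0 * FreeGroup.of k * (FreeGroup.of 0)⁻¹ ∈ jHom.range := by
    intro k hk
    fin_cases k
    · exact absurd rfl hk
    · exact ⟨FreeGroup.of 4, by simp [jHom, jGen]⟩
    · exact ⟨FreeGroup.of 5, by simp [jHom, jGen]⟩
    · exact ⟨FreeGroup.of 6, by simp [jHom, jGen]⟩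
  have step : ∀ (k : Fin 4) (w : FreeGroup (Fin 4)), (FreeGroup.of 0 * w ∈ jHom.range ∨ w ∈ jHom.range) →
      (FreeGroup.of 0 * (FreeGroup.of k * w) ∈ jHom.range ∨ FreeGroup.of k * w ∈ jHom.range) := by
    intro k w h
    by_cases hk : k = 0
    · subst hk
      rcases h with h | h
      · exact Or.inr h
      · left; rw [← mul_assoc]; exact mul_mem ht h
    · rcases h with h | h
      · left
        have := mul_mem (hw k hk) h
        simpa [mul_assoc] using this
      · right; exact mul_mem (hu k hk) h
  have step' : ∀ (k : Fin 4) (w : FreeGroup (Fin 4)), (FreeGroup.of 0 * w ∈ jHom.range ∨ w ∈ jHom.range) →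
      (FreeGroup.of 0 * ((FreeGroup.of k)⁻¹ * w) ∈ jHom.range ∨ (FreeGroup.of k)⁻¹ * w ∈ jHom.range) := by
    intro k w h
    by_cases hk : k = 0
    · subst hk
      rcases h with h | h
      · right
        have := mul_mem (inv_mem ht) h
        simpa [mul_assoc] using this
      · left; simpa using h
    · rcases h with h | h
      · left
        have := mul_mem (inv_mem (hw k hk)) h
        simpa [mul_assoc] using this
      · right; exact mul_mem (inv_mem (hu k hk)) h
  have all : ∀ v w : FreeGroup (Fin 4), (FreeGroup.of 0 * w ∈ jHom.range ∨ w ∈ jHom.range) →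
      (FreeGroup.of 0 * (v * w) ∈ jHom.range ∨ v * w ∈ jHom.range) := by
    intro v
    induction v using FreeGroup.induction_on with
    | C1 => intro w h; simpa using h
    | of k => exact step k
    | inv_of k _ => exact step' k
    | mul x y hx hy => intro w h; rw [mul_assoc]; exact hx _ (hy _ h)
  let ε : FreeGroup (Fin 4) →* Multiplicative (ZMod 2) :=
    FreeGroup.lift ![Multiplicative.ofAdd 1, 1, 1, 1]
  have hε : ∀ x ∈ jHom.range, ε x = 1 := by
    rintro _ ⟨w, rfl⟩
    have : ε.comp jHom = 1 := by
      ext k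
      fin_cases k <;> simp [ε, jHom, jGen] <;> decide
    exact DFunLike.congr_fun this w
  intro b
  have hb := all b 1 (Or.inr (one_mem _))
  rw [mul_one] at hb
  have hne : ¬ (FreeGroup.of 0 * b ∈ jHom.range ∧ b ∈ jHom.range) := by
    rintro ⟨h1, h2⟩
    have h1 := hε _ h1
    rw [map_mul, hε _ h2] at h1
    have : ε (FreeGroup.of 0) = Multiplicative.ofAdd 1 := by simp [ε]
    rw [this] at h1
    revert h1; decide
  unfold Xor
  tauto

/-! ### Combinatorics of cycles -/

/-- the cyclic permutation of `[lo, hi]` -/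
def cyc (lo hi : ℕ) : Equiv.Perm ℕ where
  toFun k := if lo ≤ k ∧ k < hi then k + 1 else if k = hi ∧ lo ≤ hi then lo else k
  invFun k := if lo < k ∧ k ≤ hi then k - 1 else if k = lo ∧ lo ≤ hi then hi else k
  left_inv k := by grind
  right_inv k := by grind

lemma run_pow {V G : Type} [Group G] (σ : Equiv.Perm V) (c : V → G) (f : ℕ → V) (n : ℕ)
    (hf : ∀ k < n, σ (f k) = f (k + 1)) (hc : ∀ k, 0 < k → k < n → c (f k) = 1) (hn : 0 < n)
    (g : G) : (skew σ c ^ n) (f 0, g) = (f n, c (f 0) * g) := by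
  have : ∀ k, k + 1 ≤ n → (skew σ c ^ (k + 1)) (f 0, g) = (f (k + 1), c (f 0) * g) := by
    intro k
    induction k with
    | zero => intro h; simp [skew_apply, hf 0 (by omega)]
    | succ k ih =>
      intro h
      rw [pow_succ', Equiv.Perm.mul_apply, ih (by omega), skew_apply, hf _ (by omega),
        hc _ (by omega) (by omega), one_mul]
  obtain ⟨k, rfl⟩ : ∃ k, n = k + 1 := ⟨n - 1, by omega⟩
  exact this k le_rfl

lemma exists_move (e f : Fin 3 → ℕ) (he : Function.Injective e) (hf : Function.Injective f) :
    ∃ τ : Equiv.Perm ℕ, ∀ k, τ (e k) = f k := by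
  have : MulAction.IsMultiplyPretransitive (Equiv.Perm ℕ) ℕ 3 :=
    Equiv.Perm.isMultiplyPretransitive ℕ 3
  obtain ⟨τ, hτ⟩ := MulAction.exists_smul_eq (Equiv.Perm ℕ)
    (⟨e, he⟩ : Fin 3 ↪ ℕ) (⟨f, hf⟩ : Fin 3 ↪ ℕ)
  exact ⟨τ, fun k => DFunLike.congr_fun hτ k⟩

/-- moving vertices -/
def moveV {G : Type} (X : Equiv.Perm (ℕ × G)) (τ : Equiv.Perm ℕ) : Equiv.Perm (ℕ × G) :=
  (Equiv.prodCongr τ (Equiv.refl G)) * X * (Equiv.prodCongr τ (Equiv.refl G) : Equiv.Perm (ℕ × G))⁻¹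

lemma moveV_pow {G : Type} (X : Equiv.Perm (ℕ × G)) (τ : Equiv.Perm ℕ) (n : ℕ) (v w : ℕ)
    (g h : G) (hX : (X ^ n) (v, g) = (w, h)) :
    (moveV X τ ^ n) (τ v, g) = (τ w, h) := by
  rw [moveV, conj_pow]
  have : (Equiv.prodCongr τ (Equiv.refl G) : Equiv.Perm (ℕ × G))⁻¹ (τ v, g) = (v, g) := by
    rw [Equiv.Perm.inv_eq_iff_eq]; simp
  rw [Equiv.Perm.mul_apply, Equiv.Perm.mul_apply, this, hX]
  simp

lemma odd_lemma {G : Type} [Group G] (m : ℕ) (hm : 1 ≤ m) (e : Fin 3 → ℕ)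
    (he : Function.Injective e) (g0 g1 g2 : G) :
    ∃ X : Equiv.Perm (ℕ × G), (∀ h, X (e 0, h) = (e 1, g0 * h)) ∧
      (∀ h, (X ^ m) (e 1, h) = (e 2, g1 * h)) ∧ (∀ h, (X ^ m) (e 2, h) = (e 0, g2 * h)) := by
  obtain ⟨τ, hτ⟩ := exists_move ![2 * m, 0, m] e (by
    intro i j; fin_cases i <;> fin_cases j <;> simp <;> omega) he
  have h0 := hτ 0
  have h1 := hτ 1
  have h2 := hτ 2
  simp at h0 h1 h2
  let c : ℕ → G := fun k => if k = 2 * m then g0 else if k = 0 then g1 else if k = m then g2 else 1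
  have c0 : c (2 * m) = g0 := by simp [c]
  have c1 : c 0 = g1 := by simp only [c]; rw [if_neg (by omega)]; simp
  have c2 : c m = g2 := by
    simp only [c]; rw [if_neg (by omega), if_neg (by omega)]; simp
  refine ⟨moveV (skew (cyc 0 (2 * m)) c) τ, fun h => ?_, fun h => ?_, fun h => ?_⟩
  rotate_left
  · rw [← h1, ← h2]
    refine moveV_pow (skew (cyc 0 (2 * m)) c) τ m _ _ _ _ ?_
    have := run_pow (cyc 0 (2 * m)) c (fun k => k) m (fun k hk => by simp [cyc]; omega)
      (fun k hk hk' => by simp only [c]; grind) hm h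
    rw [this, c1]
  · rw [← h0, ← h2]
    refine moveV_pow (skew (cyc 0 (2 * m)) c) τ m _ _ _ _ ?_
    have := run_pow (cyc 0 (2 * m)) c (fun k => m + k) m
      (fun k hk => by simp only [cyc, Equiv.coe_fn_mk]; grind)
      (fun k hk hk' => by simp only [c]; grind) hm h
    simp only [add_zero] at this
    rw [this, c2, two_mul]
  · rw [← h0, ← h1]
    have := moveV_pow (skew (cyc 0 (2 * m)) c) τ 1 (2 * m) 0 h (g0 * h) (by
      simp [skew_apply, c0, cyc])
    simpa using this

lemma even_lemma {G : Type} [Group G] (m : ℕ) (hm : 2 ≤ m) (e : Fin 3 → ℕ)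
    (he : Function.Injective e) (g0 g1 g2 : G) :
    ∃ X : Equiv.Perm (ℕ × G), (∀ h, X (e 0, h) = (e 1, g0 * h)) ∧
      (∀ h, (X ^ m) (e 1, h) = (e 1, g1 * h)) ∧ (∀ h, (X ^ m) (e 2, h) = (e 2, g2 * h)) := by
  obtain ⟨τ, hτ⟩ := exists_move ![m - 1, 0, m] e (by
    intro i j; fin_cases i <;> fin_cases j <;> simp <;> omega) he
  have h0 := hτ 0
  have h1 := hτ 1
  have h2 := hτ 2
  simp at h0 h1 h2
  let c : ℕ → G := fun k => if k = m - 1 then g0 else if k = 0 then g0⁻¹ * g1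
    else if k = m then g2 else 1
  have c0 : c (m - 1) = g0 := by simp [c]
  have c1 : c 0 = g0⁻¹ * g1 := by simp only [c]; rw [if_neg (by omega)]; simp
  have c2 : c m = g2 := by
    simp only [c]; rw [if_neg (by omega), if_neg (by omega)]; simp
  let σ : Equiv.Perm ℕ := cyc 0 (m - 1) * cyc m (2 * m - 1)
  have hσ : ∀ k, σ k = if k < m - 1 then k + 1 else if k = m - 1 then 0 else
      if k < 2 * m - 1 then k + 1 else if k = 2 * m - 1 then m else k := by
    intro k
    simp only [σ, Equiv.Perm.mul_apply, cyc, Equiv.coe_fn_mk]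
    grind
  refine ⟨moveV (skew σ c) τ, fun h => ?_, fun h => ?_, fun h => ?_⟩
  rotate_left
  · rw [← h1]
    refine moveV_pow (skew σ c) τ m _ _ _ _ ?_
    have := run_pow σ c (fun k => k) (m - 1) (fun k hk => by simp [hσ]; omega)
      (fun k hk hk' => by simp only [c]; grind) (by omega) h
    have hm' : m = (m - 1) + 1 := by omega
    conv_lhs => rw [hm']
    rw [pow_succ', Equiv.Perm.mul_apply, this, c1, skew_apply, c0]
    simp [hσ, mul_assoc]
  · rw [← h2]
    refine moveV_pow (skew σ c) τ m _ _ _ _ ?_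
    have := run_pow σ c (fun k => if k = m then m else m + k) m
      (fun k hk => by simp only [hσ]; grind)
      (fun k hk hk' => by simp only [c]; grind) (by omega) h
    have h0m : (0 : ℕ) ≠ m := by omega
    simp only [h0m, if_false, if_true, add_zero] at this
    rw [this, c2]
  · rw [← h0, ← h1]
    have := moveV_pow (skew σ c) τ 1 (m - 1) 0 h (g0 * h) (by
      simp [skew_apply, c0, hσ])
    simpa using this

/-! ### The rank seven subgroup of the free group of rank three -/

section Actions
variable {G : Type} [Group G]

lemma inv_app {X : Equiv.Perm (ℕ × G)} {u v : ℕ} {g : G} (h : ∀ k, X (u, k) = (v, g * k)) (k : G) :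
    X⁻¹ (v, k) = (u, g⁻¹ * k) := by
  rw [Equiv.Perm.inv_eq_iff_eq, h, mul_inv_cancel_left]

lemma act_one (M : ℕ) (hM : 3 ≤ M) (s v w : G) : ∃ X : Equiv.Perm (ℕ × G),
    (∀ h, X (2, h) = (1, 1 * h)) ∧ ∀ Y Z : Equiv.Perm (ℕ × G),
      (∀ h, Y (1, h) = (0, 1 * h)) → (∀ h, Z (0, h) = (2, s * h)) →
      ∀ h, uOne M X Y Z (0, h) = (0, v * h) ∧ wOne M X Y Z (0, h) = (0, w * h) := by
  rcases Nat.even_or_odd' M with ⟨m, rfl | rfl⟩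
  · obtain ⟨X, h0, h1, h2⟩ := even_lemma m (by omega) ![2, 1, 0] (by decide) 1 w v
    simp only [Matrix.cons_val] at h0 h1 h2
    refine ⟨X, h0, fun Y Z hY hZ h => ?_⟩
    have hp : (2 * m) % 2 = 0 := by omega
    have hp' : 2 * m / 2 = m := by omega
    simp only [uOne, wOne, hp, hp', if_true, Equiv.Perm.mul_apply, inv_app hY, hY, h0, h1, h2]
    simp
  · obtain ⟨X, h0, h1, h2⟩ := odd_lemma m (by omega) ![2, 1, 0] (by decide) 1 v (w * s)
    simp only [Matrix.cons_val] at h0 h1 h2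
    refine ⟨X, h0, fun Y Z hY hZ h => ?_⟩
    have hp : ¬ (2 * m + 1) % 2 = 0 := by omega
    have hp' : (2 * m + 1) / 2 = m := by omega
    simp only [uOne, wOne, hp, hp', if_false, pow_succ', Equiv.Perm.mul_apply, inv_app hY, hY,
      inv_app h0, inv_app hZ, h0, h1, h2]
    simp [mul_assoc]

lemma act_two (M : ℕ) (hM : 3 ≤ M) (s v w : G) : ∃ Y : Equiv.Perm (ℕ × G),
    (∀ h, Y (1, h) = (0, 1 * h)) ∧ ∀ X Z : Equiv.Perm (ℕ × G),
      (∀ h, X (2, h) = (1, 1 * h)) → (∀ h, Z (0, h) = (2, s * h)) →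
      ∀ h, uTwo M X Y Z (0, h) = (0, v * h) ∧ wTwo M X Y Z (0, h) = (0, w * h) := by
  rcases Nat.even_or_odd' M with ⟨m, rfl | rfl⟩
  · obtain ⟨Y, h0, h1, h2⟩ := even_lemma m (by omega) ![1, 0, 2] (by decide) 1 v w
    simp only [Matrix.cons_val] at h0 h1 h2
    refine ⟨Y, h0, fun X Z hX hZ h => ?_⟩
    have hp : (2 * m) % 2 = 0 := by omega
    have hp' : 2 * m / 2 = m := by omega
    simp only [uTwo, wTwo, hp, hp', if_true, Equiv.Perm.mul_apply, inv_app hX, hX, inv_app h0,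
      h0, h1, h2]
    simp
  · obtain ⟨Y, h0, h1, h2⟩ := odd_lemma m (by omega) ![1, 0, 2] (by decide) 1 (s * v) w
    simp only [Matrix.cons_val] at h0 h1 h2
    refine ⟨Y, h0, fun X Z hX hZ h => ?_⟩
    have hp : ¬ (2 * m + 1) % 2 = 0 := by omega
    have hp' : (2 * m + 1) / 2 = m := by omega
    simp only [uTwo, wTwo, hp, hp', if_false, pow_succ', Equiv.Perm.mul_apply, inv_app hX, hX,
      inv_app h0, inv_app hZ, h0, h1, h2]
    simp [mul_assoc]

lemma act_three (M : ℕ) (hM : 3 ≤ M) (s v w : G) : ∃ Z : Equiv.Perm (ℕ × G),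
    (∀ h, Z (0, h) = (2, s * h)) ∧ ∀ X Y : Equiv.Perm (ℕ × G),
      (∀ h, X (2, h) = (1, 1 * h)) → (∀ h, Y (1, h) = (0, 1 * h)) →
      ∀ h, uThree M X Y Z (0, h) = (0, v * h) ∧ wThree M X Y Z (0, h) = (0, w * h) := by
  rcases Nat.even_or_odd' M with ⟨m, rfl | rfl⟩
  · obtain ⟨Z, h0, h1, h2⟩ := even_lemma m (by omega) ![0, 2, 1] (by decide) s (s * v * s⁻¹) w
    simp only [Matrix.cons_val] at h0 h1 h2
    refine ⟨Z, h0, fun X Y hX hY h => ?_⟩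
    have hp : (2 * m) % 2 = 0 := by omega
    have hp' : 2 * m / 2 = m := by omega
    have h3 : ∀ h, (Z ^ m) (0, h) = (0, v * h) := by
      intro h
      have hc : Z ((Z ^ m) (0, h)) = (Z ^ m) (Z (0, h)) := by
        rw [← Equiv.Perm.mul_apply, ← Equiv.Perm.mul_apply, ← pow_succ, ← pow_succ']
      apply Z.injective
      rw [hc, h0, h1, h0]
      simp [mul_assoc]
    simp only [uThree, wThree, hp, hp', if_true, Equiv.Perm.mul_apply, inv_app hY, hY,
      h2, h3]
    simp
  · obtain ⟨Z, h0, h1, h2⟩ := odd_lemma m (by omega) ![0, 2, 1] (by decide) s w v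
    simp only [Matrix.cons_val] at h0 h1 h2
    refine ⟨Z, h0, fun X Y hX hY h => ?_⟩
    have hp : ¬ (2 * m + 1) % 2 = 0 := by omega
    have hp' : (2 * m + 1) / 2 = m := by omega
    simp only [uThree, wThree, hp, hp', if_false, Equiv.Perm.mul_apply, inv_app hX, hY,
      inv_app hY, h1, h2]
    simp

end Actions

/-- The images of the seven generators, as words in `x, y, z`. -/
def iWords {K : Type*} [Group K] (M N P : ℕ) (x y z : K) : Fin 7 → K :=
  ![y * x * z, uOne M x y z, uTwo N x y z, uThree P x y z,
    wOne M x y z, wTwo N x y z, wThree P x y z]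

lemma map_iWords {K L : Type*} [Group K] [Group L] (f : K →* L) (M N P : ℕ) (x y z : K)
    (k : Fin 7) : f (iWords M N P x y z k) = iWords M N P (f x) (f y) (f z) k := by
  fin_cases k <;>
    simp [iWords, map_uOne, map_uTwo, map_uThree, map_wOne, map_wTwo, map_wThree]

def iHom (M N P : ℕ) : FreeGroup (Fin 7) →* FreeGroup (Fin 3) :=
  FreeGroup.lift (iWords M N P (FreeGroup.of 0) (FreeGroup.of 1) (FreeGroup.of 2))

lemma iHom_of (M N P : ℕ) (k : Fin 7) : iHom M N P (FreeGroup.of k) =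
    iWords M N P (FreeGroup.of 0) (FreeGroup.of 1) (FreeGroup.of 2) k :=
  FreeGroup.lift_apply_of

lemma jHom_of (k : Fin 7) : jHom (FreeGroup.of k) = jGen k := FreeGroup.lift_apply_of

lemma iHom_injective (M N P : ℕ) (hM : 3 ≤ M) (hN : 3 ≤ N) (hP : 3 ≤ P) :
    Function.Injective (iHom M N P) := by
  let s : FreeGroup (Fin 7) := FreeGroup.of 0
  obtain ⟨X, hX, aX⟩ := act_one M hM s (FreeGroup.of (1 : Fin 7)) (FreeGroup.of 4)
  obtain ⟨Y, hY, aY⟩ := act_two N hN s (FreeGroup.of (2 : Fin 7)) (FreeGroup.of 5)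
  obtain ⟨Z, hZ, aZ⟩ := act_three P hP s (FreeGroup.of (3 : Fin 7)) (FreeGroup.of 6)
  refine injective_of_action (iHom M N P) (FreeGroup.lift ![X, Y, Z]) 0 ?_
  intro k g
  have h1 := aX Y Z hY hZ g
  have h2 := aY X Z hX hZ g
  have h3 := aZ X Y hX hY g
  rw [iHom, FreeGroup.lift_apply_of, map_iWords]
  simp only [FreeGroup.lift_apply_of, Matrix.cons_val]
  fin_cases k
  · simp [iWords, hX, hY, hZ, s]
  · exact h1.1
  · exact h2.1
  · exact h3.1
  · exact h1.2
  · exact h2.2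
  · exact h3.2

/-! ### The isomorphism -/

section Iso
variable (M N P : ℕ)

abbrev Amal : Type := AmalgamatedProduct (iHom M N P) jHom

def inA : FreeGroup (Fin 3) →* Amal M N P :=
  Monoid.PushoutI.of (φ := twoMaps (iHom M N P) jHom) true
def inB : FreeGroup (Fin 4) →* Amal M N P :=
  Monoid.PushoutI.of (φ := twoMaps (iHom M N P) jHom) false

lemma in_eq (w : FreeGroup (Fin 7)) : inA M N P (iHom M N P w) = inB M N P (jHom w) :=
  (Monoid.PushoutI.of_apply_eq_base (twoMaps (iHom M N P) jHom) true w).trans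
    (Monoid.PushoutI.of_apply_eq_base (twoMaps (iHom M N P) jHom) false w).symm

lemma in_eq_gen (k : Fin 7) :
    iWords M N P (inA M N P (FreeGroup.of 0)) (inA M N P (FreeGroup.of 1))
      (inA M N P (FreeGroup.of 2)) k = inB M N P (jGen k) := by
  have := in_eq M N P (FreeGroup.of k)
  rwa [iHom_of, jHom_of, map_iWords] at this

lemma amal_hom_ext {K : Type*} [Group K] {f g : Amal M N P →* K}
    (hA : ∀ k, f (inA M N P (FreeGroup.of k)) = g (inA M N P (FreeGroup.of k)))
    (hB : ∀ k, f (inB M N P (FreeGroup.of k)) = g (inB M N P (FreeGroup.of k))) : f = g := by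
  apply Monoid.PushoutI.hom_ext_nonempty
  intro b
  cases b with
  | false => exact FreeGroup.ext_hom _ _ hB
  | true => exact FreeGroup.ext_hom _ _ hA

def amalFam {K : Type*} [Group K] (f : FreeGroup (Fin 3) →* K) (g : FreeGroup (Fin 4) →* K) :
    ∀ b, twoFam (FreeGroup (Fin 3)) (FreeGroup (Fin 4)) b →* K
  | false => g
  | true => f

lemma amalFam_comp {K : Type*} [Group K] (f : FreeGroup (Fin 3) →* K) (g : FreeGroup (Fin 4) →* K)
    (h : f.comp (iHom M N P) = g.comp jHom) :
    ∀ b, (amalFam f g b).comp (twoMaps (iHom M N P) jHom b) = g.comp jHom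
  | false => rfl
  | true => h

lemma exists_amalLift {K : Type*} [Group K] (f : FreeGroup (Fin 3) →* K)
    (g : FreeGroup (Fin 4) →* K) (h : f.comp (iHom M N P) = g.comp jHom) :
    ∃ F : Amal M N P →* K, (∀ w, F (inA M N P w) = f w) ∧ (∀ w, F (inB M N P w) = g w) := by
  refine ⟨Monoid.PushoutI.lift (amalFam f g) (g.comp jHom) (amalFam_comp M N P f g h), ?_, ?_⟩
  · exact fun w => Monoid.PushoutI.lift_of (amalFam f g) (g.comp jHom)
      (amalFam_comp M N P f g h) (i := true) w
  · exact fun w => Monoid.PushoutI.lift_of (amalFam f g) (g.comp jHom)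
      (amalFam_comp M N P f g h) (i := false) w

def artinGen (k : Fin 3) : Artin3 M N P := PresentedGroup.of k

lemma artin_rels :
    altK (artinGen M N P 0) (artinGen M N P 1) M = altK (artinGen M N P 1) (artinGen M N P 0) M ∧
    altK (artinGen M N P 1) (artinGen M N P 2) N = altK (artinGen M N P 2) (artinGen M N P 1) N ∧
    altK (artinGen M N P 2) (artinGen M N P 0) P = altK (artinGen M N P 0) (artinGen M N P 2) P := by
  have key : ∀ (i j : Fin 3) (n : ℕ), altWord i j n * (altWord j i n)⁻¹ ∈ artinRels3 M N P →
      altK (artinGen M N P i) (artinGen M N P j) n = altK (artinGen M N P j) (artinGen M N P i) n := by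
    intro i j n h
    have := PresentedGroup.one_of_mem h
    rw [map_mul, map_inv, mul_inv_eq_one, map_altWord, map_altWord] at this
    exact this
  refine ⟨key _ _ _ ?_, key _ _ _ ?_, key _ _ _ ?_⟩ <;> simp [artinRels3]

/-- The map from the amalgam to the Artin group. -/
lemma exists_back : ∃ F : Amal M N P →* Artin3 M N P,
    F (inA M N P (FreeGroup.of 0)) = artinGen M N P 0 * artinGen M N P 1 ∧
    F (inA M N P (FreeGroup.of 1)) = artinGen M N P 1 * artinGen M N P 2 ∧
    F (inA M N P (FreeGroup.of 2)) = artinGen M N P 2 * artinGen M N P 0 ∧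
    F (inB M N P (FreeGroup.of 0)) = artinGen M N P 1 * artinGen M N P 2 * artinGen M N P 0 := by
  obtain ⟨r1, r2, r3⟩ := artin_rels M N P
  rw [rel_one _ _ _ (artinGen M N P 2)] at r1
  rw [rel_two _ (artinGen M N P 0)] at r2
  rw [rel_three _ _ (artinGen M N P 1)] at r3
  generalize artinGen M N P 0 = a at *
  generalize artinGen M N P 1 = b at *
  generalize artinGen M N P 2 = c at *
  let f : FreeGroup (Fin 3) →* Artin3 M N P := FreeGroup.lift ![a * b, b * c, c * a]
  let g : FreeGroup (Fin 4) →* Artin3 M N P := FreeGroup.lift ![b * c * a,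
    uOne M (a * b) (b * c) (c * a), uTwo N (a * b) (b * c) (c * a), uThree P (a * b) (b * c) (c * a)]
  have h : f.comp (iHom M N P) = g.comp jHom := by
    ext k
    simp only [MonoidHom.comp_apply, iHom, jHom, FreeGroup.lift_apply_of, map_iWords]
    simp only [f, FreeGroup.lift_apply_of, Matrix.cons_val]
    fin_cases k <;> simp only [iWords, jGen, g] <;> simp [mul_assoc]
    · simpa [mul_assoc] using r1.symm
    · simpa [mul_assoc] using r2.symm
    · simpa [mul_assoc] using r3.symm
  obtain ⟨F, hFA, hFB⟩ := exists_amalLift M N P f g h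
  refine ⟨F, ?_, ?_, ?_, ?_⟩
  · rw [hFA]; simp [f]
  · rw [hFA]; simp [f]
  · rw [hFA]; simp [f]
  · rw [hFB]; simp [g]

theorem iso_exists : Nonempty (Artin3 M N P ≃* Amal M N P) := by
  obtain ⟨F, Fx, Fy, Fz, Ft⟩ := exists_back M N P
  have e := in_eq_gen M N P
  have e0 := e 0
  have e1 := e 1
  have e2 := e 2
  have e3 := e 3
  have e4 := e 4
  have e5 := e 5
  have e6 := e 6
  simp only [iWords, jGen, Matrix.cons_val, map_mul, map_inv] at e0 e1 e2 e3 e4 e5 e6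
  rw [← e1] at e4
  rw [← e2] at e5
  rw [← e3] at e6
  generalize hx : inA M N P (FreeGroup.of 0) = x at *
  generalize hy : inA M N P (FreeGroup.of 1) = y at *
  generalize hz : inA M N P (FreeGroup.of 2) = z at *
  generalize ht : inB M N P (FreeGroup.of 0) = t at *
  obtain ⟨a, ha⟩ : ∃ a, a = y⁻¹ * t := ⟨_, rfl⟩
  obtain ⟨b, hb⟩ : ∃ b, b = t * z⁻¹ := ⟨_, rfl⟩
  obtain ⟨c, hc⟩ : ∃ c, c = z * t⁻¹ * y := ⟨_, rfl⟩
  have hab : x = a * b := by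
    have : a * b = y⁻¹ * (t * t) * z⁻¹ := by rw [ha, hb]; group
    rw [this, ← e0]; group
  have hbc : y = b * c := by rw [hb, hc]; group
  have hca : z = c * a := by rw [hc, ha]; group
  have hbca : t = b * c * a := by rw [← hbc, ha]; group
  have r1 : altK a b M = altK b a M := by
    rw [rel_one M a b c, ← hbca, ← hab, ← hbc, ← hca]; exact e4.symm
  have r2 : altK b c N = altK c b N := by
    rw [rel_two N a b c, ← hbca, ← hab, ← hbc, ← hca]; exact e5.symm
  have r3 : altK c a P = altK a c P := by
    rw [rel_three P a b c, ← hbca, ← hab, ← hbc, ← hca]; exact e6.symm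
  have hrel : ∀ r ∈ artinRels3 M N P, FreeGroup.lift ![a, b, c] r = 1 := by
    intro r hr
    simp only [artinRels3, Set.mem_insert_iff, Set.mem_singleton_iff] at hr
    rcases hr with rfl | rfl | rfl <;>
      rw [map_mul, map_inv, mul_inv_eq_one, map_altWord, map_altWord]
    · simpa using r1
    · simpa using r2
    · simpa using r3
  let Φ : Artin3 M N P →* Amal M N P := PresentedGroup.toGroup hrel
  have Φa : Φ (artinGen M N P 0) = a := by
    simp only [Φ, artinGen]; rw [PresentedGroup.toGroup.of]; rfl
  have Φb : Φ (artinGen M N P 1) = b := by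
    simp only [Φ, artinGen]; rw [PresentedGroup.toGroup.of]; rfl
  have Φc : Φ (artinGen M N P 2) = c := by
    simp only [Φ, artinGen]; rw [PresentedGroup.toGroup.of]; rfl
  refine ⟨MonoidHom.toMulEquiv Φ F ?_ ?_⟩
  · apply PresentedGroup.ext
    intro k
    change F (Φ (artinGen M N P k)) = artinGen M N P k
    fin_cases k
    · change F (Φ (artinGen M N P 0)) = artinGen M N P 0
      rw [Φa, ha, map_mul, map_inv, Fy, Ft]; group
    · change F (Φ (artinGen M N P 1)) = artinGen M N P 1
      rw [Φb, hb, map_mul, map_inv, Fz, Ft]; group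
    · change F (Φ (artinGen M N P 2)) = artinGen M N P 2
      rw [Φc, hc, map_mul, map_mul, map_inv, Fz, Ft, Fy]; group
  · have gx : Φ (F x) = x := by rw [Fx, map_mul, Φa, Φb, hab]
    have gy : Φ (F y) = y := by rw [Fy, map_mul, Φb, Φc, hbc]
    have gz : Φ (F z) = z := by rw [Fz, map_mul, Φc, Φa, hca]
    have gt : Φ (F t) = t := by rw [Ft, map_mul, map_mul, Φa, Φb, Φc, hbca]
    have key : ∀ w, Φ (F w) = (Φ.comp F) w := fun w => rfl
    apply amal_hom_ext
    · intro k
      change Φ (F _) = _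
      fin_cases k
      · change Φ (F (inA M N P (FreeGroup.of 0))) = inA M N P (FreeGroup.of 0)
        rw [hx]; exact gx
      · change Φ (F (inA M N P (FreeGroup.of 1))) = inA M N P (FreeGroup.of 1)
        rw [hy]; exact gy
      · change Φ (F (inA M N P (FreeGroup.of 2))) = inA M N P (FreeGroup.of 2)
        rw [hz]; exact gz
    · intro k
      change Φ (F _) = _
      fin_cases k
      · change Φ (F (inB M N P (FreeGroup.of 0))) = inB M N P (FreeGroup.of 0)
        rw [ht]; exact gt
      · change Φ (F (inB M N P (FreeGroup.of 1))) = inB M N P (FreeGroup.of 1)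
        rw [← e1, key, map_uOne, ← key, ← key, ← key, gx, gy, gz]
      · change Φ (F (inB M N P (FreeGroup.of 2))) = inB M N P (FreeGroup.of 2)
        rw [← e2, key, map_uTwo, ← key, ← key, ← key, gx, gy, gz]
      · change Φ (F (inB M N P (FreeGroup.of 3))) = inB M N P (FreeGroup.of 3)
        rw [← e3, key, map_uThree, ← key, ← key, ← key, gx, gy, gz]

end Iso

theorem artin3_splits_as_amalgam (M N P : ℕ) (hM : 3 ≤ M) (hN : 3 ≤ N) (hP : 3 ≤ P) :
    ∃ (i : FreeGroup (Fin 7) →* FreeGroup (Fin 3))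
      (j : FreeGroup (Fin 7) →* FreeGroup (Fin 4)),
      Function.Injective i ∧ Function.Injective j ∧ j.range.index = 2 ∧
      Nonempty (Artin3 M N P ≃* AmalgamatedProduct i j) := by
  exact ⟨iHom M N P, jHom, iHom_injective M N P hM hN hP, jHom_injective, jHom_index,
    iso_exists M N P⟩
end

section
/- Let Γ be a finite connected simple graph whose edges are labelled by integers ≥ 2 and which admits an admissible partial orientation. If Γ is bipartite and all labels are even, then the Artin group Art_Γ is isomorphic to an HNN extension A*_B of a free group A of rank |E(Γ)| over a free group B of rank 1 − |V(Γ)| + 2|E(Γ)| (given by two injective homomorphisms B → A). Otherwise, Art_Γ is isomorphic to an amalgamated free product A *_C B where A is a free group of rank |E(Γ)|, B is a free group of rank 1 − |V(Γ)| + 2|E(Γ)|, and C is a free group of rank 1 − 2|V(Γ)| + 4|E(Γ)| embedding into A injectively and embedding into B as a subgroup of index 2. -/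
/-- The Artin relators of a labelled graph: one relator `(a,b)_{M a b} ((b,a)_{M a b})⁻¹`
for each edge `{a,b}` of `Γ`. -/
def artinRels {V : Type} (Γ : SimpleGraph V) (M : V → V → ℕ) : Set (FreeGroup V) :=
  {r | ∃ a b, Γ.Adj a b ∧ r = altWord a b (M a b) * (altWord b a (M a b))⁻¹}

/-- The Artin group of a labelled graph. -/
abbrev ArtinGroup {V : Type} (Γ : SimpleGraph V) (M : V → V → ℕ) : Type :=
  PresentedGroup (artinRels Γ M)

/-- `c : ZMod n → V` is a cycle in `Γ`: a closed walk with no backtracking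
(a combinatorial immersion of the `n`-cycle); it need not be embedded. -/
structure SimpleGraph.IsCycleMap {V : Type} (Γ : SimpleGraph V) {n : ℕ} (c : ZMod n → V) : Prop where
  adj : ∀ i, Γ.Adj (c i) (c (i + 1))
  no_backtrack : ∀ i, c (i + 2) ≠ c i

/-- `p 0, p 1, …, p k` is a path (walk without backtracking) of length `k` in `Γ`. -/
def SimpleGraph.IsPathMap {V : Type} (Γ : SimpleGraph V) (k : ℕ) (p : ℕ → V) : Prop :=
  (∀ i < k, Γ.Adj (p i) (p (i + 1))) ∧ (∀ i, i + 2 ≤ k → p (i + 2) ≠ p i)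

/-- A partial orientation of the edges of `Γ`: `D a b` means the edge `{a,b}` is
oriented with initial vertex `a`. -/
structure IsPartialOrientation {V : Type} (Γ : SimpleGraph V) (D : V → V → Prop) : Prop where
  adj : ∀ a b, D a b → Γ.Adj a b
  not_both : ∀ a b, ¬ (D a b ∧ D b a)

/-- The path `p 0, …, p k` in `Γ` is misdirected with respect to the partial orientation `D`:
it has length at least 2, and the partial orientation induced on its edges extends to a full
orientation of its edges (recorded by `s i = true` iff the `i`-th edge points from `p i` to
`p (i+1)`) in which every maximal directed subpath has length 1, i.e. the directions alternate. -/
def MisdirectedPath {V : Type} (Γ : SimpleGraph V) (D : V → V → Prop) (k : ℕ) (p : ℕ → V) :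
    Prop :=
  2 ≤ k ∧ Γ.IsPathMap k p ∧ ∃ s : ℕ → Bool,
    (∀ i, i + 1 < k → s (i + 1) = !(s i)) ∧
    (∀ i < k, (D (p i) (p (i + 1)) → s i = true) ∧ (D (p (i + 1)) (p i) → s i = false))

/-- The cycle `c : ZMod n → V` is almost misdirected with respect to `D`:
it can be written as `(a₁, …, aₙ, a₁)` where the path `(a₁, …, aₙ)` is misdirected. -/
def AlmostMisdirectedCycle {V : Type} (Γ : SimpleGraph V) (D : V → V → Prop)
    (n : ℕ) (c : ZMod n → V) : Prop :=
  Γ.IsCycleMap c ∧ MisdirectedPath Γ D (n - 1) (fun i => c (i : ZMod n))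

/-- An admissible partial orientation of a labelled graph: it is defined exactly on the
edges with label ≥ 3, and no cycle of `Γ` is almost misdirected. -/
structure IsAdmissibleOrientation {V : Type} (Γ : SimpleGraph V) (M : V → V → ℕ)
    (D : V → V → Prop) : Prop where
  adj : ∀ a b, D a b → Γ.Adj a b
  not_both : ∀ a b, ¬ (D a b ∧ D b a)
  defined_iff : ∀ a b, Γ.Adj a b → ((D a b ∨ D b a) ↔ 3 ≤ M a b)
  no_almost_misdirected : ∀ (n : ℕ), 0 < n → ∀ c : ZMod n → V,
    ¬ AlmostMisdirectedCycle Γ D n c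

/-- `Γ` is bipartite: the vertices can be partitioned into two sets such that
every edge joins the two sets. -/
def IsBipartite {V : Type} (Γ : SimpleGraph V) : Prop :=
  ∃ S : Set V, ∀ a b, Γ.Adj a b → (a ∈ S ↔ b ∉ S)

namespace ArtinSplit

/-- The wreath product `(A × A) ⋊ ℤ/2`. -/
@[ext] structure Wr (A : Type) where
  u : A
  v : A
  s : Bool

section WrBasic

variable {A : Type} [Group A]

instance : Mul (Wr A) :=
  ⟨fun x y => ⟨x.u * (bif x.s then y.v else y.u), x.v * (bif x.s then y.u else y.v), xor x.s y.s⟩⟩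
instance : One (Wr A) := ⟨⟨1, 1, false⟩⟩
instance : Inv (Wr A) :=
  ⟨fun x => ⟨bif x.s then x.v⁻¹ else x.u⁻¹, bif x.s then x.u⁻¹ else x.v⁻¹, x.s⟩⟩

@[simp] lemma mul_u (x y : Wr A) : (x * y).u = x.u * (bif x.s then y.v else y.u) := rfl
@[simp] lemma mul_v (x y : Wr A) : (x * y).v = x.v * (bif x.s then y.u else y.v) := rfl
@[simp] lemma mul_s (x y : Wr A) : (x * y).s = xor x.s y.s := rfl
@[simp] lemma one_u : (1 : Wr A).u = 1 := rfl
@[simp] lemma one_v : (1 : Wr A).v = 1 := rfl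
@[simp] lemma one_s : (1 : Wr A).s = false := rfl
@[simp] lemma inv_u (x : Wr A) : (x⁻¹).u = bif x.s then x.v⁻¹ else x.u⁻¹ := rfl
@[simp] lemma inv_v (x : Wr A) : (x⁻¹).v = bif x.s then x.u⁻¹ else x.v⁻¹ := rfl
@[simp] lemma inv_s (x : Wr A) : (x⁻¹).s = x.s := rfl

instance : Group (Wr A) := Group.ofLeftAxioms
  (by rintro ⟨a, b, s⟩ ⟨c, d, t⟩ ⟨e, f, w⟩; cases s <;> cases t <;> cases w <;> ext <;>
        simp [mul_assoc])
  (by rintro ⟨a, b, s⟩; ext <;> simp)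
  (by rintro ⟨a, b, s⟩; cases s <;> ext <;> simp)

/-- The sign homomorphism. -/
def sgn : Wr A →* ℤˣ where
  toFun x := bif x.s then -1 else 1
  map_one' := rfl
  map_mul' := by rintro ⟨a, b, s⟩ ⟨c, d, t⟩; cases s <;> cases t <;> simp

lemma sgn_eq_one {x : Wr A} : sgn x = 1 ↔ x.s = false := by
  rcases x with ⟨a, b, s⟩
  cases s <;> simp [sgn]

/-- Twisted conjugation, as a function. -/
def actFn {P : Type} [Group P] (f : A →* P) (x : Wr A) (p : P) : P :=
  f x.u * (bif x.s then p⁻¹ else p) * (f x.v)⁻¹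

lemma actFn_mul {P : Type} [Group P] (f : A →* P) (x y : Wr A) (p : P) :
    actFn f (x * y) p = actFn f x (actFn f y p) := by
  rcases x with ⟨a, b, s⟩
  rcases y with ⟨c, d, t⟩
  cases s <;> cases t <;> simp [actFn, mul_assoc]

/-- Twisted conjugation action. -/
def actHom {P : Type} [Group P] (f : A →* P) : Wr A →* Equiv.Perm P :=
  MonoidHom.toHomPerm
    { toFun := fun x => (actFn f x : Function.End P)
      map_one' := by
        funext p
        change f 1 * p * (f 1)⁻¹ = p
        simp
      map_mul' := fun x y => funext fun p => actFn_mul f x y p }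

lemma actHom_apply {P : Type} [Group P] (f : A →* P) (x : Wr A) (p : P) :
    actHom f x p = f x.u * (bif x.s then p⁻¹ else p) * (f x.v)⁻¹ := rfl

lemma map_actHom {P Q : Type} [Group P] [Group Q] (f : A →* P) (f' : A →* Q) (g : P →* Q)
    (h : ∀ a, g (f a) = f' a) (x : Wr A) (p : P) : g (actHom f x p) = actHom f' x (g p) := by
  rcases x with ⟨a, b, s⟩
  cases s <;> simp [actHom_apply, h]

/-- Induced action on pairs, as a function. -/
def actFnFun {Ω : Type} (f : A →* Equiv.Perm Ω) (x : Wr A) (ξ : Bool → Ω) (i : Bool) : Ω :=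
  bif i then f x.v (ξ (!x.s)) else f x.u (ξ x.s)

lemma actFnFun_mul {Ω : Type} (f : A →* Equiv.Perm Ω) (x y : Wr A) (ξ : Bool → Ω) :
    actFnFun f (x * y) ξ = actFnFun f x (actFnFun f y ξ) := by
  rcases x with ⟨a, b, s⟩
  rcases y with ⟨c, d, t⟩
  funext i
  cases s <;> cases t <;> cases i <;> simp [actFnFun]

/-- Induced action on pairs. -/
def actFun {Ω : Type} (f : A →* Equiv.Perm Ω) : Wr A →* Equiv.Perm (Bool → Ω) :=
  MonoidHom.toHomPerm
    { toFun := fun x => (actFnFun f x : Function.End (Bool → Ω))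
      map_one' := by
        funext ξ i
        change actFnFun f 1 ξ i = ξ i
        cases i <;> simp [actFnFun]
      map_mul' := fun x y => funext fun p => actFnFun_mul f x y p }

lemma actFun_false {Ω : Type} (f : A →* Equiv.Perm Ω) (x : Wr A) (ξ : Bool → Ω) :
    actFun f x ξ false = f x.u (ξ x.s) := rfl
lemma actFun_true {Ω : Type} (f : A →* Equiv.Perm Ω) (x : Wr A) (ξ : Bool → Ω) :
    actFun f x ξ true = f x.v (ξ (!x.s)) := rfl

/-- Universal property: `P` is generated by `A` and `ρ` subject to `ρ` being fixed by `L`. -/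
structure IsUniv {G : Type} [Group G] (L : G →* Wr A) (P : Type) [Group P] (f : A →* P) (ρ : P) :
    Prop where
  fix : ∀ w, actHom f (L w) ρ = ρ
  desc : ∀ (Q : Type) [Group Q] (f' : A →* Q) (ρ' : Q), (∀ w, actHom f' (L w) ρ' = ρ') →
    ∃ g : P →* Q, (∀ a, g (f a) = f' a) ∧ g ρ = ρ'
  uniq : ∀ g : P →* P, (∀ a, g (f a) = f a) → g ρ = ρ → g = MonoidHom.id P

lemma IsUniv.equiv {G : Type} [Group G] {L : G →* Wr A} {P Q : Type} [Group P] [Group Q]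
    {f : A →* P} {ρ : P} {f' : A →* Q} {ρ' : Q} (h : IsUniv L P f ρ) (h' : IsUniv L Q f' ρ') :
    Nonempty (P ≃* Q) := by
  obtain ⟨g, hg, hgr⟩ := h.desc Q f' ρ' h'.fix
  obtain ⟨k, hk, hkr⟩ := h'.desc P f ρ h.fix
  exact ⟨MonoidHom.toMulEquiv g k
    (h.uniq _ (fun a => by rw [MonoidHom.comp_apply, hg, hk]) (by rw [MonoidHom.comp_apply, hgr, hkr]))
    (h'.uniq _ (fun a => by rw [MonoidHom.comp_apply, hk, hg]) (by rw [MonoidHom.comp_apply, hkr, hgr]))⟩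

/-- The HNN extension has the universal property. -/
lemma isUniv_hnn {G : Type} [Group G] (L : G →* Wr A) (f₁ f₂ : G →* A)
    (h₁ : Function.Injective f₁) (h₂ : Function.Injective f₂)
    (e : ∀ w, L w = ⟨f₂ w, f₁ w, false⟩) :
    IsUniv L (HNNExtension A f₁.range f₂.range
            ((MonoidHom.ofInjective h₁).symm.trans (MonoidHom.ofInjective h₂)))
      HNNExtension.of HNNExtension.t where
  fix w := by
    have := HNNExtension.t_mul_of (φ := (MonoidHom.ofInjective h₁).symm.trans
      (MonoidHom.ofInjective h₂)) (MonoidHom.ofInjective h₁ w)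
    simp only [MulEquiv.trans_apply, MulEquiv.symm_apply_apply] at this
    rw [actHom_apply, e]
    simp only [cond_false]
    rw [mul_inv_eq_iff_eq_mul]
    exact this.symm
  desc Q _ f' ρ' h := by
    refine ⟨HNNExtension.lift f' ρ' ?_, fun a => HNNExtension.lift_of _ _ _ a, HNNExtension.lift_t _ _ _⟩
    rintro ⟨_, w, rfl⟩
    have := h w
    rw [actHom_apply, e] at this
    simp only [cond_false] at this
    rw [mul_inv_eq_iff_eq_mul] at this
    have h3 : (MonoidHom.ofInjective h₁).symm ⟨f₁ w, w, rfl⟩ = w := by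
      rw [MulEquiv.symm_apply_eq]; rfl
    simp only [MulEquiv.trans_apply, h3]
    exact this.symm
  uniq g h1 h2 := by
    ext x
    · simpa using h1 x
    · simpa using h2

/-- The inclusion of `A` in the amalgam. -/
def inA {A B C : Type} [Group A] [Group B] [Group C] (i : C →* A) (j : C →* B) :
    A →* AmalgamatedProduct i j := Monoid.PushoutI.of (φ := twoMaps i j) true

/-- The inclusion of `B` in the amalgam. -/
def inB {A B C : Type} [Group A] [Group B] [Group C] (i : C →* A) (j : C →* B) :
    B →* AmalgamatedProduct i j := Monoid.PushoutI.of (φ := twoMaps i j) false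

lemma inA_eq_inB {A B C : Type} [Group A] [Group B] [Group C] (i : C →* A) (j : C →* B) (c : C) :
    inA i j (i c) = inB i j (j c) :=
  (Monoid.PushoutI.of_apply_eq_base (twoMaps i j) true c).trans
      (Monoid.PushoutI.of_apply_eq_base (twoMaps i j) false c).symm

lemma amalg_lift {A B C : Type} [Group A] [Group B] [Group C] (i : C →* A) (j : C →* B)
    {Q : Type} [Group Q] (f : A →* Q) (g : B →* Q) (h : ∀ c, f (i c) = g (j c)) :
    ∃ k : AmalgamatedProduct i j →* Q, (∀ a, k (inA i j a) = f a) ∧ ∀ b, k (inB i j b) = g b := by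
  let fam : ∀ b, twoFam A B b →* Q := fun b => match b with
    | false => g
    | true => f
  have hfam : ∀ b, (fam b).comp (twoMaps i j b) = f.comp i := by
    rintro (_ | _)
    · ext c; exact (h c).symm
    · rfl
  exact ⟨Monoid.PushoutI.lift fam (f.comp i) hfam,
    fun a => Monoid.PushoutI.lift_of (i := true) fam _ hfam a,
    fun a => Monoid.PushoutI.lift_of (i := false) fam _ hfam a⟩

lemma amalg_ext {A B C : Type} [Group A] [Group B] [Group C] (i : C →* A) (j : C →* B)
    {Q : Type} [Group Q] (k l : AmalgamatedProduct i j →* Q)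
    (h1 : ∀ a, k (inA i j a) = l (inA i j a)) (h2 : ∀ a, k (inB i j a) = l (inB i j a)) :
    k = l := by
  refine Monoid.PushoutI.hom_ext_nonempty ?_
  rintro (_ | _)
  · ext w; exact h2 w
  · ext a; exact h1 a

/-- The index two amalgam has the universal property. -/
lemma isUniv_amalg {G C : Type} [Group G] [Group C] (L : G →* Wr A) (j : C →* G) (i : C →* A)
    (w₀ : G) (hw₀ : (L w₀).s = true)
    (hj : ∀ w, (L w).s = false ↔ w ∈ j.range)
    (hi : ∀ c, i c = (L (j c)).u) :
    IsUniv L (AmalgamatedProduct i j) (inA i j) (inB i j w₀⁻¹ * inA i j (L w₀).u) := by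
  -- key statement for arbitrary compatible pairs
  have key : ∀ (P : Type) [Group P] (f : A →* P) (g : G →* P), (∀ c, f (i c) = g (j c)) →
      ∀ w, actHom f (L w) (g w₀⁻¹ * f (L w₀).u) = g w₀⁻¹ * f (L w₀).u := by
    intro P _ f g hfg w
    have hC : ∀ w, (L w).s = false → g w = f (L w).u := by
      intro w hw
      obtain ⟨c, rfl⟩ := (hj w).1 hw
      rw [← hfg, hi]
    have e1 : f (L w₀).u = g w₀ * (g w₀⁻¹ * f (L w₀).u) := by simp
    generalize hρ : g w₀⁻¹ * f (L w₀).u = ρ at *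
    have hg0 : g w₀ = f (L w₀).u * ρ⁻¹ := by rw [e1]; simp
    have hD : ∀ w, (L w).s = true → g w = f (L w).u * ρ⁻¹ := by
      intro w hw
      have h1 := hC (w * w₀⁻¹) (by simp [hw, hw₀])
      simp only [map_mul, mul_u, map_inv, inv_u, inv_v, hw, hw₀, cond_true] at h1
      rw [mul_inv_eq_iff_eq_mul] at h1
      rw [h1, hg0]; simp
    rw [actHom_apply, mul_inv_eq_iff_eq_mul]
    rcases hs : (L w).s with _ | _
    · have h1 := hD (w₀ * w) (by simp [hs, hw₀])
      simp only [map_mul, mul_u, hw₀, cond_true] at h1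
      rw [hC w hs, hg0] at h1
      simp only [cond_false]
      have h2 : ρ⁻¹ * f (L w).u = f (L w).v * ρ⁻¹ := by
        simpa [mul_assoc] using h1
      rw [inv_mul_eq_iff_eq_mul] at h2
      rw [h2]; simp [mul_assoc]
    · have h1 := hC (w₀ * w) (by simp [hs, hw₀])
      simp only [map_mul, mul_u, hw₀, cond_true] at h1
      rw [hD w hs, hg0] at h1
      simp only [cond_true]
      have h2 : ρ⁻¹ * (f (L w).u * ρ⁻¹) = f (L w).v := by
        simpa [mul_assoc] using h1
      rw [inv_mul_eq_iff_eq_mul] at h2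
      exact h2
  refine ⟨?_, ?_, ?_⟩
  · exact key _ _ (inB i j) (inA_eq_inB i j)
  · intro Q _ f' ρ' h
    -- the hom `G → Q`
    let g : G →* Q := 
      { toFun := fun w => f' (L w).u * (bif (L w).s then ρ'⁻¹ else 1)
        map_one' := by simp
        map_mul' := by
          intro w w'
          have h' := h w'
          rw [actHom_apply, mul_inv_eq_iff_eq_mul] at h'
          rcases hs : (L w).s with _ | _ <;> rcases hs' : (L w').s with _ | _ <;>
            simp only [hs', cond_false, cond_true] at h' <;> simp [hs, hs', mul_assoc]
          · rw [eq_inv_mul_iff_mul_eq, ← mul_assoc, ← h']; simp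
          · rw [h']; simp }
    have hgc : ∀ c, f' (i c) = g (j c) := by
      intro c
      have : (L (j c)).s = false := (hj _).2 ⟨c, rfl⟩
      simp [g, this, hi]
    obtain ⟨k, hT, hF⟩ := amalg_lift i j f' g hgc
    refine ⟨k, hT, ?_⟩
    have hgw : g w₀ = f' (L w₀).u * ρ'⁻¹ := by simp [g, hw₀]
    rw [map_mul, hT, hF, map_inv, hgw]
    simp
  · intro g h1 h2
    rw [map_mul, h1, mul_left_inj] at h2
    have h0 : ∀ c, g (inB i j (j c)) = inB i j (j c) := by
      intro c
      have := h1 (i c)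
      rwa [inA_eq_inB] at this
    refine amalg_ext i j _ _ h1 ?_
    intro w
    change _ = inB i j w
    rcases hs : (L w).s with _ | _
    · obtain ⟨c, rfl⟩ := (hj w).1 hs
      exact h0 c
    · obtain ⟨c, hc⟩ := (hj (w₀⁻¹ * w)).1 (by simp [hs, hw₀])
      have : w = w₀ * j c := by rw [hc]; simp
      rw [map_inv, map_inv, inv_inj] at h2
      rw [this, map_mul, map_mul, h2, h0]

end WrBasic
section IndexTwo

/-- The first coordinate of a homomorphism with trivial sign. -/
def uHom {C A : Type} [Group C] [Group A] (f : C →* Wr A) (h : ∀ c, (f c).s = false) : C →* A where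
  toFun c := (f c).u
  map_one' := by simp
  map_mul' x y := by simp [h]

/-- The second coordinate of a homomorphism with trivial sign. -/
def vHom {C A : Type} [Group C] [Group A] (f : C →* Wr A) (h : ∀ c, (f c).s = false) : C →* A where
  toFun c := (f c).v
  map_one' := by simp
  map_mul' x y := by simp [h]

/-- Functoriality of the wreath product. -/
def wrMap {C A : Type} [Group C] [Group A] (f : C →* A) : Wr C →* Wr A where
  toFun x := ⟨f x.u, f x.v, x.s⟩
  map_one' := by ext <;> simp
  map_mul' := by
    rintro ⟨a, b, s⟩ ⟨c, d, t⟩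
    cases s <;> cases t <;> ext <;> simp

/-- The diagonal homomorphism twisted by a sign. -/
def diagHom {F : Type} [Group F] (ε : F →* ℤˣ) : F →* Wr F where
  toFun w := ⟨w, w, decide (ε w = -1)⟩
  map_one' := by ext <;> simp
  map_mul' x y := by
    rcases Int.units_eq_one_or (ε x) with hx | hx <;>
      rcases Int.units_eq_one_or (ε y) with hy | hy <;> ext <;> simp [hx, hy]

lemma index_two {K : Type} [Fintype K] (ε : FreeGroup K →* ℤˣ) (k₀ : K)
    (h₀ : ε (FreeGroup.of k₀) = -1) (N : ℕ) (hN : N = 2 * Fintype.card K - 1) :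
    ∃ j : FreeGroup (Fin N) →* FreeGroup K, Function.Injective j ∧ j.range = ε.ker := by
  classical
  let Y := {p : K × Bool // p ≠ (k₀, false)}
  let gen : K × Bool → FreeGroup Y := fun p =>
    if h : p ≠ (k₀, false) then FreeGroup.of ⟨p, h⟩ else 1
  let Φ : FreeGroup K →* Wr (FreeGroup Y) := FreeGroup.lift fun k =>
    ⟨gen (k, false), gen (k, true), decide (ε (FreeGroup.of k) = -1)⟩
  let d : Wr (FreeGroup K) := ⟨1, FreeGroup.of k₀, false⟩
  let Ψ : FreeGroup K →* Wr (FreeGroup K) := (MulAut.conj d).toMonoidHom.comp (diagHom ε)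
  have hΨ : ∀ w, Ψ w = d * diagHom ε w * d⁻¹ := fun w => rfl
  have hΨu : ∀ w, ε w = 1 → (Ψ w).u = w := by
    intro w hw
    simp [hΨ, d, diagHom, hw]
  let jf : K × Bool → FreeGroup K := fun p =>
    bif p.2 then (Ψ (FreeGroup.of p.1)).v else (Ψ (FreeGroup.of p.1)).u
  let j : FreeGroup Y →* FreeGroup K := FreeGroup.lift fun y => jf y.1
  have hjgen : ∀ p, j (gen p) = jf p := by
    intro p
    by_cases hp : p ≠ (k₀, false)
    · simp [gen, hp, j]
    · push Not at hp
      subst hp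
      simp [gen, jf, hΨ, d, diagHom, h₀]
  have hcomp : (wrMap j).comp Φ = Ψ := by
    ext1 k
    have : (wrMap j).comp Φ (FreeGroup.of k) = ⟨j (gen (k, false)), j (gen (k, true)),
      decide (ε (FreeGroup.of k) = -1)⟩ := by simp [Φ, wrMap]
    rw [this, hjgen, hjgen]
    ext <;> simp [jf, hΨ, d, diagHom]
  have hker : ∀ c, ε (j c) = 1 := by
    intro c
    have : ε.comp j = 1 := by
      ext1 y
      rcases y with ⟨⟨k, b⟩, hy⟩
      rcases Int.units_eq_one_or (ε (FreeGroup.of k)) with hx | hx <;> cases b <;>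
        simp [j, jf, hΨ, d, diagHom, hx, h₀]
    exact DFunLike.congr_fun this c
  have hs : ∀ c, ((Φ.comp j) c).s = false := by
    intro c
    have h1 : (wrMap j (Φ (j c))).s = (Ψ (j c)).s := by
      rw [← hcomp]; rfl
    have h2 : (Ψ (j c)).s = false := by simp [hΨ, d, diagHom, hker]
    exact h1.trans h2
  have hΦ0 : Φ (FreeGroup.of k₀) = ⟨1, gen (k₀, true), true⟩ := by
    simp [Φ, h₀, gen]
  have hid : uHom (Φ.comp j) hs = MonoidHom.id _ := by
    ext1 y
    rcases y with ⟨⟨k, b⟩, hy⟩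
    have hg : gen (k, b) = FreeGroup.of ⟨(k, b), hy⟩ := by simp [gen, hy]
    have hk : Φ (FreeGroup.of k) =
      ⟨gen (k, false), gen (k, true), decide (ε (FreeGroup.of k) = -1)⟩ := by simp [Φ]
    change (Φ (j (FreeGroup.of _))).u = FreeGroup.of _
    rw [← hg, hjgen]
    rcases Int.units_eq_one_or (ε (FreeGroup.of k)) with hx | hx <;> cases b <;>
      simp [jf, hΨ, d, diagHom, hx, hΦ0, hk]
  have hinj : Function.Injective j := by
    intro x y hxy
    have : ∀ c, (Φ (j c)).u = c := fun c => DFunLike.congr_fun hid c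
    rw [← this x, ← this y, hxy]
  have hrange : j.range = ε.ker := by
    ext w
    constructor
    · rintro ⟨c, rfl⟩
      exact hker c
    · intro hw
      refine ⟨(Φ w).u, ?_⟩
      have h1 : (wrMap j (Φ w)).u = (Ψ w).u := by
        rw [← hcomp]; rfl
      rw [hΨu w hw] at h1
      exact h1
  have hcard : Fintype.card Y = N := by
    rw [hN]
    simp [Y, Fintype.card_subtype_compl, mul_comm]
  let e := FreeGroup.freeGroupCongr (Fintype.equivFinOfCardEq hcard).symm
  refine ⟨j.comp e.toMonoidHom, hinj.comp e.injective, ?_⟩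
  rw [← hrange]
  ext w
  constructor
  · rintro ⟨c, rfl⟩
    exact ⟨e c, rfl⟩
  · rintro ⟨c, rfl⟩
    exact ⟨e.symm c, by simp⟩

end IndexTwo
section SetupSection

lemma perm_inv_self {X : Type*} (p : Equiv.Perm X) (x : X) : p⁻¹ (p x) = x :=
  p.symm_apply_apply x

/-- Voltage of the first edge over `e`. -/
def hτ {E : Type} (e : E) : Wr (FreeGroup E) := ⟨FreeGroup.of e, 1, true⟩

/-- Voltage of the second edge over `e`. -/
def hσ {E : Type} (M : E → ℕ) (e : E) : Wr (FreeGroup E) :=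
  if Even (M e) then ⟨FreeGroup.of e ^ (M e / 2), FreeGroup.of e ^ (M e / 2 - 1), true⟩
  else ⟨FreeGroup.of e ^ (M e / 2), FreeGroup.of e ^ (M e / 2), false⟩

/-- An oriented labelled graph with a spanning tree and a potential. -/
structure Setup (V E : Type) where
  src : E → V
  tgt : E → V
  M : E → ℕ
  r : V
  T : Set E
  φ : V → Wr (FreeGroup E)
  φ_r : φ r = 1
  φ_T : ∀ e ∈ T, φ (tgt e) = φ (src e) * hτ e
  ind : ∀ P : V → Prop, P r → (∀ e ∈ T, (P (src e) ↔ P (tgt e))) → ∀ v, P v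

namespace Setup

variable {V E : Type} (S : Setup V E)

/-- Basis of the fundamental group of the level graph. -/
abbrev K : Type := {e : E // e ∉ S.T} ⊕ E

/-- Fundamental group of the level graph. -/
abbrev G : Type := FreeGroup S.K

open Classical in
/-- First loops. -/
noncomputable def τ (e : E) : S.G :=
  if h : e ∈ S.T then 1 else FreeGroup.of (Sum.inl ⟨e, h⟩)

/-- Second loops. -/
def σ (e : E) : S.G := FreeGroup.of (Sum.inr e)

/-- The holonomy homomorphism. -/
def L : S.G →* Wr (FreeGroup E) := FreeGroup.lift (Sum.elim
  (fun e => S.φ (S.src e) * hτ e.1 * (S.φ (S.tgt e))⁻¹)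
  (fun e => S.φ (S.tgt e) * hσ S.M e * (S.φ (S.src e))⁻¹))

lemma L_τ (e : E) : S.L (S.τ e) = S.φ (S.src e) * hτ e * (S.φ (S.tgt e))⁻¹ := by
  by_cases h : e ∈ S.T
  · simp [τ, h, S.φ_T e h]
  · simp [τ, h, L]

lemma L_σ (e : E) : S.L (S.σ e) = S.φ (S.tgt e) * hσ S.M e * (S.φ (S.src e))⁻¹ := by
  simp [σ, L]

lemma G_ind (H : Subgroup S.G) (h1 : ∀ e, S.τ e ∈ H) (h2 : ∀ e, S.σ e ∈ H) (w : S.G) : w ∈ H := by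
  induction w using FreeGroup.induction_on with
  | C1 => exact H.one_mem
  | of k =>
    rcases k with ⟨e, he⟩ | e
    · simpa [τ, he] using h1 e
    · exact h2 e
  | inv_of k h => exact H.inv_mem h
  | mul x y hx hy => exact H.mul_mem hx hy

lemma transport {X : Type} (α : Wr (FreeGroup E) →* Equiv.Perm X) (ξ : V → X)
    (h : ∀ e ∈ S.T, ξ (S.src e) = α (hτ e) (ξ (S.tgt e))) (v : V) :
    α (S.φ v) (ξ v) = ξ S.r := by
  refine S.ind (fun v => α (S.φ v) (ξ v) = ξ S.r) (by simp [S.φ_r]) ?_ v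
  intro e he
  rw [S.φ_T e he, map_mul, Equiv.Perm.mul_apply, ← h e he]

lemma injective_of_action {Ω : Type} (f : FreeGroup E →* Equiv.Perm Ω)
    (ψ : V → S.G → Bool → Ω)
    (h1 : ∀ e g, ψ (S.src e) g = actFun f (hτ e) (ψ (S.tgt e) (g * S.τ e)))
    (h2 : ∀ e g, ψ (S.tgt e) g = actFun f (hσ S.M e) (ψ (S.src e) (g * S.σ e)))
    (hinj : ∀ s, Function.Injective (fun g => ψ S.r g s))
    (w : S.G) (hw : (S.L w).s = false) (hw1 : (S.L w).u = 1 ∨ (S.L w).v = 1) : w = 1 := by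
  have tr : ∀ v g, actFun f (S.φ v) (ψ v g) = ψ S.r g := by
    intro v g
    refine S.transport (actFun f) (fun v => ψ v g) ?_ v
    intro e he
    have := h1 e g
    simpa [τ, he] using this
  have tr' : ∀ v g, actFun f (S.φ v)⁻¹ (ψ S.r g) = ψ v g := by
    intro v g
    rw [← tr v g, map_inv, perm_inv_self]
  have key : ∀ w g, actFun f (S.L w) (ψ S.r (g * w)) = ψ S.r g := by
    intro w
    let H : Subgroup S.G :=
      { carrier := {w | ∀ g, actFun f (S.L w) (ψ S.r (g * w)) = ψ S.r g}
        one_mem' := by intro g; simp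
        mul_mem' := by
          intro a b ha hb g
          rw [map_mul, map_mul, Equiv.Perm.mul_apply, ← mul_assoc, hb, ha]
        inv_mem' := by
          intro a ha g
          have := ha (g * a⁻¹)
          rw [inv_mul_cancel_right] at this
          rw [map_inv, map_inv, ← this, perm_inv_self] }
    refine S.G_ind H ?_ ?_ w
    · intro e g
      rw [L_τ, map_mul, map_mul, Equiv.Perm.mul_apply, Equiv.Perm.mul_apply, tr', ← h1, tr]
    · intro e g
      rw [L_σ, map_mul, map_mul, Equiv.Perm.mul_apply, Equiv.Perm.mul_apply, tr', ← h2, tr]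
  have := key w 1
  rw [one_mul] at this
  rcases hw1 with h | h
  · have h3 := congrFun this false
    rw [actFun_false, h, hw, map_one] at h3
    exact hinj false h3
  · have h3 := congrFun this true
    rw [actFun_true, h, hw, map_one] at h3
    exact hinj true h3

end Setup

/-- The Artin relation in the form used here. -/
def Rel {P : Type} [Group P] (M : ℕ) (p q : P) : Prop :=
  if Even M then q * (p * q) ^ (M / 2 - 1) = (p * q) ^ (M / 2) * p⁻¹
  else q * (p * q) ^ (M / 2) = (p * q) ^ (M / 2) * p

lemma rel_iff {P E : Type} [Group P] (f : FreeGroup E →* P) (M : E → ℕ) (e : E) (p q : P)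
    (h : f (FreeGroup.of e) = p * q) : actHom f (hσ M e) p = q ↔ Rel (M e) p q := by
  rw [actHom_apply, mul_inv_eq_iff_eq_mul]
  by_cases hM : Even (M e) <;> simp [Rel, hσ, hM, h, eq_comm]

lemma Setup.isUniv_art {V E : Type} (S : Setup V E) {P : Type} [Group P] (gen : V → P)
    (hgen : ∀ g : P →* P, (∀ v, g (gen v) = gen v) → g = MonoidHom.id P)
    (hrel : ∀ e, Rel (S.M e) (gen (S.src e)) (gen (S.tgt e)))
    (hdesc : ∀ (Q : Type) [Group Q] (q : V → Q), (∀ e, Rel (S.M e) (q (S.src e)) (q (S.tgt e))) →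
      ∃ g : P →* Q, ∀ v, g (gen v) = q v) :
    IsUniv S.L P (FreeGroup.lift fun e => gen (S.src e) * gen (S.tgt e)) (gen S.r) := by
  set f : FreeGroup E →* P := FreeGroup.lift fun e => gen (S.src e) * gen (S.tgt e) with hf
  have hfe : ∀ e, f (FreeGroup.of e) = gen (S.src e) * gen (S.tgt e) := by simp [hf]
  have h1 : ∀ e, gen (S.src e) = actHom f (hτ e) (gen (S.tgt e)) := by
    intro e
    simp [actHom_apply, hτ, hfe]
  have h2 : ∀ e, gen (S.tgt e) = actHom f (hσ S.M e) (gen (S.src e)) := fun e =>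
    ((rel_iff f S.M e _ _ (hfe e)).2 (hrel e)).symm
  have tr : ∀ v, actHom f (S.φ v) (gen v) = gen S.r := S.transport (actHom f) gen fun e _ => h1 e
  have tr' : ∀ v, actHom f (S.φ v)⁻¹ (gen S.r) = gen v := by
    intro v
    rw [← tr v, map_inv, perm_inv_self]
  refine ⟨?_, ?_, ?_⟩
  · refine S.G_ind (((MulAction.stabilizer (Equiv.Perm P) (gen S.r)).comap (actHom f)).comap S.L)
      ?_ ?_
    · intro e
      change actHom f (S.L (S.τ e)) (gen S.r) = gen S.r
      rw [S.L_τ, map_mul, map_mul, Equiv.Perm.mul_apply, Equiv.Perm.mul_apply, tr', ← h1, tr]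
    · intro e
      change actHom f (S.L (S.σ e)) (gen S.r) = gen S.r
      rw [S.L_σ, map_mul, map_mul, Equiv.Perm.mul_apply, Equiv.Perm.mul_apply, tr', ← h2, tr]
  · intro Q _ f' ρ' h
    let q : V → Q := fun v => actHom f' (S.φ v)⁻¹ ρ'
    have e1 : ∀ e, q (S.src e) = actHom f' (hτ e) (q (S.tgt e)) := by
      intro e
      have := h (S.τ e)
      rw [S.L_τ, map_mul, map_mul, Equiv.Perm.mul_apply, Equiv.Perm.mul_apply] at this
      change actHom f' (S.φ (S.src e))⁻¹ ρ' = _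
      rw [map_inv, Equiv.Perm.inv_eq_iff_eq]
      exact this.symm
    have e2 : ∀ e, q (S.tgt e) = actHom f' (hσ S.M e) (q (S.src e)) := by
      intro e
      have := h (S.σ e)
      rw [S.L_σ, map_mul, map_mul, Equiv.Perm.mul_apply, Equiv.Perm.mul_apply] at this
      change actHom f' (S.φ (S.tgt e))⁻¹ ρ' = _
      rw [map_inv, Equiv.Perm.inv_eq_iff_eq]
      exact this.symm
    have e3 : ∀ e, f' (FreeGroup.of e) = q (S.src e) * q (S.tgt e) := by
      intro e
      rw [e1 e]
      simp [actHom_apply, hτ]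
    obtain ⟨g, hg⟩ := hdesc Q q fun e => (rel_iff f' S.M e _ _ (e3 e)).1 (e2 e).symm
    refine ⟨g, ?_, ?_⟩
    · intro a
      have : g.comp f = f' := by
        ext e
        simp [hfe, hg, e3]
      exact DFunLike.congr_fun this a
    · rw [hg]
      simp [q, S.φ_r]
      rfl
  · intro g hg1 hg2
    refine hgen g fun v => ?_
    rw [← tr' v, map_actHom f f g hg1, hg2]

end SetupSection
section LocalSection

variable {G : Type} [Group G]

/-- A rotation with monodromy. -/
def rot (n : ℕ) (hn : 0 < n) (c : G) : Equiv.Perm (Fin n × G) where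
  toFun p := if p.1.val = 0 then (⟨n - 1, by omega⟩, p.2 * c⁻¹)
    else (⟨p.1.val - 1, by omega⟩, p.2)
  invFun p := if h : p.1.val + 1 = n then (⟨0, hn⟩, p.2 * c) else (⟨p.1.val + 1, by omega⟩, p.2)
  left_inv := by
    rintro ⟨⟨i, hi⟩, g⟩
    by_cases h : i = 0
    · subst h
      have : n - 1 + 1 = n := by omega
      simp [this]
    · have h1 : ¬ (i - 1 + 1 = n) := by omega
      have h2 : i - 1 + 1 = i := by omega
      simp [h, h2, hi.ne]
  right_inv := by
    rintro ⟨⟨i, hi⟩, g⟩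
    by_cases h : i + 1 = n
    · have : n - 1 = i := by omega
      simp [h, this]
    · simp [h]

lemma rot_zero (n : ℕ) (hn : 0 < n) (c g : G) :
    rot n hn c (⟨0, hn⟩, g) = (⟨n - 1, by omega⟩, g * c⁻¹) := by
  simp [rot]

lemma rot_pos (n : ℕ) (hn : 0 < n) (c g : G) (i : ℕ) (hi : i + 1 < n) :
    rot n hn c (⟨i + 1, hi⟩, g) = (⟨i, by omega⟩, g) := by
  simp [rot]

lemma rot_pow (n : ℕ) (hn : 0 < n) (c g : G) (k i : ℕ) (hi : i + k < n) :
    (rot n hn c ^ k) (⟨i + k, hi⟩, g) = (⟨i, by omega⟩, g) := by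
  induction k with
  | zero => simp
  | succ k ih =>
    rw [pow_succ, Equiv.Perm.mul_apply]
    have := rot_pos n hn c g (i + k) hi
    exact (congrArg _ this).trans (ih (by omega))

lemma rot_pow_zero (n : ℕ) (hn : 0 < n) (c g : G) (k i : ℕ) (hi : i + (k + 1) = n) :
    (rot n hn c ^ (k + 1)) (⟨0, hn⟩, g) = (⟨i, by omega⟩, g * c⁻¹) := by
  rw [pow_succ, Equiv.Perm.mul_apply, rot_zero]
  have := rot_pow n hn c (g * c⁻¹) k i (by omega)
  convert this using 4
  omega

/-- Adjacency of nodes over one edge. -/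
def Nbr (M : ℕ) (τ σ : G) (n n' : Bool × Bool × G) : Prop :=
  (∃ g, n = (false, true, g) ∧ n' = (true, false, g * τ)) ∨
    (M = 2 ∧ ∃ g, n = (true, true, g) ∧ n' = (false, false, g * σ))

/-- Local model at an edge. -/
structure LocalModel (M : ℕ) (τ σ : G) where
  Q : Type
  π : Equiv.Perm Q
  ι : Bool × Bool × G → Q
  h1 : ∀ g, π (ι (true, true, g * τ)) = ι (false, false, g)
  h2 : ∀ g, ι (false, true, g) = ι (true, false, g * τ)
  h3 : ¬ Even M → ∀ s g, (π ^ (M / 2)) (ι (false, s, g * σ)) = ι (true, s, g)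
  h4 : Even M → ∀ g, (π ^ (M / 2)) (ι (false, true, g * σ)) = ι (true, false, g)
  h5 : Even M → ∀ g, (π ^ (M / 2 - 1)) (ι (false, false, g * σ)) = ι (true, true, g)
  inj : ∀ n n', ι n = ι n' → n = n' ∨ Nbr M τ σ n n' ∨ Nbr M τ σ n' n

lemma localModel_odd (m : ℕ) (hm : 1 ≤ m) (τ σ : G) :
    Nonempty (LocalModel (2 * m + 1) τ σ) := by
  have hn : 0 < 2 * m + 1 := by omega
  have hd : (2 * m + 1) / 2 = m := by omega
  have hodd : ¬ Even (2 * m + 1) := by simp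
  obtain ⟨k, rfl⟩ : ∃ k, m = k + 1 := ⟨m - 1, by omega⟩
  let c := τ * σ * τ * σ
  let ι : Bool × Bool × G → Fin (2 * (k + 1) + 1) × G := fun x => match x with
    | (false, false, g) => (⟨0, by omega⟩, g)
    | (true, true, g) => (⟨0 + 1, by omega⟩, g * τ⁻¹)
    | (false, true, g) => (⟨1 + (k + 1), by omega⟩, g * σ⁻¹ * τ⁻¹)
    | (true, false, g) => (⟨1 + (k + 1), by omega⟩, g * τ⁻¹ * σ⁻¹ * τ⁻¹)
  refine ⟨⟨_, rot _ hn c, ι, ?_, ?_, ?_, fun h => absurd h hodd, fun h => absurd h hodd, ?_⟩⟩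
  · intro g
    refine (rot_pos _ hn c (g * τ * τ⁻¹) 0 _).trans ?_
    simp [ι]
  · intro g
    simp [ι]
  · intro _ s g
    rw [hd]
    cases s
    · refine (rot_pow_zero _ hn c (g * σ) k (1 + (k + 1)) (by omega)).trans ?_
      simp [ι, c, mul_assoc]
    · refine (rot_pow _ hn c (g * σ * σ⁻¹ * τ⁻¹) (k + 1) 1 (by omega)).trans ?_
      simp [ι]
  · rintro ⟨a, s, g⟩ ⟨a', s', g'⟩ h
    cases a <;> cases s <;> cases a' <;> cases s' <;> simp [ι, Nbr] at h ⊢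
    all_goals first | exact h | (exfalso; omega) | skip
    · rw [h]; simp
    · rw [mul_inv_eq_iff_eq_mul] at h; simp [h]

lemma localModel_even (m : ℕ) (hm : 1 ≤ m) (τ σ : G) :
    Nonempty (LocalModel (2 * m) τ σ) := by
  have hd : (2 * m) / 2 = m := by omega
  have heven : Even (2 * m) := by simp
  obtain ⟨k, rfl⟩ : ∃ k, m = k + 1 := ⟨m - 1, by omega⟩
  have hn : 0 < k + 1 := by omega
  let c := τ * σ
  let R := rot (k + 1) hn c
  let π : Equiv.Perm (Bool × (Fin (k + 1) × G)) := Equiv.prodCongr (Equiv.refl _) R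
  have hπ : ∀ (j : ℕ) b x, (π ^ j) (b, x) = (b, (R ^ j) x) := by
    intro j
    induction j with
    | zero => simp
    | succ j ih =>
      intro b x
      rw [pow_succ, pow_succ, Equiv.Perm.mul_apply, Equiv.Perm.mul_apply, ← ih]
      rfl
  have hfull : ∀ g, (R ^ (k + 1)) (⟨0, hn⟩, g) = (⟨0, hn⟩, g * c⁻¹) := fun g =>
    rot_pow_zero _ hn c g k 0 (by omega)
  let ι : Bool × Bool × G → Bool × (Fin (k + 1) × G) := fun x => match x with
    | (false, false, g) => (false, (⟨0, hn⟩, g))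
    | (true, true, g) => (false, R.symm (⟨0, hn⟩, g * τ⁻¹))
    | (false, true, g) => (true, (⟨0, hn⟩, g))
    | (true, false, g) => (true, (⟨0, hn⟩, g * τ⁻¹))
  refine ⟨⟨_, π, ι, ?_, ?_, fun h => absurd heven h, ?_, ?_, ?_⟩⟩
  · intro g
    simp [ι, π]
  · intro g
    simp [ι]
  · intro _ g
    rw [hd, hπ, hfull]
    simp [ι, c]
  · intro _ g
    rw [hd, hπ]
    have := hfull (g * σ)
    rw [pow_succ', Equiv.Perm.mul_apply] at this
    have h3 : (k + 1 - 1) = k := by omega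
    simp only [ι, h3]
    congr 1
    rw [Equiv.eq_symm_apply]
    refine this.trans ?_
    simp [c]
  · have key : ∀ g g', (⟨0, hn⟩, g) = R.symm (⟨0, hn⟩, g' * τ⁻¹) → k = 0 ∧ g = g' * σ := by
      intro g g' h
      rw [Equiv.eq_symm_apply] at h
      have h2 := (rot_zero (k + 1) hn c g).symm.trans h
      simp [c] at h2
      refine ⟨h2.1, ?_⟩
      rw [← mul_assoc] at h2
      have h3 := mul_right_cancel h2.2
      rw [← h3]; simp
    rintro ⟨a, s, g⟩ ⟨a', s', g'⟩ h
    cases a <;> cases s <;> cases a' <;> cases s' <;> simp [ι, Nbr] at h ⊢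
    all_goals first | exact h | (exfalso; omega) | skip
    · exact (key _ _ h)
    · rw [h]; simp
    · rw [← h]; simp
    · obtain ⟨h1, h2⟩ := key _ _ h.symm
      exact ⟨h1, h2⟩

lemma localModel (M : ℕ) (hM : 2 ≤ M) (τ σ : G) : Nonempty (LocalModel M τ σ) := by
  rcases Nat.even_or_odd' M with ⟨m, rfl | rfl⟩
  · exact localModel_even m (by omega) τ σ
  · exact localModel_odd m (by omega) τ σ

end LocalSection
section CoverSection

variable {V N : Type}

lemma reduced_seq (Γ : SimpleGraph V) (M : V → V → ℕ) (D : V → V → Prop)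
    (hD : IsAdmissibleOrientation Γ M D) (Z : SimpleGraph N) (pr : N → V) (sh : N → Bool)
    (F1 : ∀ n n', Z.Adj n n' → Γ.Adj (pr n) (pr n'))
    (F1' : ∀ n n', Z.Adj n n' → sh n' = !(sh n))
    (F2 : ∀ n n' n'', Z.Adj n n' → Z.Adj n n'' → pr n' = pr n'' → n' = n'')
    (F3 : ∀ n n', Z.Adj n n' → D (pr n) (pr n') → sh n = true) (k : ℕ) :
    ∀ p : ℕ → N, 2 ≤ k → (∀ i < k, Z.Adj (p i) (p (i + 1))) →
      (∀ i, i + 2 ≤ k → p (i + 2) ≠ p i) →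
      pr (p k) ≠ pr (p 0) ∧ ¬ Γ.Adj (pr (p k)) (pr (p 0)) := by
  induction k with
  | zero => intro p hk; omega
  | succ k ih =>
    intro p hk hadj hred
    have hredV : ∀ i, i + 2 ≤ k + 1 → pr (p (i + 2)) ≠ pr (p i) := by
      intro i hi he
      exact hred i hi (F2 (p (i + 1)) _ _ (hadj (i + 1) (by omega)) (hadj i (by omega)).symm he)
    refine ⟨?_, ?_⟩
    · intro heq
      by_cases hk2 : k = 1
      · subst hk2
        exact hredV 0 (by omega) heq
      · have := (ih p (by omega) (fun i hi => hadj i (by omega)) (fun i hi => hred i (by omega))).2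
        rw [← heq] at this
        exact this (F1 _ _ (hadj k (by omega)))
    · intro hadj0
      have hlast : pr (p k) ≠ pr (p 0) := by
        by_cases hk2 : k = 1
        · subst hk2
          exact (F1 _ _ (hadj 0 (by omega))).ne.symm
        · exact (ih p (by omega) (fun i hi => hadj i (by omega))
            (fun i hi => hred i (by omega))).1
      have hfirst : pr (p (k + 1)) ≠ pr (p 1) := by
        by_cases hk2 : k = 1
        · subst hk2
          exact (F1 _ _ (hadj 1 (by omega))).ne.symm
        · exact (ih (fun i => p (i + 1)) (by omega) (fun i hi => hadj (i + 1) (by omega))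
            (fun i hi => hred (i + 1) (by omega))).1
      let c : ZMod (k + 2) → V := fun i => pr (p i.val)
      have hc : ∀ j : ℕ, c (j : ZMod (k + 2)) = pr (p (j % (k + 2))) := by
        intro j
        simp only [c, ZMod.val_natCast]
      have hc' : ∀ j : ℕ, j < k + 2 → c (j : ZMod (k + 2)) = pr (p j) := by
        intro j hj
        rw [hc, Nat.mod_eq_of_lt hj]
      refine hD.no_almost_misdirected (k + 2) (by omega) c ⟨⟨?_, ?_⟩, ?_, ⟨?_, ?_⟩, ?_⟩
      · intro i
        obtain ⟨j, hj, rfl⟩ : ∃ j : ℕ, j < k + 2 ∧ (j : ZMod (k + 2)) = i :=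
          ⟨i.val, ZMod.val_lt i, ZMod.natCast_zmod_val i⟩
        have e1 : ((j : ZMod (k + 2)) + 1) = ((j + 1 : ℕ) : ZMod (k + 2)) := by push_cast; rfl
        rw [e1, hc' j hj]
        by_cases hjk : j = k + 1
        · subst hjk
          rw [hc, Nat.mod_self]
          exact hadj0
        · rw [hc' _ (by omega)]
          exact F1 _ _ (hadj j (by omega))
      · intro i
        obtain ⟨j, hj, rfl⟩ : ∃ j : ℕ, j < k + 2 ∧ (j : ZMod (k + 2)) = i :=
          ⟨i.val, ZMod.val_lt i, ZMod.natCast_zmod_val i⟩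
        have e1 : ((j : ZMod (k + 2)) + 2) = ((j + 2 : ℕ) : ZMod (k + 2)) := by push_cast; rfl
        rw [e1, hc' j hj]
        by_cases hjk : j = k + 1
        · subst hjk
          rw [hc]
          have : (k + 1 + 2) % (k + 2) = 1 := by
            rw [show k + 1 + 2 = 1 + (k + 2) by omega, Nat.add_mod_right, Nat.mod_eq_of_lt]
            omega
          rw [this]
          exact hfirst.symm
        · by_cases hjk2 : j = k
          · subst hjk2
            rw [hc, Nat.mod_self]
            exact hlast.symm
          · rw [hc' _ (by omega)]
            exact hredV j (by omega)
      · omega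
      · intro i hi
        change Γ.Adj (c i) (c ((i + 1 : ℕ) : ZMod (k + 2)))
        rw [hc' i (by omega), hc' (i + 1) (by omega)]
        exact F1 _ _ (hadj i (by omega))
      · intro i hi
        change c ((i + 2 : ℕ) : ZMod (k + 2)) ≠ c i
        rw [hc' i (by omega), hc' (i + 2) (by omega)]
        exact hredV i (by omega)
      · refine ⟨fun i => sh (p i), fun i hi => F1' _ _ (hadj i (by omega)), ?_⟩
        intro i hi
        change (D (c i) (c ((i + 1 : ℕ) : ZMod (k + 2))) → _) ∧
          (D (c ((i + 1 : ℕ) : ZMod (k + 2))) (c i) → _)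
        rw [hc' i (by omega), hc' (i + 1) (by omega)]
        have ha := hadj i (by omega)
        refine ⟨F3 _ _ ha, fun h => ?_⟩
        have := F3 _ _ ha.symm h
        rw [F1' _ _ ha] at this
        simpa using this

lemma reachable_near (Γ : SimpleGraph V) (M : V → V → ℕ) (D : V → V → Prop)
    (hD : IsAdmissibleOrientation Γ M D) (Z : SimpleGraph N) (pr : N → V) (sh : N → Bool)
    (F1 : ∀ n n', Z.Adj n n' → Γ.Adj (pr n) (pr n'))
    (F1' : ∀ n n', Z.Adj n n' → sh n' = !(sh n))
    (F2 : ∀ n n' n'', Z.Adj n n' → Z.Adj n n'' → pr n' = pr n'' → n' = n'')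
    (F3 : ∀ n n', Z.Adj n n' → D (pr n) (pr n') → sh n = true) (n n' : N)
    (hr : Z.Reachable n n') (h : pr n' = pr n ∨ Γ.Adj (pr n') (pr n)) :
    n = n' ∨ (Z.Adj n n' ∧ pr n' ≠ pr n) := by
  classical
  obtain ⟨w, hw⟩ := hr.exists_isPath
  rcases lt_or_ge w.length 2 with hlt | hge
  · rcases Nat.lt_or_ge w.length 1 with h0 | h1
    · exact Or.inl (SimpleGraph.Walk.eq_of_length_eq_zero (by omega : w.length = 0))
    · have := SimpleGraph.Walk.adj_of_length_eq_one (by omega : w.length = 1)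
      exact Or.inr ⟨this, (F1 _ _ this).ne.symm⟩
  · exfalso
    have := reduced_seq Γ M D hD Z pr sh F1 F1' F2 F3 w.length w.getVert hge
      (fun i hi => w.adj_getVert_succ hi) (fun i hi he => by
        have := hw.getVert_injOn (by simpa using hi) (by simp; omega) he
        omega)
    simp only [SimpleGraph.Walk.getVert_length, SimpleGraph.Walk.getVert_zero] at this
    tauto

end CoverSection
section InjSection

variable {V E : Type} (S : Setup V E)

/-- Endpoint of an edge. -/
def ep (e : E) (b : Bool) : V := bif b then S.tgt e else S.src e

/-- Global node of a local node. -/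
def nd (e : E) (n : Bool × Bool × S.G) : V × Bool × S.G := (ep S e n.1, n.2.1, n.2.2)

/-- Directed adjacency in the cover. -/
def ZR (n n' : V × Bool × S.G) : Prop :=
  ∃ e b g, (b = true → S.M e = 2) ∧ n = nd S e (b, true, g) ∧
    n' = nd S e (!b, false, g * (bif b then S.σ e else S.τ e))

/-- The cover graph. -/
def ZG : SimpleGraph (V × Bool × S.G) where
  Adj n n' := ZR S n n' ∨ ZR S n' n
  symm := ⟨fun _ _ h => h.symm⟩
  loopless := ⟨fun n h => by
    rcases h with ⟨e, b, g, -, h1, h2⟩ | ⟨e, b, g, -, h1, h2⟩ <;>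
    · rw [h1] at h2
      simp [nd] at h2⟩

lemma inj_main (Γ : SimpleGraph V) (M : V → V → ℕ) (D : V → V → Prop)
    (hD : IsAdmissibleOrientation Γ M D)
    (hM : ∀ e, S.M e = M (S.src e) (S.tgt e)) (hM2 : ∀ e, 2 ≤ S.M e)
    (hadj : ∀ e, Γ.Adj (S.src e) (S.tgt e))
    (hdet : ∀ e e' b b', ep S e b = ep S e' b' → ep S e (!b) = ep S e' (!b') → e = e' ∧ b = b')
    (hor : ∀ e, ¬ D (S.tgt e) (S.src e))
    (w : S.G) (hw : (S.L w).s = false) (hw1 : (S.L w).u = 1 ∨ (S.L w).v = 1) : w = 1 := by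
  classical
  have hadj' : ∀ e b, Γ.Adj (ep S e b) (ep S e (!b)) := by
    rintro e (_ | _)
    · exact hadj e
    · exact (hadj e).symm
  have hor' : ∀ e b, (b = true → S.M e = 2) → ¬ D (ep S e (!b)) (ep S e b) := by
    rintro e (_ | _) hb
    · exact hor e
    · intro h
      have h3 := (hD.defined_iff _ _ (hadj e)).1 (Or.inl h)
      rw [← hM, hb rfl] at h3
      omega
  have near := reachable_near Γ M D hD (ZG S) (fun n => n.1) (fun n => n.2.1)
    (by
      rintro n n' (⟨e, b, g, -, rfl, rfl⟩ | ⟨e, b, g, -, rfl, rfl⟩)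
      · exact hadj' e b
      · exact (hadj' e b).symm)
    (by
      rintro n n' (⟨e, b, g, -, rfl, rfl⟩ | ⟨e, b, g, -, rfl, rfl⟩) <;> rfl)
    (by
      rintro n n' n'' (⟨e, b, g, -, h1, h2⟩ | ⟨e, b, g, -, h1, h2⟩)
        (⟨e', b', g', -, h1', h2'⟩ | ⟨e', b', g', -, h1', h2'⟩) h
      · rw [h2, h2'] at h
        rw [h1] at h1'
        obtain ⟨rfl, rfl⟩ := hdet e e' b b' (congrArg (fun n => n.1) h1') h
        have : g = g' := congrArg (fun n => n.2.2) h1'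
        rw [h2, h2', this]
      · rw [h1] at h2'
        have := congrArg (fun n => n.2.1) h2'
        simp [nd] at this
      · rw [h2] at h1'
        have := congrArg (fun n => n.2.1) h1'
        simp [nd] at this
      · rw [h1, h1'] at h
        rw [h2] at h2'
        obtain ⟨rfl, rfl⟩ := hdet e e' b b' h (congrArg (fun n => n.1) h2')
        have : g * _ = g' * _ := congrArg (fun n => n.2.2) h2'
        have := mul_right_cancel this
        rw [h1, h1', this])
    (by
      rintro n n' (⟨e, b, g, hb, rfl, rfl⟩ | ⟨e, b, g, hb, rfl, rfl⟩) h
      · rfl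
      · exact absurd h (hor' e b hb))
  let X : ∀ e, LocalModel (S.M e) (S.τ e) (S.σ e) := fun e =>
    (localModel (S.M e) (hM2 e) (S.τ e) (S.σ e)).some
  have Nbr_iff : ∀ e n n', Nbr (S.M e) (S.τ e) (S.σ e) n n' → ZR S (nd S e n) (nd S e n') := by
    rintro e n n' (⟨g, rfl, rfl⟩ | ⟨h, g, rfl, rfl⟩)
    · exact ⟨e, false, g, by simp, rfl, rfl⟩
    · exact ⟨e, true, g, fun _ => h, rfl, rfl⟩
  have ZR_ι : ∀ e n n', ZR S (nd S e n) (nd S e n') → (X e).ι n = (X e).ι n' := by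
    rintro e ⟨b, s, g⟩ ⟨b', s', g'⟩ ⟨e', c, k, hc, h1, h2⟩
    have hbb : b' = !b := by
      by_contra hne
      have : b' = b := by
        revert hne; cases b <;> cases b' <;> simp
      subst this
      have h3 : ep S e b' = ep S e' c := congrArg (fun n => n.1) h1
      have h4 : ep S e b' = ep S e' (!c) := congrArg (fun n => n.1) h2
      exact (hadj' e' c).ne (h3.symm.trans h4)
    subst hbb
    obtain ⟨rfl, rfl⟩ := hdet e e' b c (congrArg (fun n => n.1) h1) (congrArg (fun n => n.1) h2)
    have : s = true := congrArg (fun n => n.2.1) h1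
    subst this
    have : s' = false := congrArg (fun n => n.2.1) h2
    subst this
    have : g = k := congrArg (fun n => n.2.2) h1
    subst this
    have : g' = _ := congrArg (fun n => n.2.2) h2
    subst this
    cases b
    · exact (X e).h2 g
    · have hM2 := hc rfl
      have := (X e).h5 (by rw [hM2]; decide) g
      have h0 : S.M e / 2 - 1 = 0 := by omega
      rw [h0] at this
      exact this.symm
  let Ω : Type := (ZG S).ConnectedComponent ⊕ (Σ e, (X e).Q)
  let cc : V × Bool × S.G → Ω := fun n => Sum.inl ((ZG S).connectedComponentMk n)
  have cc_eq : ∀ n n', cc n = cc n' → (ZG S).Reachable n n' := fun n n' h =>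
    SimpleGraph.ConnectedComponent.exact (Sum.inl_injective h)
  have cc_adj : ∀ n n', ZR S n n' → cc n = cc n' := fun n n' h =>
    congrArg Sum.inl (SimpleGraph.ConnectedComponent.sound
      (SimpleGraph.Adj.reachable (G := ZG S) (Or.inl h)))
  have ι_cc : ∀ e n n', (X e).ι n = (X e).ι n' → cc (nd S e n) = cc (nd S e n') := by
    intro e n n' h
    rcases (X e).inj n n' h with rfl | h | h
    · rfl
    · exact cc_adj _ _ (Nbr_iff e _ _ h)
    · exact (cc_adj _ _ (Nbr_iff e _ _ h)).symm
  have cc_ι : ∀ e n n', cc (nd S e n) = cc (nd S e n') → (X e).ι n = (X e).ι n' := by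
    intro e n n' h
    have hr := cc_eq _ _ h
    have hcase : ep S e n'.1 = ep S e n.1 ∨ Γ.Adj (ep S e n'.1) (ep S e n.1) := by
      rcases n with ⟨b, n⟩
      rcases n' with ⟨b', n'⟩
      by_cases hb : b = b'
      · subst hb; exact Or.inl rfl
      · have : b = !b' := by revert hb; cases b <;> cases b' <;> simp
        subst this
        exact Or.inr (hadj' e b')
    rcases near _ _ hr hcase with h | ⟨h | h, -⟩
    · have hn : n = n' := by
        rcases n with ⟨b, s, g⟩
        rcases n' with ⟨b', s', g'⟩
        have h1 : ep S e b = ep S e b' := congrArg (fun n => n.1) h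
        have hb : b = b' := by
          by_contra hb
          have : b = !b' := by revert hb; cases b <;> cases b' <;> simp
          subst this
          exact (hadj' e b').ne h1.symm
        subst hb
        have h2 : s = s' := congrArg (fun n => n.2.1) h
        have h3 : g = g' := congrArg (fun n => n.2.2) h
        rw [h2, h3]
      rw [hn]
    · exact ZR_ι e _ _ h
    · exact (ZR_ι e _ _ h).symm
  let em : ∀ e, (X e).Q → Ω := fun e q =>
    if h : ∃ n, (X e).ι n = q then cc (nd S e h.choose) else Sum.inr ⟨e, q⟩
  have em_ι : ∀ e n, em e ((X e).ι n) = cc (nd S e n) := by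
    intro e n
    have hex : ∃ n', (X e).ι n' = (X e).ι n := ⟨n, rfl⟩
    simp only [em, dif_pos hex]
    exact ι_cc e _ _ hex.choose_spec
  have em_no : ∀ e q, (¬ ∃ n, (X e).ι n = q) → em e q = Sum.inr ⟨e, q⟩ := by
    intro e q hq
    simp only [em, dif_neg hq]
  have em_inj : ∀ e, Function.Injective (em e) := by
    intro e q q' h
    by_cases hq : ∃ n, (X e).ι n = q <;> by_cases hq' : ∃ n, (X e).ι n = q'
    · obtain ⟨n, rfl⟩ := hq
      obtain ⟨n', rfl⟩ := hq'
      rw [em_ι, em_ι] at h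
      exact cc_ι e _ _ h
    · obtain ⟨n, rfl⟩ := hq
      rw [em_ι, em_no e _ hq'] at h
      exact absurd h (by simp [cc])
    · obtain ⟨n, rfl⟩ := hq'
      rw [em_ι, em_no e _ hq] at h
      exact absurd h (by simp [cc])
    · rw [em_no e _ hq, em_no e _ hq'] at h
      have := Sum.inr_injective h
      simpa using this
  let F : ∀ e, Equiv.Perm Ω := fun e => ((X e).π).viaEmbedding ⟨em e, em_inj e⟩
  have F_pow : ∀ e (k : ℕ) q, (F e ^ k) (em e q) = em e (((X e).π ^ k) q) := by
    intro e k
    induction k with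
    | zero => intro q; rfl
    | succ k ih =>
      intro q
      rw [pow_succ, pow_succ, Equiv.Perm.mul_apply, Equiv.Perm.mul_apply, ← ih]
      congr 1
      exact Equiv.Perm.viaEmbedding_apply _ ⟨em e, em_inj e⟩ q
  have F_one : ∀ e q, F e (em e q) = em e ((X e).π q) := fun e q =>
    Equiv.Perm.viaEmbedding_apply _ ⟨em e, em_inj e⟩ q
  refine S.injective_of_action (FreeGroup.lift F) (fun v g s => cc (v, s, g)) ?_ ?_ ?_ w hw hw1
  · intro e g
    funext s
    cases s
    · rw [actFun_false]
      simp only [hτ, FreeGroup.lift_apply_of]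
      have := F_one e ((X e).ι (true, true, g * S.τ e))
      rw [(X e).h1, em_ι, em_ι] at this
      exact this.symm
    · rw [actFun_true]
      simp only [hτ, map_one]
      have := em_ι e (false, true, g)
      rw [(X e).h2, em_ι] at this
      exact this.symm
  · intro e g
    by_cases hev : Even (S.M e)
    · funext s
      cases s
      · rw [actFun_false]
        simp only [hσ, if_pos hev, map_pow, FreeGroup.lift_apply_of]
        have := F_pow e (S.M e / 2) ((X e).ι (false, true, g * S.σ e))
        rw [(X e).h4 hev, em_ι, em_ι] at this
        exact this.symm
      · rw [actFun_true]
        simp only [hσ, if_pos hev, map_pow, FreeGroup.lift_apply_of]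
        have := F_pow e (S.M e / 2 - 1) ((X e).ι (false, false, g * S.σ e))
        rw [(X e).h5 hev, em_ι, em_ι] at this
        exact this.symm
    · funext s
      have := F_pow e (S.M e / 2) ((X e).ι (false, s, g * S.σ e))
      rw [(X e).h3 hev, em_ι, em_ι] at this
      cases s
      · rw [actFun_false]
        simp only [hσ, if_neg hev, map_pow, FreeGroup.lift_apply_of]
        exact this.symm
      · rw [actFun_true]
        simp only [hσ, if_neg hev, map_pow, FreeGroup.lift_apply_of]
        exact this.symm
  · intro s g g' h
    rcases near _ _ (cc_eq _ _ h) (Or.inl rfl) with h | ⟨-, h⟩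
    · exact congrArg (fun n => n.2.2) h
    · exact absurd rfl h

end InjSection
section TreeSection

/-- Product of voltages along a walk. -/
def wprod {V H : Type} [Group H] {T : SimpleGraph V} (h : V → V → H) :
    ∀ {a b : V}, T.Walk a b → H
  | _, _, .nil => 1
  | _, _, @SimpleGraph.Walk.cons _ _ a b _ _ w => h a b * wprod h w

lemma wprod_concat {V H : Type} [Group H] {T : SimpleGraph V} (h : V → V → H) {a b c : V}
    (w : T.Walk a b) (hbc : T.Adj b c) : wprod h (w.concat hbc) = wprod h w * h b c := by
  induction w with
  | nil => simp [SimpleGraph.Walk.concat_nil, wprod]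
  | cons hab w ih =>
    rw [SimpleGraph.Walk.concat_cons, wprod, wprod, ih, mul_assoc]

lemma exists_potential {V H : Type} [Group H] (T : SimpleGraph V) (hT : T.IsTree)
    (h : V → V → H) (hinv : ∀ a b, T.Adj a b → h b a = (h a b)⁻¹) (r : V) :
    ∃ φ : V → H, φ r = 1 ∧ ∀ a b, T.Adj a b → φ b = φ a * h a b := by
  choose p hp using fun v => (hT.existsUnique_path r v)
  have hp1 : ∀ v, (p v).IsPath := fun v => (hp v).1
  refine ⟨fun v => wprod h (p v), ?_, ?_⟩
  · have : p r = SimpleGraph.Walk.nil := ((hp r).2 _ SimpleGraph.Walk.IsPath.nil).symm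
    change wprod h (p r) = 1
    rw [this]
    rfl
  · intro a b hab
    change wprod h (p b) = wprod h (p a) * h a b
    by_cases hb : a ∈ (p b).support
    · rw [hT.isAcyclic.path_concat (hp1 a) (hp1 b) hab hb, wprod_concat]
    · have := hT.isAcyclic.mem_support_of_ne_mem_support_of_adj_of_isPath (hp1 a) (hp1 b) hab hb
      rw [hT.isAcyclic.path_concat (hp1 b) (hp1 a) hab.symm this, wprod_concat, hinv a b hab]
      simp

lemma exists_setup {V : Type} [Fintype V] [DecidableEq V]
    (Γ : SimpleGraph V) [DecidableRel Γ.Adj] (hconn : Γ.Connected) (M : V → V → ℕ)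
    (D : V → V → Prop) (hD : ∀ a b, ¬ (D a b ∧ D b a)) :
    ∃ S : Setup V (Fin Γ.edgeFinset.card),
      (∀ e, S.M e = M (S.src e) (S.tgt e)) ∧
      (∀ e, Γ.Adj (S.src e) (S.tgt e)) ∧
      (∀ e e' b b', ep S e b = ep S e' b' → ep S e (!b) = ep S e' (!b') → e = e' ∧ b = b') ∧
      (∀ e, ¬ D (S.tgt e) (S.src e)) ∧
      (∀ a b, Γ.Adj a b → ∃ e c, a = ep S e c ∧ b = ep S e (!c)) ∧
      Nat.card {e // e ∉ S.T} + Fintype.card V = Γ.edgeFinset.card + 1 := by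
  classical
  let en := Γ.edgeFinset.equivFin.symm
  have h1 : ∀ z : Sym2 V, ∃ a b, s(a, b) = z ∧ ¬ D b a := by
    intro z
    induction z with
    | _ a b =>
      by_cases h : D b a
      · exact ⟨b, a, Sym2.eq_swap, fun h' => hD a b ⟨h', h⟩⟩
      · exact ⟨a, b, rfl, h⟩
  choose src tgt hst hor using fun e => h1 (en e).1
  have hadj : ∀ e, Γ.Adj (src e) (tgt e) := by
    intro e
    rw [← SimpleGraph.mem_edgeSet, hst, ← SimpleGraph.mem_edgeFinset]
    exact (en e).2
  have hinj : ∀ e e', s(src e, tgt e) = s(src e', tgt e') → e = e' := by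
    intro e e' h
    rw [hst, hst] at h
    exact en.injective (Subtype.ext h)
  have hsurj : ∀ a b, Γ.Adj a b → ∃ e, s(src e, tgt e) = s(a, b) := by
    intro a b hab
    refine ⟨en.symm ⟨s(a, b), by simpa using hab⟩, ?_⟩
    rw [hst]
    simp
  have noswap : ∀ e e', src e = tgt e' → tgt e = src e' → False := by
    intro e e' h h'
    have : e = e' := hinj e e' (by rw [h, h', Sym2.eq_swap])
    subst this
    exact (hadj e).ne h
  obtain ⟨T, -, hTle, hT⟩ := hconn.exists_isTree_le_of_le_of_isAcyclic (H := ⊥) bot_le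
    SimpleGraph.isAcyclic_bot
  obtain ⟨r⟩ := hconn.nonempty
  let h : V → V → Wr (FreeGroup (Fin Γ.edgeFinset.card)) := fun a b =>
    if hx : ∃ e, src e = a ∧ tgt e = b then hτ hx.choose
    else if hx : ∃ e, src e = b ∧ tgt e = a then (hτ hx.choose)⁻¹ else 1
  have hh : ∀ e, h (src e) (tgt e) = hτ e := by
    intro e
    have hx : ∃ e', src e' = src e ∧ tgt e' = tgt e := ⟨e, rfl, rfl⟩
    have : hx.choose = e := hinj _ _ (by rw [hx.choose_spec.1, hx.choose_spec.2])
    simp only [h, dif_pos hx, this]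
  have hh' : ∀ e, h (tgt e) (src e) = (hτ e)⁻¹ := by
    intro e
    have hx : ∃ e', src e' = src e ∧ tgt e' = tgt e := ⟨e, rfl, rfl⟩
    have hy : ¬ ∃ e', src e' = tgt e ∧ tgt e' = src e := by
      rintro ⟨e', h1, h2⟩
      exact noswap _ _ h1 h2
    have : hx.choose = e := hinj _ _ (by rw [hx.choose_spec.1, hx.choose_spec.2])
    simp only [h, dif_pos hx, dif_neg hy, this]
  obtain ⟨φ, hφr, hφ⟩ := exists_potential T hT h (by
    intro a b hab
    obtain ⟨e, he⟩ := hsurj a b (hTle hab)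
    rcases Sym2.eq_iff.1 he with ⟨rfl, rfl⟩ | ⟨rfl, rfl⟩
    · rw [hh, hh']
    · rw [hh, hh', inv_inv]) r
  let S : Setup V (Fin Γ.edgeFinset.card) :=
    { src := src
      tgt := tgt
      M := fun e => M (src e) (tgt e)
      r := r
      T := {e | T.Adj (src e) (tgt e)}
      φ := φ
      φ_r := hφr
      φ_T := by
        intro e he
        rw [hφ _ _ he, hh]
      ind := by
        intro P hr hP v
        obtain ⟨w⟩ := hT.connected.preconnected r v
        clear hφr
        induction w with
        | nil => exact hr
        | cons hab w ih =>
          apply ih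
          obtain ⟨e, he⟩ := hsurj _ _ (hTle hab)
          rcases Sym2.eq_iff.1 he with ⟨rfl, rfl⟩ | ⟨rfl, rfl⟩
          · exact (hP e hab).1 hr
          · exact (hP e hab.symm).2 hr }
  refine ⟨S, fun e => rfl, hadj, ?_, hor, ?_, ?_⟩
  · have hs : ∀ e b, s(ep S e b, ep S e (!b)) = s(src e, tgt e) := by
      rintro e (_ | _)
      · rfl
      · exact Sym2.eq_swap
    intro e e' b b' h1 h2
    have : e = e' := hinj e e' (by rw [← hs e b, ← hs e' b', h1, h2])
    subst this
    refine ⟨rfl, ?_⟩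
    cases b <;> cases b'
    · rfl
    · exact absurd h1 (hadj e).ne
    · exact absurd h1 (hadj e).ne.symm
    · rfl
  · intro a b hab
    obtain ⟨e, he⟩ := hsurj a b hab
    rcases Sym2.eq_iff.1 he with ⟨rfl, rfl⟩ | ⟨rfl, rfl⟩
    · exact ⟨e, false, rfl, rfl⟩
    · exact ⟨e, true, rfl, rfl⟩
  · have hc1 : Fintype.card {e // e ∈ S.T} = T.edgeFinset.card := by
      refine Eq.trans ?_ (SimpleGraph.edgeFinset_card (G := T)).symm
      refine Fintype.card_of_bijective
        (f := fun e : {e // e ∈ S.T} => (⟨s(src e.1, tgt e.1), e.2⟩ : T.edgeSet)) ⟨?_, ?_⟩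
      · intro e e' he
        exact Subtype.ext (hinj _ _ (congrArg Subtype.val he))
      · rintro ⟨z, hz⟩
        induction z with
        | _ a b =>
          obtain ⟨e, he⟩ := hsurj a b (hTle hz)
          refine ⟨⟨e, ?_⟩, Subtype.ext he⟩
          change T.Adj _ _
          rw [← SimpleGraph.mem_edgeSet, he]
          exact hz
    have hc2 := hT.card_edgeFinset
    have hc3 := Fintype.card_subtype_compl (fun e => e ∈ S.T)
    have hc4 := Fintype.card_subtype_le (fun e => e ∈ S.T)
    rw [Fintype.card_fin] at hc3 hc4
    rw [Nat.card_eq_fintype_card, hc3]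
    omega

end TreeSection
section FinalSection

lemma mul_swap_pow {P : Type} [Group P] (p q : P) (k : ℕ) : q * (p * q) ^ k = (q * p) ^ k * q := by
  induction k with
  | zero => simp
  | succ k ih => rw [pow_succ, ← mul_assoc, ih, pow_succ]; simp [mul_assoc]

/-- Alternating product. -/
def aw {P : Type} [Group P] (p q : P) (M : ℕ) : P :=
  ((List.range M).map fun i => if i % 2 = 0 then p else q).prod

lemma aw_even {P : Type} [Group P] (p q : P) (m : ℕ) : aw p q (2 * m) = (p * q) ^ m := by
  induction m with
  | zero => simp [aw]
  | succ m ih =>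
    rw [pow_succ, ← ih]
    have h1 : (2 * m) % 2 = 0 := by omega
    have h2 : (2 * m + 1) % 2 = 1 := by omega
    simp [aw, show 2 * (m + 1) = (2 * m + 1) + 1 by omega, List.range_succ, h2, mul_assoc]

lemma aw_odd {P : Type} [Group P] (p q : P) (m : ℕ) :
    aw p q (2 * m + 1) = (p * q) ^ m * p := by
  rw [← aw_even]
  simp [aw, List.range_succ]

lemma lift_altWord {V P : Type} [Group P] (F : FreeGroup V →* P) (a b : V) (M : ℕ) :
    F (altWord a b M) = aw (F (FreeGroup.of a)) (F (FreeGroup.of b)) M := by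
  rw [altWord, map_list_prod, List.map_map, aw]
  congr 1
  refine List.map_congr_left fun i _ => ?_
  by_cases h : i % 2 = 0 <;> simp [h]

lemma rel_aw {P : Type} [Group P] (p q : P) (M : ℕ) (hM : 2 ≤ M) :
    Rel M p q ↔ aw p q M = aw q p M := by
  rcases Nat.even_or_odd' M with ⟨m, rfl | rfl⟩
  · obtain ⟨k, rfl⟩ : ∃ k, m = k + 1 := ⟨m - 1, by omega⟩
    have h1 : 2 * (k + 1) / 2 = k + 1 := by omega
    rw [Rel, if_pos (by simp), aw_even, aw_even, h1, eq_mul_inv_iff_mul_eq, Nat.add_sub_cancel,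
      mul_swap_pow, mul_assoc, ← pow_succ]
    exact eq_comm
  · have h1 : (2 * m + 1) / 2 = m := by omega
    rw [Rel, if_neg (by simp), aw_odd, aw_odd, h1, mul_swap_pow]
    exact eq_comm

lemma art_isUniv {V : Type} (Γ : SimpleGraph V) (M : V → V → ℕ) (hsymm : ∀ a b, M a b = M b a)
    (h2 : ∀ a b, Γ.Adj a b → 2 ≤ M a b) {E : Type} (S : Setup V E)
    (hM : ∀ e, S.M e = M (S.src e) (S.tgt e)) (hadj : ∀ e, Γ.Adj (S.src e) (S.tgt e))
    (hcov : ∀ a b, Γ.Adj a b → ∃ e c, a = ep S e c ∧ b = ep S e (!c)) :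
    ∃ f ρ, IsUniv S.L (ArtinGroup Γ M) f ρ := by
  refine ⟨_, _, S.isUniv_art (fun v => (PresentedGroup.of v : ArtinGroup Γ M)) ?_ ?_ ?_⟩
  · intro g hg
    exact PresentedGroup.ext hg
  · intro e
    rw [hM, rel_aw _ _ _ (h2 _ _ (hadj e))]
    have hmem : altWord (S.src e) (S.tgt e) (M (S.src e) (S.tgt e)) *
        (altWord (S.tgt e) (S.src e) (M (S.src e) (S.tgt e)))⁻¹ ∈ artinRels Γ M :=
      ⟨_, _, hadj e, rfl⟩
    have h1 := PresentedGroup.one_of_mem hmem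
    rw [map_mul, map_inv, mul_inv_eq_one, lift_altWord, lift_altWord] at h1
    exact h1
  · intro Q _ q hq
    refine ⟨PresentedGroup.toGroup (f := q) ?_, fun v => PresentedGroup.toGroup.of _⟩
    rintro _ ⟨a, b, hab, rfl⟩
    rw [map_mul, map_inv, mul_inv_eq_one, lift_altWord, lift_altWord, FreeGroup.lift_apply_of,
      FreeGroup.lift_apply_of]
    obtain ⟨e, c, rfl, rfl⟩ := hcov a b hab
    have h1 := hq e
    rw [hM, rel_aw _ _ _ (h2 _ _ (hadj e))] at h1
    cases c
    · exact h1
    · rw [hsymm]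
      exact h1.symm

lemma sign_iff {V : Type} (Γ : SimpleGraph V) (M : V → V → ℕ) (hsymm : ∀ a b, M a b = M b a)
    {E : Type} (S : Setup V E)
    (hM : ∀ e, S.M e = M (S.src e) (S.tgt e)) (hadj : ∀ e, Γ.Adj (S.src e) (S.tgt e))
    (hcov : ∀ a b, Γ.Adj a b → ∃ e c, a = ep S e c ∧ b = ep S e (!c)) :
    (∀ w, (S.L w).s = false) ↔ (IsBipartite Γ ∧ ∀ a b, Γ.Adj a b → Even (M a b)) := by
  constructor
  · intro h
    have h1 : ∀ e, (S.φ (S.tgt e)).s = !(S.φ (S.src e)).s := by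
      intro e
      have := h (S.τ e)
      rw [S.L_τ] at this
      revert this
      cases h1 : (S.φ (S.tgt e)).s <;> cases h2 : (S.φ (S.src e)).s <;> simp [hτ, h1, h2]
    have h2 : ∀ e, Even (S.M e) := by
      intro e
      by_contra hodd
      have := h (S.σ e)
      rw [S.L_σ] at this
      revert this
      cases h2 : (S.φ (S.src e)).s <;> simp [hσ, hodd, h1, h2]
    refine ⟨⟨{v | (S.φ v).s = true}, ?_⟩, ?_⟩
    · intro a b hab
      obtain ⟨e, c, rfl, rfl⟩ := hcov a b hab
      cases c <;> simp [ep, h1]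
    · intro a b hab
      obtain ⟨e, c, rfl, rfl⟩ := hcov a b hab
      have := h2 e
      rw [hM] at this
      cases c
      · exact this
      · rw [hsymm]; exact this
  · rintro ⟨⟨A, hA⟩, hev⟩
    have hP : ∀ v, ((S.φ v).s = true ↔ ¬ (v ∈ A ↔ S.r ∈ A)) := by
      refine S.ind _ (by simp [S.φ_r]) ?_
      intro e he
      have h1 := hA _ _ (hadj e)
      rw [S.φ_T e he]
      cases h2 : (S.φ (S.src e)).s <;> simp [hτ, h2] <;> tauto
    have h1 : ∀ e, (S.φ (S.tgt e)).s = !(S.φ (S.src e)).s := by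
      intro e
      have h1 := hA _ _ (hadj e)
      have h2 := hP (S.src e)
      have h3 := hP (S.tgt e)
      cases h4 : (S.φ (S.tgt e)).s <;> cases h5 : (S.φ (S.src e)).s <;> simp [h4, h5] at h2 h3 ⊢ <;>
        tauto
    intro w
    rw [← sgn_eq_one]
    refine S.G_ind ((sgn.comp S.L).ker) ?_ ?_ w
    · intro e
      change sgn (S.L (S.τ e)) = 1
      rw [sgn_eq_one, S.L_τ]
      cases h2 : (S.φ (S.src e)).s <;> simp [hτ, h1, h2]
    · intro e
      have he : Even (S.M e) := by rw [hM]; exact hev _ _ (hadj e)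
      change sgn (S.L (S.σ e)) = 1
      rw [sgn_eq_one, S.L_σ]
      cases h2 : (S.φ (S.src e)).s <;> simp [hσ, he, h1, h2]

lemma IsUniv.comp {A : Type} [Group A] {G G' P : Type} [Group G] [Group G'] [Group P]
    {L : G →* Wr A} {f : A →* P} {ρ : P} (h : IsUniv L P f ρ) (θ : G' ≃* G) :
    IsUniv (L.comp θ.toMonoidHom) P f ρ where
  fix w := h.fix (θ w)
  desc Q _ f' ρ' h' := h.desc Q f' ρ' fun w => by
    have := h' (θ.symm w)
    simpa using this
  uniq := h.uniq

end FinalSection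

end ArtinSplit

theorem artinGroup_splitting {V : Type} [Fintype V] [DecidableEq V]
    (Γ : SimpleGraph V) [DecidableRel Γ.Adj] (hconn : Γ.Connected)
    (M : V → V → ℕ) (hsymm : ∀ a b, M a b = M b a) (h2 : ∀ a b, Γ.Adj a b → 2 ≤ M a b)
    (D : V → V → Prop) (hD : IsAdmissibleOrientation Γ M D) :
    ((IsBipartite Γ ∧ ∀ a b, Γ.Adj a b → Even (M a b)) →
      ∃ (f₁ f₂ : FreeGroup (Fin (2 * Γ.edgeFinset.card + 1 - Fintype.card V)) →*
          FreeGroup (Fin Γ.edgeFinset.card))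
        (h₁ : Function.Injective f₁) (h₂ : Function.Injective f₂),
        Nonempty (ArtinGroup Γ M ≃*
          HNNExtension (FreeGroup (Fin Γ.edgeFinset.card)) f₁.range f₂.range
            ((MonoidHom.ofInjective h₁).symm.trans (MonoidHom.ofInjective h₂)))) ∧
    (¬ (IsBipartite Γ ∧ ∀ a b, Γ.Adj a b → Even (M a b)) →
      ∃ (i : FreeGroup (Fin (4 * Γ.edgeFinset.card + 1 - 2 * Fintype.card V)) →*
          FreeGroup (Fin Γ.edgeFinset.card))
        (j : FreeGroup (Fin (4 * Γ.edgeFinset.card + 1 - 2 * Fintype.card V)) →*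
          FreeGroup (Fin (2 * Γ.edgeFinset.card + 1 - Fintype.card V))),
        Function.Injective i ∧ Function.Injective j ∧ j.range.index = 2 ∧
        Nonempty (ArtinGroup Γ M ≃* AmalgamatedProduct i j)) := by
  obtain ⟨S, hM, hadj, hdet, hor, hcov, hcard⟩ :=
    ArtinSplit.exists_setup Γ hconn M D hD.not_both
  classical
  have hinj := ArtinSplit.inj_main S Γ M D hD hM
    (fun e => by rw [hM]; exact h2 _ _ (hadj e)) hadj hdet hor
  obtain ⟨f, ρ, hU⟩ := ArtinSplit.art_isUniv Γ M hsymm h2 S hM hadj hcov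
  have hsign := ArtinSplit.sign_iff Γ M hsymm S hM hadj hcov
  have hK : Fintype.card S.K = 2 * Γ.edgeFinset.card + 1 - Fintype.card V := by
    rw [Fintype.card_sum, Fintype.card_fin, ← Nat.card_eq_fintype_card]
    omega
  let eK : Fin (2 * Γ.edgeFinset.card + 1 - Fintype.card V) ≃ S.K :=
    (Fintype.equivFinOfCardEq hK).symm
  let θ := FreeGroup.freeGroupCongr eK
  have hU' := hU.comp θ
  generalize hL : S.L.comp θ.toMonoidHom = L at hU'
  have hLw : ∀ w, L w = S.L (θ w) := by
    intro w
    rw [← hL]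
    rfl
  have hLinj : ∀ w, (L w).s = false → (L w).u = 1 ∨ (L w).v = 1 → w = 1 := by
    intro w h1 h2
    rw [hLw] at h1 h2
    exact (MulEquiv.map_eq_one_iff θ).1 (hinj _ h1 h2)
  have hsign' : (∀ w, (L w).s = false) ↔ (IsBipartite Γ ∧ ∀ a b, Γ.Adj a b → Even (M a b)) := by
    rw [← hsign]
    refine ⟨fun h w => ?_, fun h w => ?_⟩
    · have := h (θ.symm w)
      rwa [hLw, MulEquiv.apply_symm_apply] at this
    · rw [hLw]; exact h _
  refine ⟨fun hbip => ?_, fun hbip => ?_⟩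
  · have hs := hsign'.2 hbip
    have i1 : Function.Injective (ArtinSplit.vHom L hs) := by
      rw [injective_iff_map_eq_one]
      exact fun w hw => hLinj w (hs w) (Or.inr hw)
    have i2 : Function.Injective (ArtinSplit.uHom L hs) := by
      rw [injective_iff_map_eq_one]
      exact fun w hw => hLinj w (hs w) (Or.inl hw)
    refine ⟨_, _, i1, i2, hU'.equiv (ArtinSplit.isUniv_hnn L _ _ i1 i2 ?_)⟩
    intro w
    ext
    · rfl
    · rfl
    · exact hs w
  · let ε := ArtinSplit.sgn.comp L
    have hε : ∀ w, (L w).s = false ↔ w ∈ ε.ker := fun w => ArtinSplit.sgn_eq_one.symm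
    obtain ⟨k₀, hk₀⟩ : ∃ k₀, ε (FreeGroup.of k₀) = -1 := by
      by_contra hno
      push Not at hno
      apply hbip
      rw [← hsign']
      have : ε = 1 := by
        ext k
        have := (Int.units_eq_one_or (ε (FreeGroup.of k))).resolve_right (hno k)
        simp [this]
      intro w
      rw [hε, this]
      simp
    obtain ⟨j, hjinj, hjr⟩ := ArtinSplit.index_two ε k₀ hk₀
      (4 * Γ.edgeFinset.card + 1 - 2 * Fintype.card V) (by rw [Fintype.card_fin]; omega)
    have hs : ∀ c, ((L.comp j) c).s = false := by
      intro c
      refine (hε (j c)).2 ?_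
      rw [← hjr]
      exact ⟨c, rfl⟩
    refine ⟨ArtinSplit.uHom (L.comp j) hs, j, ?_, hjinj, ?_, ?_⟩
    · rw [injective_iff_map_eq_one]
      intro c hc
      have := hLinj (j c) (hs c) (Or.inl hc)
      exact (injective_iff_map_eq_one j).1 hjinj c this
    · rw [hjr, Subgroup.index_ker]
      have : ε.range = ⊤ := by
        rw [eq_top_iff]
        intro x _
        rcases Int.units_eq_one_or x with rfl | rfl
        · exact ⟨1, map_one _⟩
        · exact ⟨_, hk₀⟩
      rw [this]
      simp
    · refine hU'.equiv (ArtinSplit.isUniv_amalg L j _ (FreeGroup.of k₀) ?_ ?_ ?_)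
      · by_contra h
        rw [Bool.not_eq_true, ← ArtinSplit.sgn_eq_one] at h
        have h3 : ε (FreeGroup.of k₀) = 1 := h
        rw [hk₀] at h3
        exact absurd h3 (by decide)
      · intro w
        rw [hε, hjr]
      · intro c
        rfl
end

section
/- Let Γ be a finite connected simple graph with all edge labels ≥ 3 (large type). If Γ admits an orientation of all of its edges in which every simple cycle is directed, then the Artin group Art_Γ splits as an amalgamated free product A *_C B or an HNN extension A*_B, where A, B, C are free groups of finite rank and all the defining homomorphisms are injective. -/
/-! ### The wreath product `A ≀ ℤ/2` -/

/-- Elements of the wreath product of `A` with the group of order two. -/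
@[ext] structure Wr (A : Type) where
  p : A
  q : A
  s : Bool

namespace Wr

variable {A : Type} [Group A]

instance : Mul (Wr A) :=
  ⟨fun x y => ⟨x.p * (if x.s then y.q else y.p), x.q * (if x.s then y.p else y.q), xor x.s y.s⟩⟩

instance : One (Wr A) := ⟨⟨1, 1, false⟩⟩

instance : Inv (Wr A) :=
  ⟨fun x => ⟨if x.s then x.q⁻¹ else x.p⁻¹, if x.s then x.p⁻¹ else x.q⁻¹, x.s⟩⟩

theorem mul_p (x y : Wr A) : (x * y).p = x.p * (if x.s then y.q else y.p) := rfl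
theorem mul_q (x y : Wr A) : (x * y).q = x.q * (if x.s then y.p else y.q) := rfl
theorem mul_s (x y : Wr A) : (x * y).s = xor x.s y.s := rfl
theorem one_p : (1 : Wr A).p = 1 := rfl
theorem one_q : (1 : Wr A).q = 1 := rfl
theorem one_s : (1 : Wr A).s = false := rfl
theorem inv_p (x : Wr A) : (x⁻¹).p = if x.s then x.q⁻¹ else x.p⁻¹ := rfl
theorem inv_q (x : Wr A) : (x⁻¹).q = if x.s then x.p⁻¹ else x.q⁻¹ := rfl
theorem inv_s (x : Wr A) : (x⁻¹).s = x.s := rfl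

instance : Group (Wr A) := Group.ofLeftAxioms
  (by
    rintro ⟨a, b, s⟩ ⟨c, d, t⟩ ⟨e, f, u⟩
    cases s <;> cases t <;> cases u <;>
      (ext <;> simp [mul_p, mul_q, mul_s, mul_assoc]))
  (by
    rintro ⟨a, b, s⟩
    cases s <;> (ext <;> simp [mul_p, mul_q, mul_s, one_p, one_q, one_s]))
  (by
    rintro ⟨a, b, s⟩
    cases s <;>
      (ext <;> simp [mul_p, mul_q, mul_s, one_p, one_q, one_s, inv_p, inv_q, inv_s]))

/-- Functoriality of the wreath product. -/
def map {H : Type} [Group H] (f : A →* H) : Wr A →* Wr H where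
  toFun x := ⟨f x.p, f x.q, x.s⟩
  map_one' := by ext <;> simp [one_p, one_q, one_s]
  map_mul' := by
    rintro ⟨a, b, s⟩ ⟨c, d, t⟩
    cases s <;> (ext <;> simp [mul_p, mul_q, mul_s])

theorem map_p {H : Type} [Group H] (f : A →* H) (x : Wr A) : (map f x).p = f x.p := rfl
theorem map_q {H : Type} [Group H] (f : A →* H) (x : Wr A) : (map f x).q = f x.q := rfl
theorem map_s {H : Type} [Group H] (f : A →* H) (x : Wr A) : (map f x).s = x.s := rfl

theorem map_map {H K : Type} [Group H] [Group K] (f : A →* H) (g : H →* K) (x : Wr A) :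
    map g (map f x) = map (g.comp f) x := rfl

theorem map_id (x : Wr A) : map (MonoidHom.id A) x = x := rfl

/-- The sign homomorphism. -/
def sign : Wr A →* Multiplicative (ZMod 2) where
  toFun x := if x.s then Multiplicative.ofAdd 1 else 1
  map_one' := by simp [one_s]
  map_mul' := by
    rintro ⟨a, b, s⟩ ⟨c, d, t⟩
    cases s <;> cases t <;> simp [mul_s] <;> decide

theorem sign_eq_one (x : Wr A) : sign x = 1 ↔ x.s = false := by
  rcases x with ⟨a, b, s⟩
  cases s <;> simp [sign]

/-- The involution attached to `t`. -/
def tau (t : A) : Wr A := ⟨t, t⁻¹, true⟩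

theorem map_tau {H : Type} [Group H] (f : A →* H) (t : A) : map f (tau t) = tau (f t) := by
  ext <;> simp [map_p, map_q, map_s, tau]

theorem conj_tau (w : Wr A) (t : A) : w * tau t * w⁻¹ = tau ((w * tau t * w⁻¹).p) := by
  rcases w with ⟨a, b, s⟩
  cases s <;>
    (ext <;> simp [mul_p, mul_q, mul_s, inv_p, inv_q, inv_s, tau, mul_assoc])

theorem tau_inj {a b : A} (h : tau a = tau b) : a = b := congrArg Wr.p h

end Wr

open Wr

/-- `w` is compatible with `φ` and `t`. -/
def Compat {A H : Type} [Group A] [Group H] (φ : A →* H) (t : H) (w : Wr A) : Prop :=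
  Wr.map φ w * tau t = tau t * Wr.map φ w

theorem compat_false {A H : Type} [Group A] [Group H] {φ : A →* H} {t : H} {w : Wr A}
    (hs : w.s = false) : Compat φ t w ↔ φ w.p * t = t * φ w.q := by
  unfold Compat
  constructor
  · intro h
    have := congrArg Wr.p h
    simpa [mul_p, map_p, map_q, map_s, hs, tau] using this
  · intro h
    ext
    · simpa [mul_p, map_p, map_q, map_s, hs, tau] using h
    · simp only [mul_q, map_p, map_q, map_s, hs, tau]
      simp only [Bool.false_eq_true, if_false, if_true]
      rw [eq_inv_mul_iff_mul_eq, ← mul_assoc, ← h]; group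
    · simp [mul_s, map_s, hs, tau]

theorem compat_true {A H : Type} [Group A] [Group H] {φ : A →* H} {t : H} {w : Wr A}
    (hs : w.s = true) : Compat φ t w ↔ φ w.p * t⁻¹ = t * φ w.q := by
  unfold Compat
  constructor
  · intro h
    have := congrArg Wr.p h
    simpa [mul_p, map_p, map_q, map_s, hs, tau] using this
  · intro h
    ext
    · simpa [mul_p, map_p, map_q, map_s, hs, tau] using h
    · simp only [mul_q, map_p, map_q, map_s, hs, tau]
      simp only [if_true]
      rw [eq_inv_mul_iff_mul_eq, ← mul_assoc, ← h]; group
    · simp [mul_s, map_s, hs, tau]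

/-- The universal group generated by `A` and an element `t` compatible with all `Λ β`. -/
structure IsP {A B G : Type} [Group A] [Group B] [Group G] (Λ : B →* Wr A)
    (φ : A →* G) (t : G) : Prop where
  compat : ∀ β, Compat φ t (Λ β)
  lift : ∀ (H : Type) [Group H] (φ' : A →* H) (t' : H), (∀ β, Compat φ' t' (Λ β)) →
    ∃ f : G →* H, f.comp φ = φ' ∧ f t = t'
  uniq : ∀ (H : Type) [Group H] (f g : G →* H), f.comp φ = g.comp φ → f t = g t → f = g

theorem IsP.equiv {A B G G' : Type} [Group A] [Group B] [Group G] [Group G'] {Λ : B →* Wr A}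
    {φ : A →* G} {t : G} {φ' : A →* G'} {t' : G'} (h : IsP Λ φ t) (h' : IsP Λ φ' t') :
    Nonempty (G ≃* G') := by
  obtain ⟨f, hf, hft⟩ := h.lift G' φ' t' h'.compat
  obtain ⟨g, hg, hgt⟩ := h'.lift G φ t h.compat
  refine ⟨MonoidHom.toMulEquiv f g ?_ ?_⟩
  · apply h.uniq
    · rw [MonoidHom.comp_assoc, hf, hg]; rfl
    · simp [hft, hgt]
  · apply h'.uniq
    · rw [MonoidHom.comp_assoc, hg, hf]; rfl
    · simp [hft, hgt]

theorem IsP.transport {A B G A' B' : Type} [Group A] [Group B] [Group G] [Group A'] [Group B']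
    {Λ : B →* Wr A} {φ : A →* G} {t : G} (h : IsP Λ φ t) (eA : A ≃* A') (eB : B ≃* B') :
    IsP (((Wr.map eA.toMonoidHom).comp Λ).comp eB.symm.toMonoidHom)
      (φ.comp eA.symm.toMonoidHom) t := by
  have key : ∀ {H : Type} [Group H] (φ' : A' →* H) (t' : H) (β : B'),
      Compat φ' t' ((((Wr.map eA.toMonoidHom).comp Λ).comp eB.symm.toMonoidHom) β) ↔
      Compat (φ'.comp eA.toMonoidHom) t' (Λ (eB.symm β)) := by
    intro H _ φ' t' β
    rfl
  have hc : ∀ {H : Type} [Group H] (φ' : A →* H),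
      (φ'.comp eA.symm.toMonoidHom).comp eA.toMonoidHom = φ' := by
    intro H _ φ'
    ext x; simp
  refine ⟨?_, ?_, ?_⟩
  · intro β
    rw [key, hc]
    exact h.compat _
  · intro H _ φ' t' hcomp
    obtain ⟨f, hf, hft⟩ := h.lift H (φ'.comp eA.toMonoidHom) t' (by
      intro β
      have := (key φ' t' (eB β)).1 (hcomp _)
      simpa using this)
    refine ⟨f, ?_, hft⟩
    rw [← MonoidHom.comp_assoc, hf]
    ext x; simp
  · intro H _ f g hfg hft
    apply h.uniq _ _ _ _ hft
    have := congrArg (fun k : A' →* H => k.comp eA.toMonoidHom) hfg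
    ext x
    have := DFunLike.congr_fun this x
    simpa using this

/-- The homomorphism `B → H` associated with compatible data. -/
theorem exists_psi {A B H : Type} [Group A] [Group B] [Group H] (Λ : B →* Wr A)
    (φ : A →* H) (t : H) (hc : ∀ β, Compat φ t (Λ β)) :
    ∃ ψ : B →* H, (∀ β, (Λ β).s = false → ψ β = φ (Λ β).p) ∧
      (∀ β, (Λ β).s = true → ψ β = φ (Λ β).p * t⁻¹) := by
  refine ⟨MonoidHom.mk' (fun β => if (Λ β).s then φ (Λ β).p * t⁻¹ else φ (Λ β).p) ?_, ?_, ?_⟩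
  · intro β γ
    have hγ := hc γ
    rcases hb : (Λ β).s <;> rcases hg : (Λ γ).s
    · simp [map_mul, mul_s, mul_p, hb, hg]
    · simp [map_mul, mul_s, mul_p, hb, hg, mul_assoc]
    · rw [compat_false hg] at hγ
      have : t⁻¹ * φ (Λ γ).p = φ (Λ γ).q * t⁻¹ := by
        rw [inv_mul_eq_iff_eq_mul, ← mul_assoc, ← hγ]; group
      simp [map_mul, mul_s, mul_p, hb, hg, mul_assoc, this]
    · rw [compat_true hg] at hγ
      simp [map_mul, mul_s, mul_p, hb, hg, mul_assoc, hγ]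
  · intro β h; simp [h]
  · intro β h; simp [h]

theorem amalgam_isP {A B C : Type} [Group A] [Group B] [Group C] (Λ : B →* Wr A)
    (i : C →* A) (j : C →* B) (hj : ∀ c, (Λ (j c)).s = false)
    (hij : ∀ c, i c = (Λ (j c)).p) (hsurj : ∀ β, (Λ β).s = false → ∃ c, j c = β)
    (β₀ : B) (h₀ : (Λ β₀).s = true) :
    ∃ (φ : A →* AmalgamatedProduct i j) (t : AmalgamatedProduct i j), IsP Λ φ t := by
  let φ : A →* AmalgamatedProduct i j := Monoid.PushoutI.of (φ := twoMaps i j) true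
  let ψ : B →* AmalgamatedProduct i j := Monoid.PushoutI.of (φ := twoMaps i j) false
  have glue0 : ∀ c, φ (i c) = ψ (j c) := fun c =>
    (Monoid.PushoutI.of_apply_eq_base (twoMaps i j) true c).trans
      (Monoid.PushoutI.of_apply_eq_base (twoMaps i j) false c).symm
  have glue : ∀ β, (Λ β).s = false → ψ β = φ (Λ β).p := by
    intro β h
    obtain ⟨c, rfl⟩ := hsurj β h
    rw [← glue0, hij]
  have hlift : ∀ (H : Type) [Group H] (φ' : A →* H) (ψ' : B →* H),
      (∀ c, φ' (i c) = ψ' (j c)) →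
      ∃ f : AmalgamatedProduct i j →* H, (∀ x, f (φ x) = φ' x) ∧ (∀ x, f (ψ x) = ψ' x) := by
    intro H _ φ' ψ' h
    refine ⟨Monoid.PushoutI.lift (φ := twoMaps i j)
      (fun b => match b with
        | false => ψ'
        | true => φ') (φ'.comp i) ?_, ?_, ?_⟩
    · intro b
      cases b
      · ext c; exact (h c).symm
      · rfl
    · intro x
      exact Monoid.PushoutI.lift_of (φ := twoMaps i j) _ _ _ (i := true) x
    · intro x
      exact Monoid.PushoutI.lift_of (φ := twoMaps i j) _ _ _ (i := false) x
  have hext : ∀ (H : Type) [Group H] (f g : AmalgamatedProduct i j →* H),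
      (∀ x, f (φ x) = g (φ x)) → (∀ x, f (ψ x) = g (ψ x)) → f = g := by
    intro H _ f g h1 h2
    apply Monoid.PushoutI.hom_ext_nonempty
    intro b
    cases b
    · ext x; exact h2 x
    · ext x; exact h1 x
  have e1 : ∀ β, (Λ β).s = false → ψ β₀ * ψ β * (ψ β₀)⁻¹ =
      φ (Λ β₀).p * φ (Λ β).q * (φ (Λ β₀).p)⁻¹ := by
    intro β h
    have := glue (β₀ * β * β₀⁻¹) (by simp [mul_s, inv_s, h, h₀])
    simpa [mul_p, mul_s, inv_p, inv_s, inv_q, h, h₀] using this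
  have e2 : ∀ β, (Λ β).s = true → ψ β * (ψ β₀)⁻¹ = φ (Λ β).p * (φ (Λ β₀).p)⁻¹ := by
    intro β h
    have := glue (β * β₀⁻¹) (by simp [mul_s, inv_s, h, h₀])
    simpa [mul_p, mul_s, inv_p, inv_s, inv_q, h, h₀] using this
  have e3 : ∀ β, (Λ β).s = true → ψ β₀ * ψ β = φ (Λ β₀).p * φ (Λ β).q := by
    intro β h
    have := glue (β₀ * β) (by simp [mul_s, inv_s, h, h₀])
    simpa [mul_p, mul_s, inv_p, inv_s, inv_q, h, h₀] using this
  refine ⟨φ, (ψ β₀)⁻¹ * φ (Λ β₀).p, ?_, ?_, ?_⟩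
  · intro β
    rcases hb : (Λ β).s
    · rw [compat_false hb, ← glue β hb]
      have := e1 β hb
      rw [mul_inv_eq_iff_eq_mul] at this
      rw [mul_assoc, eq_inv_mul_iff_mul_eq]
      calc ψ β₀ * (ψ β * ((ψ β₀)⁻¹ * φ (Λ β₀).p))
          = (ψ β₀ * ψ β) * (ψ β₀)⁻¹ * φ (Λ β₀).p := by group
        _ = _ := by rw [this]; group
    · rw [compat_true hb, mul_assoc, ← e3 β hb]
      have := e2 β hb
      rw [mul_inv_rev, ← mul_assoc, ← this]; group
  · intro H _ φ' t' hc
    obtain ⟨ψ', h1, h2⟩ := exists_psi Λ φ' t' hc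
    obtain ⟨f, hf, hg⟩ := hlift H φ' ψ' (fun c => by rw [h1 _ (hj c), hij])
    refine ⟨f, MonoidHom.ext hf, ?_⟩
    rw [map_mul, map_inv, hf, hg, h2 _ h₀]; group
  · intro H _ f g h ht
    have h1 : ∀ x, f (φ x) = g (φ x) := fun x => DFunLike.congr_fun h x
    have h0 : f (ψ β₀) = g (ψ β₀) := by
      rw [map_mul, map_mul, h1] at ht
      have := mul_right_cancel ht
      simpa using this
    apply hext _ _ _ h1
    intro β
    rcases hb : (Λ β).s
    · rw [glue β hb, h1]
    · have := e2 β hb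
      rw [mul_inv_eq_iff_eq_mul] at this
      rw [this]
      simp only [map_mul, map_inv, h1, h0]

theorem hnn_isP {A B : Type} [Group A] [Group B] (Λ : B →* Wr A)
    (hs : ∀ β, (Λ β).s = false) (f₁ f₂ : B →* A) (hf₁ : ∀ β, f₁ β = (Λ β).q)
    (hf₂ : ∀ β, f₂ β = (Λ β).p) (h₁ : Function.Injective f₁) (h₂ : Function.Injective f₂) :
    ∃ (φ : A →* HNNExtension A f₁.range f₂.range
          ((MonoidHom.ofInjective h₁).symm.trans (MonoidHom.ofInjective h₂)))
      (t : HNNExtension A f₁.range f₂.range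
          ((MonoidHom.ofInjective h₁).symm.trans (MonoidHom.ofInjective h₂))), IsP Λ φ t := by
  have happ : ∀ β, ((((MonoidHom.ofInjective h₁).symm.trans (MonoidHom.ofInjective h₂))
      (⟨f₁ β, β, rfl⟩ : f₁.range) : f₂.range) : A) = f₂ β := by
    intro β
    have : (⟨f₁ β, β, rfl⟩ : f₁.range) = MonoidHom.ofInjective h₁ β := rfl
    rw [this]
    simp [MonoidHom.ofInjective_apply]
  refine ⟨HNNExtension.of, HNNExtension.t, ?_, ?_, ?_⟩
  · intro β
    rw [compat_false (hs β), ← hf₁, ← hf₂, ← happ β]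
    exact (HNNExtension.t_mul_of (⟨f₁ β, β, rfl⟩ : f₁.range)).symm
  · intro H _ φ' t' hc
    refine ⟨HNNExtension.lift φ' t' ?_, ?_, ?_⟩
    · rintro ⟨_, β, rfl⟩
      rw [happ]
      have := (compat_false (hs β)).1 (hc β)
      rw [← hf₁, ← hf₂] at this
      exact this.symm
    · ext x; simp
    · simp
  · intro H _ f g h ht
    exact HNNExtension.hom_ext h ht

/-! ### Combinatorics of alternating paths -/

/-- Potentials exist on oriented forests. -/
theorem exists_potential {X K : Type} [Finite X] [Group K] :
    ∀ (n : ℕ) (Q : SimpleGraph X) (_ : Q.IsAcyclic) (O : X → X → Prop) (c : X → X → K)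
      (_ : ∀ u v, O u v → Q.Adj u v) (_ : ∀ u v, O u v → ¬ O v u)
      (_ : Q.edgeSet.ncard ≤ n), ∃ h : X → K, ∀ u v, O u v → h u = c u v * h v := by
  classical
  intro n
  induction n with
  | zero =>
    intro Q _ O c hO _ hn
    have : Q.edgeSet = ∅ := by
      rw [← Set.ncard_eq_zero (Set.toFinite _)]; omega
    refine ⟨fun _ => 1, fun u v h => ?_⟩
    have := this ▸ (SimpleGraph.mem_edgeSet Q).2 (hO u v h)
    exact absurd this (Set.notMem_empty _)
  | succ n ih =>
    intro Q hQ O c hO hanti hn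
    by_cases hex : ∃ u v, O u v
    swap
    · exact ⟨fun _ => 1, fun u v h => absurd ⟨u, v, h⟩ hex⟩
    obtain ⟨u, v, huv⟩ := hex
    have hbr := SimpleGraph.isAcyclic_iff_forall_adj_isBridge.1 hQ (hO u v huv)
    rw [SimpleGraph.isBridge_iff] at hbr
    set Q' := Q.deleteEdges {s(u, v)} with hQ'
    obtain ⟨h', hh'⟩ := ih Q' (hQ.anti (SimpleGraph.deleteEdges_le _))
      (fun a b => O a b ∧ ¬ (a = u ∧ b = v)) c
      (by
        rintro a b ⟨hab, hne⟩
        rw [hQ', SimpleGraph.deleteEdges_adj]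
        refine ⟨hO a b hab, ?_⟩
        rw [Set.mem_singleton_iff, Sym2.eq_iff]
        rintro (h | ⟨rfl, rfl⟩)
        · exact hne h
        · exact hanti _ _ huv hab)
      (fun a b h h' => hanti a b h.1 h'.1)
      (by
        have hlt : Q'.edgeSet ⊂ Q.edgeSet := by
          rw [hQ', SimpleGraph.edgeSet_deleteEdges]
          refine ⟨Set.sdiff_subset, fun hsub => ?_⟩
          have := hsub ((SimpleGraph.mem_edgeSet Q).2 (hO u v huv))
          exact this.2 rfl
        have := Set.ncard_lt_ncard hlt (Set.toFinite _)
        omega)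
    refine ⟨fun w => if Q'.Reachable u w then h' w * ((h' u)⁻¹ * (c u v * h' v)) else h' w, ?_⟩
    intro a b hab
    by_cases he : a = u ∧ b = v
    · obtain ⟨rfl, rfl⟩ := he
      simp [hbr]
    · have h1 := hh' a b ⟨hab, he⟩
      have hadj : Q'.Adj a b := by
        rw [hQ', SimpleGraph.deleteEdges_adj]
        refine ⟨hO a b hab, ?_⟩
        rw [Set.mem_singleton_iff, Sym2.eq_iff]
        rintro (h | ⟨rfl, rfl⟩)
        · exact he h
        · exact hanti _ _ huv hab
      have : Q'.Reachable u a ↔ Q'.Reachable u b :=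
        ⟨fun h => h.trans hadj.reachable, fun h => h.trans hadj.symm.reachable⟩
      by_cases hr : Q'.Reachable u b
      · simp [this, hr, h1, mul_assoc]
      · simp [this, hr, h1]

section Comb

variable {V : Type} {Γ : SimpleGraph V} {D : V → V → Prop}

/-- A closed path of distinct vertices of length at least three has two consecutive
edges in the same direction. -/
theorem cycle_directed
    (hdir : ∀ (n : ℕ), 0 < n → ∀ c : ZMod n → V, Γ.IsCycleMap c → Function.Injective c →
      (∀ i, D (c i) (c (i + 1))) ∨ (∀ i, D (c (i + 1)) (c i)))
    (p : ℕ → V) (k : ℕ) (hk : 2 ≤ k) (hadj : ∀ i < k, Γ.Adj (p i) (p (i + 1)))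
    (hclose : Γ.Adj (p k) (p 0)) (hinj : ∀ i j, i < j → j ≤ k → p i ≠ p j) :
    (D (p 0) (p 1) ∧ D (p 1) (p 2)) ∨ (D (p 1) (p 0) ∧ D (p 2) (p 1)) := by
  have : NeZero (k + 1) := ⟨by omega⟩
  have : Fact (1 < k + 1) := ⟨by omega⟩
  let c : ZMod (k + 1) → V := fun i => p i.val
  have hval : ∀ i : ZMod (k + 1), i.val ≤ k := fun i => by have := ZMod.val_lt i; omega
  have hc : Function.Injective c := by
    intro i j hij
    apply ZMod.val_injective
    by_contra hne
    rcases Nat.lt_or_gt_of_ne hne with h | h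
    · exact hinj _ _ h (hval j) hij
    · exact hinj _ _ h (hval i) hij.symm
  have hsucc : ∀ i : ZMod (k + 1), (i + 1).val = if i.val = k then 0 else i.val + 1 := by
    intro i
    rw [ZMod.val_add, ZMod.val_one]
    have := hval i
    split_ifs with h
    · rw [h, Nat.mod_self]
    · exact Nat.mod_eq_of_lt (by omega)
  have v0 : (0 : ZMod (k + 1)).val = 0 := ZMod.val_zero
  have v1 : ((0 : ZMod (k + 1)) + 1).val = 1 := by
    rw [hsucc, v0, if_neg (by omega)]
  have v2 : ((0 : ZMod (k + 1)) + 1 + 1).val = 2 := by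
    rw [hsucc, v1, if_neg (by omega)]
  have hcyc : Γ.IsCycleMap c := by
    constructor
    · intro i
      change Γ.Adj (p i.val) (p (i + 1).val)
      rw [hsucc]
      have := hval i
      split_ifs with h
      · rw [h]; exact hclose
      · exact hadj _ (by omega)
    · intro i h
      have := hc h
      have h2 : (0 : ZMod (k + 1)) + 1 + 1 = 0 := by
        have h3 : i + 2 = i + 0 := by rw [this, add_zero]
        have := add_left_cancel h3
        rw [zero_add, one_add_one_eq_two]; exact this
      have := congrArg ZMod.val h2
      rw [v2, v0] at this
      omega
  rcases hdir (k + 1) (by omega) c hcyc hc with h | h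
  · left
    have a := h 0
    have b := h (0 + 1)
    simp only [c, v0, v1, v2] at a b
    exact ⟨a, b⟩
  · right
    have a := h 0
    have b := h (0 + 1)
    simp only [c, v0, v1, v2] at a b
    exact ⟨a, b⟩

/-- Alternating paths without backtracking are induced paths. -/
theorem alternating_path (hnb : ∀ a b, ¬ (D a b ∧ D b a))
    (hdir : ∀ (n : ℕ), 0 < n → ∀ c : ZMod n → V, Γ.IsCycleMap c → Function.Injective c →
      (∀ i, D (c i) (c (i + 1))) ∨ (∀ i, D (c (i + 1)) (c i)))
    (p : ℕ → V) (k : ℕ)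
    (hadj : ∀ i < k, Γ.Adj (p i) (p (i + 1)))
    (hnobt : ∀ i, i + 2 ≤ k → p (i + 2) ≠ p i)
    (halt : ∀ i, i + 2 ≤ k →
      (D (p i) (p (i + 1)) ∧ D (p (i + 2)) (p (i + 1))) ∨
      (D (p (i + 1)) (p i) ∧ D (p (i + 1)) (p (i + 2)))) :
    ∀ d i j, j = i + d → j ≤ k → 0 < d → p i ≠ p j ∧ (2 ≤ d → ¬ Γ.Adj (p j) (p i)) := by
  intro d
  induction d using Nat.strong_induction_on with
  | _ d ih =>
    intro i j hj hjk hd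
    have hne : p i ≠ p j := by
      intro heq
      rcases Nat.lt_or_ge d 3 with h3 | h3
      · have : d = 1 ∨ d = 2 := by omega
        rcases this with rfl | rfl
        · have := hadj i (by omega)
          rw [← hj, ← heq] at this
          exact Γ.loopless.irrefl _ this
        · exact hnobt i (by omega) (by rw [← hj, heq])
      · have h1 := (ih (d - 1) (by omega) i (j - 1) (by omega) (by omega) (by omega)).2 (by omega)
        have h2 := hadj (j - 1) (by omega)
        rw [show j - 1 + 1 = j by omega, ← heq] at h2
        exact h1 h2
    refine ⟨hne, fun h2 hclose => ?_⟩
    have := cycle_directed hdir (fun l => p (i + l)) d h2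
      (fun l hl => hadj (i + l) (by omega)) (by simpa [← hj] using hclose)
      (by
        intro a b hab hb
        by_cases hfull : b - a = d
        · have ha : a = 0 := by omega
          have hb' : b = d := by omega
          subst ha hb'
          simpa [← hj] using hne
        · exact (ih (b - a) (by omega) (i + a) (i + b) (by omega) (by omega) (by omega)).1)
    have h3 := halt i (by omega)
    simp only [Nat.add_zero] at this
    rcases this with ⟨a1, a2⟩ | ⟨a1, a2⟩ <;> rcases h3 with ⟨b1, b2⟩ | ⟨b1, b2⟩
    · exact hnb _ _ ⟨a2, b2⟩
    · exact hnb _ _ ⟨a1, b1⟩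
    · exact hnb _ _ ⟨a1, b1⟩
    · exact hnb _ _ ⟨a2, b2⟩

/-- The bipartite graph with edges `(a,+) — (b,-)` for each oriented edge `a → b`. -/
def altGraph (D : V → V → Prop) : SimpleGraph (V × Bool) where
  Adj u v := (u.2 = true ∧ v.2 = false ∧ D u.1 v.1) ∨ (v.2 = true ∧ u.2 = false ∧ D v.1 u.1)
  symm := ⟨fun _ _ h => h.symm⟩
  loopless := ⟨fun u h => by rcases h with ⟨h1, h2, _⟩ | ⟨h1, h2, _⟩ <;> simp [h1] at h2⟩

theorem altGraph_snd {u v : V × Bool} (h : (altGraph D).Adj u v) : v.2 = !u.2 := by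
  rcases h with ⟨h1, h2, _⟩ | ⟨h1, h2, _⟩ <;> simp [h1, h2]

/-- Walks in the alternating graph without backtracking give alternating paths. -/
theorem altGraph_walk (hadjD : ∀ a b, D a b → Γ.Adj a b) (hnb : ∀ a b, ¬ (D a b ∧ D b a))
    (hdir : ∀ (n : ℕ), 0 < n → ∀ c : ZMod n → V, Γ.IsCycleMap c → Function.Injective c →
      (∀ i, D (c i) (c (i + 1))) ∨ (∀ i, D (c (i + 1)) (c i)))
    {u v : V × Bool} (w : (altGraph D).Walk u v)
    (hnobt : ∀ i, i + 2 ≤ w.length → w.getVert (i + 2) ≠ w.getVert i) (hpos : 0 < w.length) :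
    u.1 ≠ v.1 ∧ (2 ≤ w.length → ¬ Γ.Adj v.1 u.1) := by
  have h := alternating_path hnb hdir (fun i => (w.getVert i).1) w.length
    (by
      intro i hi
      rcases w.adj_getVert_succ hi with ⟨_, _, h⟩ | ⟨_, _, h⟩
      · exact hadjD _ _ h
      · exact (hadjD _ _ h).symm)
    (by
      intro i hi heq
      apply hnobt i hi
      have h1 := altGraph_snd (w.adj_getVert_succ (i := i) (by omega))
      have h2 := altGraph_snd (w.adj_getVert_succ (i := i + 1) (by omega))
      rw [h1, Bool.not_not] at h2
      exact Prod.ext heq h2)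
    (by
      intro i hi
      have h1 := w.adj_getVert_succ (i := i) (by omega)
      have h2 := w.adj_getVert_succ (i := i + 1) (by omega)
      rcases h1 with ⟨a1, a2, a3⟩ | ⟨a1, a2, a3⟩ <;> rcases h2 with ⟨b1, b2, b3⟩ | ⟨b1, b2, b3⟩
      · simp [a2] at b1
      · exact Or.inl ⟨a3, b3⟩
      · exact Or.inr ⟨a3, b3⟩
      · simp [a1] at b2)
    w.length 0 w.length (by omega) le_rfl hpos
  simpa using h

theorem altGraph_acyclic (hadjD : ∀ a b, D a b → Γ.Adj a b) (hnb : ∀ a b, ¬ (D a b ∧ D b a))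
    (hdir : ∀ (n : ℕ), 0 < n → ∀ c : ZMod n → V, Γ.IsCycleMap c → Function.Injective c →
      (∀ i, D (c i) (c (i + 1))) ∨ (∀ i, D (c (i + 1)) (c i))) :
    (altGraph D).IsAcyclic := by
  intro u w hw
  have h3 := hw.three_le_length
  refine (altGraph_walk hadjD hnb hdir w ?_ (by omega)).1 rfl
  intro i hi heq
  by_cases h0 : i = 0
  · subst h0
    have := hw.getVert_injOn' (x₁ := 0 + 2) (x₂ := 0) (by simp; omega) (by simp) heq
    omega
  · have := hw.getVert_injOn (x₁ := i + 2) (x₂ := i) (by simp; omega) (by simp; omega) heq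
    omega

theorem altGraph_path (hadjD : ∀ a b, D a b → Γ.Adj a b) (hnb : ∀ a b, ¬ (D a b ∧ D b a))
    (hdir : ∀ (n : ℕ), 0 < n → ∀ c : ZMod n → V, Γ.IsCycleMap c → Function.Injective c →
      (∀ i, D (c i) (c (i + 1))) ∨ (∀ i, D (c (i + 1)) (c i)))
    {u v : V × Bool} (hr : (altGraph D).Reachable u v) (hne : u ≠ v) :
    u.1 ≠ v.1 ∧ ((altGraph D).Adj u v ∨ ¬ Γ.Adj v.1 u.1) := by
  obtain ⟨w, hw⟩ := hr.exists_isPath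
  have hpos : 0 < w.length := by
    rcases Nat.eq_zero_or_pos w.length with h | h
    · exact absurd (SimpleGraph.Walk.eq_of_length_eq_zero h) hne
    · exact h
  have h := altGraph_walk hadjD hnb hdir w (by
    intro i hi heq
    have := hw.getVert_injOn (x₁ := i + 2) (x₂ := i) (by simp; omega) (by simp; omega) heq
    omega) hpos
  refine ⟨h.1, ?_⟩
  by_cases h2 : 2 ≤ w.length
  · exact Or.inr (h.2 h2)
  · left
    exact SimpleGraph.Walk.adj_of_length_eq_one (p := w) (by omega)

theorem altGraph_ne_self (hadjD : ∀ a b, D a b → Γ.Adj a b) (hnb : ∀ a b, ¬ (D a b ∧ D b a))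
    (hdir : ∀ (n : ℕ), 0 < n → ∀ c : ZMod n → V, Γ.IsCycleMap c → Function.Injective c →
      (∀ i, D (c i) (c (i + 1))) ∨ (∀ i, D (c (i + 1)) (c i))) (a : V) :
    ¬ (altGraph D).Reachable (a, true) (a, false) := fun h =>
  (altGraph_path hadjD hnb hdir h (by simp)).1 rfl

theorem altGraph_ne_edge (hadjD : ∀ a b, D a b → Γ.Adj a b) (hnb : ∀ a b, ¬ (D a b ∧ D b a))
    (hdir : ∀ (n : ℕ), 0 < n → ∀ c : ZMod n → V, Γ.IsCycleMap c → Function.Injective c →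
      (∀ i, D (c i) (c (i + 1))) ∨ (∀ i, D (c (i + 1)) (c i))) (a b : V) (hab : D a b) :
    ¬ (altGraph D).Reachable (a, false) (b, true) := by
  intro h
  rcases (altGraph_path hadjD hnb hdir h (by simp)).2 with h1 | h1
  · rcases h1 with ⟨h1, _⟩ | ⟨_, _, h1⟩
    · simp at h1
    · exact hnb _ _ ⟨hab, h1⟩
  · exact h1 (hadjD _ _ hab).symm

end Comb

/-! ### Permutations realizing the labelled graph -/

/-- The permutation of `Fin M × B` cyclically shifting the first coordinate, with a twist. -/
theorem exists_cyclic_perm {Z B : Type} [Group B] (M : ℕ) (hM : 0 < M) (ι : ℕ → B → Z)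
    (hι : ∀ i j g g', i < M → j < M → ι i g = ι j g' → i = j ∧ g = g') (c : B) :
    ∃ x : Equiv.Perm Z, (∀ i, i + 1 < M → ∀ g, x (ι i g) = ι (i + 1) g) ∧
      (∀ g, x (ι (M - 1) g) = ι 0 (c * g)) ∧
      (∀ z, (∀ i g, i < M → ι i g ≠ z) → x z = z) := by
  let f : Fin M × B ↪ Z := ⟨fun y => ι y.1.1 y.2, by
    rintro ⟨i, g⟩ ⟨j, g'⟩ h
    obtain ⟨h1, h2⟩ := hι _ _ _ _ i.2 j.2 h
    exact Prod.ext (Fin.ext h1) h2⟩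
  let e : Equiv.Perm (Fin M × B) :=
    { toFun := fun y => if h : y.1.1 + 1 < M then (⟨y.1.1 + 1, h⟩, y.2) else (⟨0, hM⟩, c * y.2)
      invFun := fun y => if h : y.1.1 = 0 then (⟨M - 1, by omega⟩, c⁻¹ * y.2)
        else (⟨y.1.1 - 1, by have := y.1.2; omega⟩, y.2)
      left_inv := by
        rintro ⟨⟨i, hi⟩, g⟩
        by_cases h : i + 1 < M
        · simp [h]
        · simp [h]
          omega
      right_inv := by
        rintro ⟨⟨i, hi⟩, g⟩
        by_cases h : i = 0
        · have h' : ¬ (M - 1 + 1 < M) := by omega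
          simp [h, h']
        · have h' : i - 1 + 1 = i := by omega
          simp [h, h', hi] }
  refine ⟨e.viaEmbedding f, ?_, ?_, ?_⟩
  · intro i hi g
    have h1 : ι i g = f (⟨i, by omega⟩, g) := rfl
    rw [h1, Equiv.Perm.viaEmbedding_apply]
    simp [e, hi]
    rfl
  · intro g
    have h1 : ι (M - 1) g = f (⟨M - 1, by omega⟩, g) := rfl
    rw [h1, Equiv.Perm.viaEmbedding_apply]
    have h' : ¬ (M - 1 + 1 < M) := by omega
    simp [e, h']
    rfl
  · intro z hz
    apply Equiv.Perm.viaEmbedding_apply_of_notMem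
    rintro ⟨⟨i, g⟩, h⟩
    exact hz i.1 g i.2 h

theorem cyclic_pow {Z B : Type} (M : ℕ) (ι : ℕ → B → Z) (x : Equiv.Perm Z)
    (hx : ∀ i, i + 1 < M → ∀ g, x (ι i g) = ι (i + 1) g) (k : ℕ) :
    ∀ i, i + k < M → ∀ g, (x ^ k) (ι i g) = ι (i + k) g := by
  induction k with
  | zero => intro i _ g; simp
  | succ k ih =>
    intro i hi g
    rw [pow_succ', Equiv.Perm.mul_apply, ih i (by omega), hx _ (by omega)]
    rfl

theorem exists_perm_odd {Y B : Type} [Group B] (m : ℕ) (hm : 1 ≤ m) (e1 e2 : B)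
    (ap am bp : B → Y) (hap : Function.Injective ap) (ham : Function.Injective am)
    (hbp : Function.Injective bp) (h1 : ∀ g g', ap g ≠ am g') (h2 : ∀ g g', ap g ≠ bp g')
    (h3 : ∀ g g', am g ≠ bp g') :
    ∃ x : Equiv.Perm (Y ⊕ (Bool × ℕ × B)),
      (∀ g, x (Sum.inl (bp g)) = Sum.inl (am (e1 * g))) ∧
      (∀ g, (x ^ m) (Sum.inl (ap (e2 * g))) = Sum.inl (bp g)) ∧
      (∀ g, (x ^ m) (Sum.inl (am (e2 * g))) = Sum.inl (ap (e1 * g))) := by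
  let ι : ℕ → B → Y ⊕ (Bool × ℕ × B) := fun i g =>
    if i = 0 then Sum.inl (ap g) else if i = m then Sum.inl (bp (e2⁻¹ * g))
    else if i = m + 1 then Sum.inl (am (e1 * (e2⁻¹ * g))) else Sum.inr (false, i, g)
  have i0 : ∀ g, ι 0 g = Sum.inl (ap g) := fun g => by simp [ι]
  have im : ∀ g, ι m g = Sum.inl (bp (e2⁻¹ * g)) := fun g => by
    simp [ι]; omega
  have im1 : ∀ g, ι (m + 1) g = Sum.inl (am (e1 * (e2⁻¹ * g))) := fun g => by simp [ι]
  have hι : ∀ i j g g', i < 2 * m + 1 → j < 2 * m + 1 → ι i g = ι j g' → i = j ∧ g = g' := by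
    intro i j g g' _ _ h
    simp only [ι] at h
    split_ifs at h <;>
      simp only [Sum.inl.injEq, Sum.inr.injEq, Prod.mk.injEq, reduceCtorEq, true_and] at h <;>
      first
      | exact absurd h (h1 _ _)
      | exact absurd h (h2 _ _)
      | exact absurd h (h3 _ _)
      | exact absurd h.symm (h1 _ _)
      | exact absurd h.symm (h2 _ _)
      | exact absurd h.symm (h3 _ _)
      | exact ⟨by omega, hap h⟩
      | exact ⟨by omega, mul_left_cancel (hbp h)⟩
      | exact ⟨by omega, mul_left_cancel (mul_left_cancel (ham h))⟩
      | exact h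
  obtain ⟨x, hx1, hx2, -⟩ := exists_cyclic_perm (2 * m + 1) (by omega) ι hι
    (e1 * (e2⁻¹ * (e1 * e2⁻¹)))
  have hp := cyclic_pow (2 * m + 1) ι x hx1
  refine ⟨x, ?_, ?_, ?_⟩
  · intro g
    have := hx1 m (by omega) (e2 * g)
    rw [im, im1] at this
    simpa using this
  · intro g
    rw [← i0, hp m 0 (by omega), zero_add, im]
    simp
  · intro g
    have a1 := im1 (e2 * (e1⁻¹ * (e2 * g)))
    simp only [inv_mul_cancel_left, mul_inv_cancel_left] at a1
    obtain ⟨k, rfl⟩ : ∃ k, m = k + 1 := ⟨m - 1, by omega⟩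
    rw [← a1, pow_succ', Equiv.Perm.mul_apply, hp k (k + 1 + 1) (by omega),
      show k + 1 + 1 + k = 2 * (k + 1) + 1 - 1 by omega, hx2, i0]
    congr 2
    group

theorem exists_perm_even {Y B : Type} [Group B] (m : ℕ) (hm : 2 ≤ m) (e1 e2 : B)
    (ap am bp : B → Y) (hap : Function.Injective ap) (ham : Function.Injective am)
    (hbp : Function.Injective bp) (h1 : ∀ g g', ap g ≠ am g') (h2 : ∀ g g', ap g ≠ bp g')
    (h3 : ∀ g g', am g ≠ bp g') :
    ∃ x : Equiv.Perm (Y ⊕ (Bool × ℕ × B)),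
      (∀ g, x (Sum.inl (bp g)) = Sum.inl (am (e1 * g))) ∧
      (∀ g, (x ^ m) (Sum.inl (ap g)) = Sum.inl (ap (e2 * g))) ∧
      (∀ g, (x ^ m) (Sum.inl (am g)) = Sum.inl (am (e2 * g))) := by
  let ι : ℕ → B → Y ⊕ (Bool × ℕ × B) := fun i g =>
    if i = 0 then Sum.inl (ap g) else Sum.inr (false, i, g)
  let κ : ℕ → B → Y ⊕ (Bool × ℕ × B) := fun i g =>
    if i = 0 then Sum.inl (bp g) else if i = 1 then Sum.inl (am (e1 * g))
    else Sum.inr (true, i, g)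
  have i0 : ∀ g, ι 0 g = Sum.inl (ap g) := fun g => by simp [ι]
  have k0 : ∀ g, κ 0 g = Sum.inl (bp g) := fun g => by simp [κ]
  have k1 : ∀ g, κ 1 g = Sum.inl (am (e1 * g)) := fun g => by simp [κ]
  have hι : ∀ i j g g', i < m → j < m → ι i g = ι j g' → i = j ∧ g = g' := by
    intro i j g g' _ _ h
    simp only [ι] at h
    split_ifs at h <;>
      simp only [Sum.inl.injEq, Sum.inr.injEq, Prod.mk.injEq, reduceCtorEq, true_and] at h <;>
      first
      | exact ⟨by omega, hap h⟩
      | exact h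
  have hκ : ∀ i j g g', i < m → j < m → κ i g = κ j g' → i = j ∧ g = g' := by
    intro i j g g' _ _ h
    simp only [κ] at h
    split_ifs at h <;>
      simp only [Sum.inl.injEq, Sum.inr.injEq, Prod.mk.injEq, reduceCtorEq, true_and] at h <;>
      first
      | exact absurd h (h3 _ _)
      | exact absurd h.symm (h3 _ _)
      | exact ⟨by omega, hbp h⟩
      | exact ⟨by omega, mul_left_cancel (ham h)⟩
      | exact h
  have hικ : ∀ i j g g', ι i g ≠ κ j g' := by
    intro i j g g' h
    simp only [ι, κ] at h
    split_ifs at h <;>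
      simp only [Sum.inl.injEq, Sum.inr.injEq, Prod.mk.injEq, reduceCtorEq, false_and] at h <;>
      first
      | exact h1 _ _ h
      | exact h2 _ _ h
  obtain ⟨x, hx1, hx2, hx3⟩ := exists_cyclic_perm m (by omega) ι hι e2
  obtain ⟨y, hy1, hy2, hy3⟩ := exists_cyclic_perm m (by omega) κ hκ (e1⁻¹ * (e2 * e1))
  have yι : ∀ i g, y (ι i g) = ι i g := fun i g => hy3 _ (fun j g' _ => (hικ i j g g').symm)
  have xκ : ∀ i g, x (κ i g) = κ i g := fun i g => hx3 _ (fun j g' _ => hικ j i g' g)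
  have X1 : ∀ i, i + 1 < m → ∀ g, (x * y) (ι i g) = ι (i + 1) g := fun i hi g => by
    rw [Equiv.Perm.mul_apply, yι, hx1 i hi]
  have X2 : ∀ g, (x * y) (ι (m - 1) g) = ι 0 (e2 * g) := fun g => by
    rw [Equiv.Perm.mul_apply, yι, hx2]
  have Y1 : ∀ i, i + 1 < m → ∀ g, (x * y) (κ i g) = κ (i + 1) g := fun i hi g => by
    rw [Equiv.Perm.mul_apply, hy1 i hi, xκ]
  have Y2 : ∀ g, (x * y) (κ (m - 1) g) = κ 0 (e1⁻¹ * (e2 * e1) * g) := fun g => by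
    rw [Equiv.Perm.mul_apply, hy2, xκ]
  refine ⟨x * y, ?_, ?_, ?_⟩
  · intro g
    rw [← k0, Y1 0 (by omega), zero_add, k1]
  · intro g
    obtain ⟨k, rfl⟩ : ∃ k, m = k + 1 := ⟨m - 1, by omega⟩
    rw [← i0, pow_succ', Equiv.Perm.mul_apply, cyclic_pow _ ι _ X1 k 0 (by omega),
      show 0 + k = k + 1 - 1 by omega, X2, i0]
  · intro g
    obtain ⟨k, rfl⟩ : ∃ k, m = k + 2 := ⟨m - 2, by omega⟩
    have a1 := k1 (e1⁻¹ * g)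
    rw [mul_inv_cancel_left] at a1
    have hpw : ∀ w, ((x * y) ^ (k + 2)) w = (x * y) ((x * y) (((x * y) ^ k) w)) := fun w => by
      rw [pow_succ', pow_succ']; rfl
    rw [← a1, hpw, cyclic_pow _ κ _ Y1 k 1 (by omega),
      show 1 + k = k + 2 - 1 by omega, Y2, Y1 0 (by omega), zero_add, k1]
    congr 2
    group

theorem exists_action {V B : Type} [Finite V] [Group B] {Γ : SimpleGraph V} {D : V → V → Prop}
    (M : V → V → ℕ) (h3 : ∀ a b, Γ.Adj a b → 3 ≤ M a b)
    (hadjD : ∀ a b, D a b → Γ.Adj a b) (hnb : ∀ a b, ¬ (D a b ∧ D b a))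
    (hdir : ∀ (n : ℕ), 0 < n → ∀ c : ZMod n → V, Γ.IsCycleMap c → Function.Injective c →
      (∀ i, D (c i) (c (i + 1))) ∨ (∀ i, D (c (i + 1)) (c i)))
    (g1 g2 : V → V → B) :
    ∃ (Z : Type) (cl : V → Bool → B → Z) (X : V → V → Equiv.Perm Z),
      (∀ a s, Function.Injective (cl a s)) ∧ ∀ a b, D a b →
      (∀ g, X a b (cl b true g) = cl a false (g1 a b * g)) ∧
      (∀ g, cl b false g = cl a true (g1 a b * g)) ∧
      (M a b % 2 = 1 → ∀ s g, (X a b ^ (M a b / 2)) (cl a s (g2 a b * g)) = cl b s g) ∧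
      (M a b % 2 = 0 → ∀ s g, (X a b ^ (M a b / 2)) (cl a s g) = cl a s (g2 a b * g)) := by
  classical
  obtain ⟨h, hh⟩ := exists_potential (K := B) _ (altGraph D) (altGraph_acyclic hadjD hnb hdir)
    (fun u v => u.2 = true ∧ v.2 = false ∧ D u.1 v.1) (fun u v => g1 u.1 v.1)
    (fun u v h => Or.inl h) (fun u v h h' => by simp [h.1] at h') le_rfl
  let cl' : V → Bool → B → (altGraph D).ConnectedComponent × B := fun a s g =>
    ((altGraph D).connectedComponentMk (a, s), (h (a, s))⁻¹ * g)
  have hinj : ∀ a s, Function.Injective (cl' a s) := by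
    intro a s g g' hg
    exact mul_left_cancel (Prod.ext_iff.1 hg).2
  have hsame : ∀ a b, D a b → ∀ g, cl' b false g = cl' a true (g1 a b * g) := by
    intro a b hab g
    refine Prod.ext ?_ ?_
    · refine SimpleGraph.ConnectedComponent.sound (SimpleGraph.Adj.reachable ?_)
      exact Or.inr ⟨rfl, rfl, hab⟩
    · have := hh (a, true) (b, false) ⟨rfl, rfl, hab⟩
      simp only [cl', this]
      group
  have hne : ∀ a b s s', ¬ (altGraph D).Reachable (a, s) (b, s') →
      ∀ g g', cl' a s g ≠ cl' b s' g' := by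
    intro a b s s' hr g g' heq
    exact hr (SimpleGraph.ConnectedComponent.exact (Prod.ext_iff.1 heq).1)
  have hex : ∀ a b, ∃ x : Equiv.Perm (((altGraph D).ConnectedComponent × B) ⊕ (Bool × ℕ × B)),
      D a b →
      (∀ g, x (Sum.inl (cl' b true g)) = Sum.inl (cl' a false (g1 a b * g))) ∧
      (M a b % 2 = 1 → ∀ s g, (x ^ (M a b / 2)) (Sum.inl (cl' a s (g2 a b * g))) =
        Sum.inl (cl' b s g)) ∧
      (M a b % 2 = 0 → ∀ s g, (x ^ (M a b / 2)) (Sum.inl (cl' a s g)) =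
        Sum.inl (cl' a s (g2 a b * g))) := by
    intro a b
    by_cases hab : D a b
    swap
    · exact ⟨1, fun h => absurd h hab⟩
    have d1 : ∀ g g', cl' a true g ≠ cl' a false g' :=
      hne _ _ _ _ (altGraph_ne_self hadjD hnb hdir a)
    have d2 : ∀ g g', cl' a true g ≠ cl' b true g' := by
      apply hne
      intro hr
      apply altGraph_ne_self hadjD hnb hdir b
      refine hr.symm.trans (SimpleGraph.Adj.reachable ?_)
      exact Or.inl ⟨rfl, rfl, hab⟩
    have d3 : ∀ g g', cl' a false g ≠ cl' b true g' :=
      hne _ _ _ _ (altGraph_ne_edge hadjD hnb hdir a b hab)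
    have hM := h3 a b (hadjD a b hab)
    rcases Nat.mod_two_eq_zero_or_one (M a b) with hpar | hpar
    · obtain ⟨x, x1, x2, x3⟩ := exists_perm_even (M a b / 2) (by omega) (g1 a b) (g2 a b)
        (cl' a true) (cl' a false) (cl' b true) (hinj _ _) (hinj _ _) (hinj _ _) d1 d2 d3
      refine ⟨x, fun _ => ⟨x1, fun h => by omega, fun _ s g => ?_⟩⟩
      cases s
      · exact x3 g
      · exact x2 g
    · obtain ⟨x, x1, x2, x3⟩ := exists_perm_odd (M a b / 2) (by omega) (g1 a b) (g2 a b)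
        (cl' a true) (cl' a false) (cl' b true) (hinj _ _) (hinj _ _) (hinj _ _) d1 d2 d3
      refine ⟨x, fun _ => ⟨x1, fun _ s g => ?_, fun h => by omega⟩⟩
      cases s
      · rw [hsame a b hab]; exact x3 g
      · exact x2 g
  choose X hX using hex
  refine ⟨_, fun a s g => Sum.inl (cl' a s g), X, ?_, ?_⟩
  · intro a s
    exact Sum.inl_injective.comp (hinj a s)
  · intro a b hab
    exact ⟨(hX a b hab).1, fun g => congrArg Sum.inl (hsame a b hab g),
      (hX a b hab).2.1, (hX a b hab).2.2⟩

/-! ### The labelled graph and its fundamental group -/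

section Setup

variable {V : Type}

/-- The action of the wreath product on pairs. -/
def wact {A Z : Type} [Group A] (f : A →* Equiv.Perm Z) (w : Wr A) (y : Z × Z) : Z × Z :=
  (f w.p (if w.s then y.2 else y.1), f w.q (if w.s then y.1 else y.2))

theorem wact_mul {A Z : Type} [Group A] (f : A →* Equiv.Perm Z) (w w' : Wr A) (y : Z × Z) :
    wact f (w * w') y = wact f w (wact f w' y) := by
  rcases w with ⟨a, b, s⟩
  rcases w' with ⟨c, d, t⟩
  cases s <;> cases t <;> simp [wact, mul_p, mul_q, mul_s]

theorem wact_one {A Z : Type} [Group A] (f : A →* Equiv.Perm Z) (y : Z × Z) :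
    wact f 1 y = y := by
  simp [wact, one_p, one_q, one_s]

/-- The oriented edges. -/
abbrev OEdge (D : V → V → Prop) : Type := {p : V × V // D p.1 p.2}

/-- The oriented edges outside the tree. -/
abbrev NEdge (D : V → V → Prop) (T : SimpleGraph V) : Type :=
  {p : V × V // D p.1 p.2 ∧ ¬ T.Adj p.1 p.2}

open Classical in
/-- The generator of the free group attached to an oriented edge. -/
noncomputable def xg (D : V → V → Prop) (a b : V) : FreeGroup (OEdge D) :=
  if h : D a b then FreeGroup.of ⟨(a, b), h⟩ else 1

/-- First label. -/
noncomputable def lab1 (D : V → V → Prop) (a b : V) : Wr (FreeGroup (OEdge D)) :=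
  ⟨xg D a b, 1, true⟩

/-- Second label. -/
noncomputable def lab2 (D : V → V → Prop) (M : V → V → ℕ) (a b : V) :
    Wr (FreeGroup (OEdge D)) :=
  if M a b % 2 = 1 then ⟨(xg D a b ^ (M a b / 2))⁻¹, (xg D a b ^ (M a b / 2))⁻¹, false⟩
  else ⟨xg D a b ^ (M a b / 2), xg D a b ^ (M a b / 2), false⟩

/-- Endpoint of the second labelled edge. -/
def tgt (M : V → V → ℕ) (a b : V) : V := if M a b % 2 = 1 then b else a

open Classical in
/-- Element for the first edge. -/
noncomputable def gg1 (D : V → V → Prop) (T : SimpleGraph V) (a b : V) :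
    FreeGroup (NEdge D T ⊕ OEdge D) :=
  if h : D a b ∧ ¬ T.Adj a b then FreeGroup.of (Sum.inl ⟨(a, b), h⟩) else 1

open Classical in
/-- Element for the second edge. -/
noncomputable def gg2 (D : V → V → Prop) (T : SimpleGraph V) (a b : V) :
    FreeGroup (NEdge D T ⊕ OEdge D) :=
  if h : D a b then FreeGroup.of (Sum.inr ⟨(a, b), h⟩) else 1

/-- The labelling homomorphism. -/
noncomputable def lamB (D : V → V → Prop) (T : SimpleGraph V) (M : V → V → ℕ)
    (h : V → Wr (FreeGroup (OEdge D))) :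
    FreeGroup (NEdge D T ⊕ OEdge D) →* Wr (FreeGroup (OEdge D)) :=
  FreeGroup.lift (Sum.elim
    (fun e => (h e.1.1)⁻¹ * lab1 D e.1.1 e.1.2 * h e.1.2)
    (fun e => (h e.1.1)⁻¹ * lab2 D M e.1.1 e.1.2 * h (tgt M e.1.1 e.1.2)))

variable {D : V → V → Prop} {T : SimpleGraph V} {M : V → V → ℕ}
  {h : V → Wr (FreeGroup (OEdge D))}

theorem lamB_gg1 (hh : ∀ a b, T.Adj a b ∧ D a b → h a = lab1 D a b * h b) {a b : V}
    (hab : D a b) : lamB D T M h (gg1 D T a b) = (h a)⁻¹ * lab1 D a b * h b := by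
  by_cases ht : T.Adj a b
  · have : gg1 D T a b = 1 := by simp [gg1, ht]
    rw [this, map_one, hh a b ⟨ht, hab⟩]; group
  · have : gg1 D T a b = FreeGroup.of (Sum.inl ⟨(a, b), ⟨hab, ht⟩⟩) := by simp [gg1, ht, hab]
    rw [this, lamB, FreeGroup.lift_apply_of]; rfl

theorem lamB_gg2 {a b : V} (hab : D a b) :
    lamB D T M h (gg2 D T a b) = (h a)⁻¹ * lab2 D M a b * h (tgt M a b) := by
  have : gg2 D T a b = FreeGroup.of (Sum.inr ⟨(a, b), hab⟩) := by simp [gg2, hab]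
  rw [this, lamB, FreeGroup.lift_apply_of]; rfl

theorem gg_induction {P : FreeGroup (NEdge D T ⊕ OEdge D) → Prop} (h1 : P 1)
    (hm : ∀ x y, P x → P y → P (x * y)) (hi : ∀ x, P x → P x⁻¹)
    (hg1 : ∀ a b, D a b → P (gg1 D T a b)) (hg2 : ∀ a b, D a b → P (gg2 D T a b)) :
    ∀ β, P β := by
  have hof : ∀ e, P (FreeGroup.of e) := by
    rintro (⟨⟨a, b⟩, hab⟩ | ⟨⟨a, b⟩, hab⟩)
    · have := hg1 a b hab.1
      rw [gg1, dif_pos hab] at this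
      exact this
    · have := hg2 a b hab
      rw [gg2, dif_pos hab] at this
      exact this
  intro β
  induction β using FreeGroup.induction_on with
  | C1 => exact h1
  | of x => exact hof x
  | inv_of x _ => exact hi _ (hof x)
  | mul x y hx hy => exact hm _ _ hx hy

theorem tree_const {Y : Type} (hT : T.Connected) (hTD : ∀ a b, T.Adj a b → D a b ∨ D b a)
    (F : V → Y) (hF : ∀ a b, T.Adj a b → D a b → F a = F b) (a b : V) : F a = F b := by
  obtain ⟨w⟩ := hT.preconnected a b
  induction w with
  | nil => rfl
  | cons hadj _ ih =>
    rw [← ih]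
    rcases hTD _ _ hadj with hd | hd
    · exact hF _ _ hadj hd
    · exact (hF _ _ hadj.symm hd).symm

theorem lamB_inj [Finite V] {Γ : SimpleGraph V} (h3 : ∀ a b, Γ.Adj a b → 3 ≤ M a b)
    (hadjD : ∀ a b, D a b → Γ.Adj a b) (hnb : ∀ a b, ¬ (D a b ∧ D b a))
    (hdir : ∀ (n : ℕ), 0 < n → ∀ c : ZMod n → V, Γ.IsCycleMap c → Function.Injective c →
      (∀ i, D (c i) (c (i + 1))) ∨ (∀ i, D (c (i + 1)) (c i)))
    (hT : T.Connected) (hTD : ∀ a b, T.Adj a b → D a b ∨ D b a)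
    (hh : ∀ a b, T.Adj a b ∧ D a b → h a = lab1 D a b * h b)
    (β : FreeGroup (NEdge D T ⊕ OEdge D)) (hs : (lamB D T M h β).s = false)
    (hpq : (lamB D T M h β).p = 1 ∨ (lamB D T M h β).q = 1) : β = 1 := by
  obtain ⟨Z, cl, X, hcl, hX⟩ := exists_action M h3 hadjD hnb hdir (gg1 D T) (gg2 D T)
  let f : FreeGroup (OEdge D) →* Equiv.Perm Z := FreeGroup.lift fun e => X e.1.1 e.1.2
  have hf : ∀ a b, D a b → f (xg D a b) = X a b := by
    intro a b hab
    simp [f, xg, hab]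
  let Cl : V → FreeGroup (NEdge D T ⊕ OEdge D) → Z × Z := fun a g => (cl a false g, cl a true g)
  have hL1 : ∀ a b, D a b → ∀ g, wact f (lab1 D a b) (Cl b g) = Cl a (gg1 D T a b * g) := by
    intro a b hab g
    obtain ⟨e1, e2, -, -⟩ := hX a b hab
    simp [wact, lab1, Cl, hf a b hab, e1, e2]
  have hL2 : ∀ a b, D a b → ∀ g,
      wact f (lab2 D M a b) (Cl (tgt M a b) g) = Cl a (gg2 D T a b * g) := by
    intro a b hab g
    obtain ⟨-, -, e3, e4⟩ := hX a b hab
    rcases Nat.mod_two_eq_zero_or_one (M a b) with hpar | hpar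
    · simp only [wact, lab2, tgt, hpar, Cl]
      simp [hf a b hab, e4 hpar]
    · simp only [wact, lab2, tgt, hpar, Cl]
      simp only [if_true, map_inv, map_pow, hf a b hab]
      simp [← e3 hpar]
  let Y : V → FreeGroup (NEdge D T ⊕ OEdge D) → Z × Z := fun a g => wact f (h a)⁻¹ (Cl a g)
  have hY : ∀ a b, Y a = Y b := by
    apply tree_const hT hTD
    intro a b hadj hab
    funext g
    have e1 := hL1 a b hab g
    have : gg1 D T a b = 1 := by simp [gg1, hadj]
    rw [this, one_mul] at e1
    simp only [Y]
    rw [← e1, ← wact_mul, hh a b ⟨hadj, hab⟩]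
    congr 1
    group
  obtain ⟨r⟩ := hT.nonempty
  have key : ∀ β g, wact f (lamB D T M h β) (Y r g) = Y r (β * g) := by
    apply gg_induction
    · intro g; rw [map_one, wact_one, one_mul]
    · intro x y hx hy g
      rw [map_mul, wact_mul, hy, hx, mul_assoc]
    · intro x hx g
      have := hx (x⁻¹ * g)
      rw [mul_inv_cancel_left] at this
      rw [← this, ← wact_mul, ← map_mul, inv_mul_cancel, map_one, wact_one]
    · intro a b hab g
      rw [lamB_gg1 hh hab, hY r b, wact_mul, hY b a]
      rw [hY a b]
      simp only [Y]
      rw [← wact_mul, ← wact_mul, mul_inv_cancel_right, wact_mul, hL1 a b hab]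
      exact congrFun (hY a b) _
    · intro a b hab g
      rw [lamB_gg2 hab, hY r (tgt M a b)]
      simp only [Y]
      rw [← wact_mul, mul_inv_cancel_right, wact_mul, hL2 a b hab]
      exact congrFun (hY a _) _
  have h1 := key β 1
  rw [mul_one] at h1
  have hfst : ∀ g g', (Y r g).1 = (Y r g').1 → g = g' := by
    intro g g' heq
    simp only [Y, wact, Cl] at heq
    have := (f (h r)⁻¹.p).injective heq
    split_ifs at this
    · exact hcl _ _ this
    · exact hcl _ _ this
  have hsnd : ∀ g g', (Y r g).2 = (Y r g').2 → g = g' := by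
    intro g g' heq
    simp only [Y, wact, Cl] at heq
    have := (f (h r)⁻¹.q).injective heq
    split_ifs at this
    · exact hcl _ _ this
    · exact hcl _ _ this
  rcases hpq with hp | hq
  · have := congrArg Prod.fst h1
    simp only [wact, hs, hp, map_one, Equiv.Perm.one_apply] at this
    exact (hfst _ _ this).symm
  · have := congrArg Prod.snd h1
    simp only [wact, hs, hq, map_one, Equiv.Perm.one_apply] at this
    exact (hsnd _ _ this).symm

/-! ### The Artin group has the universal property -/

theorem lift_altWord_even {H : Type} [Group H] (y : V → H) (a b : V) (m : ℕ) :
    FreeGroup.lift y (altWord a b (2 * m)) = (y a * y b) ^ m := by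
  induction m with
  | zero => simp [altWord]
  | succ m ih =>
    have : altWord a b (2 * (m + 1)) =
        altWord a b (2 * m) * FreeGroup.of a * FreeGroup.of b := by
      simp [altWord, Nat.mul_add, List.range_succ, Nat.add_mod, mul_assoc]
    rw [this, map_mul, map_mul, ih, pow_succ]
    simp [mul_assoc]

theorem lift_altWord_odd {H : Type} [Group H] (y : V → H) (a b : V) (m : ℕ) :
    FreeGroup.lift y (altWord a b (2 * m + 1)) = (y a * y b) ^ m * y a := by
  have : altWord a b (2 * m + 1) = altWord a b (2 * m) * FreeGroup.of a := by
    simp [altWord, List.range_succ]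
  rw [this, map_mul, lift_altWord_even]
  simp

theorem mul_pow_swap {H : Type} [Group H] (a b : H) (m : ℕ) :
    (b * a) ^ m * b = b * (a * b) ^ m := by
  induction m with
  | zero => simp
  | succ m ih =>
    rw [pow_succ, pow_succ, ← mul_assoc b, ← ih]; simp only [mul_assoc]

theorem lift_rel_iff {H : Type} [Group H] (y : V → H) (a b : V) (n : ℕ) :
    FreeGroup.lift y (altWord a b n) = FreeGroup.lift y (altWord b a n) ↔
    (if n % 2 = 1 then (y a * y b) ^ (n / 2) * y a = y b * (y a * y b) ^ (n / 2)
      else (y a * y b) ^ (n / 2) * y a = y a * (y a * y b) ^ (n / 2)) := by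
  rcases Nat.mod_two_eq_zero_or_one n with hn | hn
  · obtain ⟨m, rfl⟩ : ∃ m, n = 2 * m := ⟨n / 2, by omega⟩
    have e : 2 * m / 2 = m := by omega
    rw [lift_altWord_even, lift_altWord_even, hn, e, if_neg (by simp)]
    rw [mul_pow_swap (y b) (y a) m]
    exact ⟨fun h1 => by rw [← h1], fun h1 => (mul_left_cancel h1).symm⟩
  · obtain ⟨m, rfl⟩ : ∃ m, n = 2 * m + 1 := ⟨n / 2, by omega⟩
    have e : (2 * m + 1) / 2 = m := by omega
    rw [lift_altWord_odd, lift_altWord_odd, hn, e, if_pos rfl, mul_pow_swap (y a) (y b) m]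

end Setup

section Universal

variable {V : Type} {D : V → V → Prop} {T : SimpleGraph V} {M : V → V → ℕ}
  {h : V → Wr (FreeGroup (OEdge D))}

theorem conj_comm_iff {K : Type} [Group K] (a b L t : K) :
    (a⁻¹ * L * b) * t = t * (a⁻¹ * L * b) ↔ L * (b * t * b⁻¹) = (a * t * a⁻¹) * L := by
  constructor
  · intro e
    calc L * (b * t * b⁻¹) = a * ((a⁻¹ * L * b) * t) * b⁻¹ := by group
      _ = _ := by rw [e]; group
  · intro e
    calc (a⁻¹ * L * b) * t = a⁻¹ * (L * (b * t * b⁻¹)) * b := by group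
      _ = _ := by rw [e]; group

theorem diag_rel {A H : Type} [Group A] [Group H] (φ : A →* H) (u : A) (a b : H) :
    Wr.map φ ⟨u, u, false⟩ * tau b = tau a * Wr.map φ ⟨u, u, false⟩ ↔ φ u * b = a * φ u := by
  constructor
  · intro e
    have := congrArg Wr.p e
    simpa [mul_p, map_p, map_q, map_s, tau] using this
  · intro e
    ext
    · simpa [mul_p, map_p, map_q, map_s, tau] using e
    · simp only [mul_q, map_p, map_q, map_s, tau]
      simp only [Bool.false_eq_true, if_false, if_true]
      rw [eq_inv_mul_iff_mul_eq, ← mul_assoc, ← e]; group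
    · simp [mul_s, map_s, tau]

theorem lab1_rel {H : Type} [Group H] (φ : FreeGroup (OEdge D) →* H) (a b : V) (ya yb : H) :
    Wr.map φ (lab1 D a b) * tau yb = tau ya * Wr.map φ (lab1 D a b) ↔
      φ (xg D a b) = ya * yb := by
  constructor
  · intro e
    have := congrArg Wr.p e
    simp [mul_p, map_p, map_q, map_s, tau, lab1] at this
    rw [← this]; group
  · intro e
    ext <;> simp [mul_p, mul_q, mul_s, map_p, map_q, map_s, tau, lab1, e]

theorem lab2_rel {H : Type} [Group H] (φ : FreeGroup (OEdge D) →* H) (y : V → H) (a b : V)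
    (e : φ (xg D a b) = y a * y b) :
    Wr.map φ (lab2 D M a b) * tau (y (tgt M a b)) = tau (y a) * Wr.map φ (lab2 D M a b) ↔
      FreeGroup.lift y (altWord a b (M a b)) = FreeGroup.lift y (altWord b a (M a b)) := by
  rw [lift_rel_iff]
  rcases Nat.mod_two_eq_zero_or_one (M a b) with hpar | hpar
  · simp only [lab2, tgt, hpar]
    simp only [zero_ne_one, if_false]
    rw [diag_rel, map_pow, e]
  · simp only [lab2, tgt, hpar]
    simp only [if_true]
    rw [diag_rel, map_inv, map_pow, e]
    constructor
    · intro h1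
      rw [inv_mul_eq_iff_eq_mul, ← mul_assoc, eq_mul_inv_iff_mul_eq] at h1
      exact h1.symm
    · intro h1
      rw [inv_mul_eq_iff_eq_mul, ← mul_assoc, eq_mul_inv_iff_mul_eq]
      exact h1.symm

theorem artin_isP {Γ : SimpleGraph V} (hsymm : ∀ a b, M a b = M b a)
    (hadjD : ∀ a b, D a b → Γ.Adj a b) (htotal : ∀ a b, Γ.Adj a b → (D a b ∨ D b a))
    (hT : T.Connected) (hTD : ∀ a b, T.Adj a b → D a b ∨ D b a)
    (hh : ∀ a b, T.Adj a b ∧ D a b → h a = lab1 D a b * h b) :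
    ∃ (φ : FreeGroup (OEdge D) →* ArtinGroup Γ M) (t : ArtinGroup Γ M),
      IsP (lamB D T M h) φ t := by
  obtain ⟨r⟩ := hT.nonempty
  let y : V → ArtinGroup Γ M := fun v => PresentedGroup.of v
  let φ : FreeGroup (OEdge D) →* ArtinGroup Γ M :=
    FreeGroup.lift fun e => y e.1.1 * y e.1.2
  have hφ : ∀ a b, D a b → φ (xg D a b) = y a * y b := by
    intro a b hab
    simp [φ, xg, hab]
  have hy : ∀ w, FreeGroup.lift y w = PresentedGroup.mk (artinRels Γ M) w := by
    intro w
    have : FreeGroup.lift y = PresentedGroup.mk (artinRels Γ M) := by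
      ext v; simp [y]; rfl
    rw [this]
  have hrel : ∀ a b, D a b →
      FreeGroup.lift y (altWord a b (M a b)) = FreeGroup.lift y (altWord b a (M a b)) := by
    intro a b hab
    rw [hy, hy, ← mul_inv_eq_one, ← map_inv, ← map_mul]
    exact PresentedGroup.one_of_mem ⟨a, b, hadjD a b hab, rfl⟩
  have r1 : ∀ a b, D a b →
      Wr.map φ (lab1 D a b) * tau (y b) = tau (y a) * Wr.map φ (lab1 D a b) :=
    fun a b hab => (lab1_rel φ a b _ _).2 (hφ a b hab)
  have r2 : ∀ a b, D a b →
      Wr.map φ (lab2 D M a b) * tau (y (tgt M a b)) = tau (y a) * Wr.map φ (lab2 D M a b) :=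
    fun a b hab => (lab2_rel φ y a b (hφ a b hab)).2 (hrel a b hab)
  have hconst : ∀ a b, (Wr.map φ (h a))⁻¹ * tau (y a) * Wr.map φ (h a) =
      (Wr.map φ (h b))⁻¹ * tau (y b) * Wr.map φ (h b) := by
    apply tree_const hT hTD
    intro a b hadj hab
    rw [hh a b ⟨hadj, hab⟩, map_mul]
    calc _ = (Wr.map φ (h b))⁻¹ * (Wr.map φ (lab1 D a b))⁻¹ *
          (tau (y a) * Wr.map φ (lab1 D a b)) * Wr.map φ (h b) := by group
      _ = _ := by rw [← r1 a b hab]; group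
  let t : ArtinGroup Γ M := ((Wr.map φ (h r))⁻¹ * tau (y r) * Wr.map φ (h r)).p
  have ht : ∀ v, tau t = (Wr.map φ (h v))⁻¹ * tau (y v) * Wr.map φ (h v) := by
    intro v
    rw [hconst v r]
    have := conj_tau (Wr.map φ (h r))⁻¹ (y r)
    rw [inv_inv] at this
    exact this.symm
  have ht' : ∀ v, Wr.map φ (h v) * tau t * (Wr.map φ (h v))⁻¹ = tau (y v) := by
    intro v; rw [ht v]; group
  refine ⟨φ, t, ?_, ?_, ?_⟩
  · apply gg_induction
    · simp [Compat]
    · intro u v hu hv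
      unfold Compat at *
      rw [map_mul, map_mul, mul_assoc, hv, ← mul_assoc, hu, mul_assoc]
    · intro u hu
      unfold Compat at *
      rw [map_inv, map_inv, inv_mul_eq_iff_eq_mul, ← mul_assoc, hu, mul_inv_cancel_right]
    · intro a b hab
      unfold Compat
      rw [lamB_gg1 hh hab, map_mul, map_mul, map_inv, conj_comm_iff, ht', ht']
      exact r1 a b hab
    · intro a b hab
      unfold Compat
      rw [lamB_gg2 hab, map_mul, map_mul, map_inv, conj_comm_iff, ht', ht']
      exact r2 a b hab
  · intro H _ φ' t' hc
    let y' : V → H := fun v => (Wr.map φ' (h v) * tau t' * (Wr.map φ' (h v))⁻¹).p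
    have hy' : ∀ v, Wr.map φ' (h v) * tau t' * (Wr.map φ' (h v))⁻¹ = tau (y' v) :=
      fun v => conj_tau _ _
    have s1 : ∀ a b, D a b → φ' (xg D a b) = y' a * y' b := by
      intro a b hab
      have := hc (gg1 D T a b)
      unfold Compat at this
      rw [lamB_gg1 hh hab, map_mul, map_mul, map_inv, conj_comm_iff, hy', hy'] at this
      exact (lab1_rel _ _ _ _ _).1 this
    have s2 : ∀ a b, D a b →
        FreeGroup.lift y' (altWord a b (M a b)) = FreeGroup.lift y' (altWord b a (M a b)) := by
      intro a b hab
      have := hc (gg2 D T a b)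
      unfold Compat at this
      rw [lamB_gg2 hab, map_mul, map_mul, map_inv, conj_comm_iff, hy', hy'] at this
      exact (lab2_rel _ _ _ _ (s1 a b hab)).1 this
    have hrels : ∀ w ∈ artinRels Γ M, FreeGroup.lift y' w = 1 := by
      rintro w ⟨a, b, hab, rfl⟩
      rw [map_mul, map_inv, mul_inv_eq_one]
      rcases htotal a b hab with hd | hd
      · exact s2 a b hd
      · rw [hsymm a b]
        exact (s2 b a hd).symm
    let f : ArtinGroup Γ M →* H := PresentedGroup.toGroup hrels
    have hfy : ∀ v, f (y v) = y' v := fun v => PresentedGroup.toGroup.of hrels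
    have hfφ : f.comp φ = φ' := by
      ext ⟨⟨a, b⟩, hab⟩
      have e := s1 a b hab
      rw [xg, dif_pos hab] at e
      simp only [MonoidHom.comp_apply, e]
      simp [φ, hfy]
    refine ⟨f, hfφ, ?_⟩
    apply tau_inj
    rw [← map_tau, ht r, map_mul, map_mul, map_inv, map_map, hfφ, map_tau, hfy, ← hy']
    group
  · intro H _ f g hfg hft
    apply PresentedGroup.ext
    intro v
    apply tau_inj
    change tau (f (y v)) = tau (g (y v))
    rw [← map_tau, ← map_tau, ← ht' v]
    simp only [map_mul, map_inv, map_map, map_tau, hfg, hft]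

theorem exists_data [Finite V] {Γ : SimpleGraph V} (hconn : Γ.Connected)
    (hsymm : ∀ a b, M a b = M b a) (h3 : ∀ a b, Γ.Adj a b → 3 ≤ M a b)
    (hpo : IsPartialOrientation Γ D) (htotal : ∀ a b, Γ.Adj a b → (D a b ∨ D b a))
    (hdir : ∀ (n : ℕ), 0 < n → ∀ c : ZMod n → V, Γ.IsCycleMap c → Function.Injective c →
      (∀ i, D (c i) (c (i + 1))) ∨ (∀ i, D (c (i + 1)) (c i))) :
    ∃ (nA nB : ℕ) (Λ : FreeGroup (Fin nB) →* Wr (FreeGroup (Fin nA)))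
      (φ : FreeGroup (Fin nA) →* ArtinGroup Γ M) (t : ArtinGroup Γ M),
      IsP Λ φ t ∧ ∀ β, (Λ β).s = false → ((Λ β).p = 1 ∨ (Λ β).q = 1) → β = 1 := by
  obtain ⟨T, hTle, hT⟩ := hconn.exists_isTree_le
  have hTD : ∀ a b, T.Adj a b → D a b ∨ D b a := fun a b hab => htotal a b (hTle hab)
  obtain ⟨h, hh⟩ := exists_potential _ T hT.IsAcyclic (fun a b => T.Adj a b ∧ D a b)
    (lab1 D) (fun _ _ e => e.1) (fun a b e e' => hpo.not_both a b ⟨e.2, e'.2⟩) le_rfl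
  obtain ⟨φ, t, hP⟩ := artin_isP (M := M) (Γ := Γ) hsymm hpo.adj htotal hT.connected hTD hh
  have hinj := lamB_inj (M := M) h3 hpo.adj hpo.not_both hdir hT.connected hTD hh
  let eA : FreeGroup (OEdge D) ≃* FreeGroup (Fin (Nat.card (OEdge D))) :=
    FreeGroup.freeGroupCongr (Finite.equivFin _)
  let eB : FreeGroup (NEdge D T ⊕ OEdge D) ≃* FreeGroup (Fin (Nat.card (NEdge D T ⊕ OEdge D))) :=
    FreeGroup.freeGroupCongr (Finite.equivFin _)
  refine ⟨_, _, _, _, t, hP.transport eA eB, ?_⟩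
  intro β hs hpq
  have := hinj (eB.symm β) hs (by
    rcases hpq with e | e
    · exact Or.inl (eA.injective (by rw [map_one]; exact e))
    · exact Or.inr (eA.injective (by rw [map_one]; exact e)))
  exact eB.symm.injective (by rw [this, map_one])

end Universal

/-! ### Finitely generated free groups and the conclusion -/

theorem finite_of_fg_freeGroup {X : Type} [hfg : Group.FG (FreeGroup X)] : Finite X := by
  classical
  obtain ⟨S, hS⟩ := Group.fg_def.1 hfg
  let k : X → (FreeGroup X →* Multiplicative (ZMod 2)) := fun x =>
    FreeGroup.lift fun z => if z = x then Multiplicative.ofAdd 1 else 1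
  refine Finite.of_injective (fun (x : X) (s : S) => k x s.1) ?_
  intro x z hxz
  have : k x = k z := by
    apply MonoidHom.eq_of_eqOn_dense hS
    intro s hs
    exact congrFun hxz ⟨s, hs⟩
  have h1 := DFunLike.congr_fun this (FreeGroup.of x)
  simp only [k, FreeGroup.lift_apply_of, if_true] at h1
  by_contra hne
  rw [if_neg hne] at h1
  revert h1
  decide

theorem exists_freeGroup_equiv {n : ℕ} (C : Subgroup (FreeGroup (Fin n)))
    (hC : C.index ≠ 0) : ∃ k : ℕ, Nonempty (FreeGroup (Fin k) ≃* C) := by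
  have : C.FiniteIndex := ⟨hC⟩
  have hfg : Group.FG C := Subgroup.fg_of_index_ne_zero C
  let e := IsFreeGroup.toFreeGroup C
  have : Group.FG (FreeGroup (IsFreeGroup.Generators C)) :=
    Group.fg_of_surjective (f := e.toMonoidHom) e.surjective
  have : Finite (IsFreeGroup.Generators C) := finite_of_fg_freeGroup
  exact ⟨_, ⟨((FreeGroup.freeGroupCongr (Finite.equivFin _)).symm.trans e.symm)⟩⟩


theorem largeType_directed_orientation_splitting {V : Type} [Fintype V]
    (Γ : SimpleGraph V) (hconn : Γ.Connected)
    (M : V → V → ℕ) (hsymm : ∀ a b, M a b = M b a) (h3 : ∀ a b, Γ.Adj a b → 3 ≤ M a b)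
    (D : V → V → Prop) (hpo : IsPartialOrientation Γ D)
    (htotal : ∀ a b, Γ.Adj a b → (D a b ∨ D b a))
    (hdir : ∀ (n : ℕ), 0 < n → ∀ c : ZMod n → V, Γ.IsCycleMap c → Function.Injective c →
      (∀ i, D (c i) (c (i + 1))) ∨ (∀ i, D (c (i + 1)) (c i))) :
    (∃ (nA nB nC : ℕ)
      (i : FreeGroup (Fin nC) →* FreeGroup (Fin nA))
      (j : FreeGroup (Fin nC) →* FreeGroup (Fin nB)),
      Function.Injective i ∧ Function.Injective j ∧
      Nonempty (ArtinGroup Γ M ≃* AmalgamatedProduct i j)) ∨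
    (∃ (nA nB : ℕ)
      (f₁ f₂ : FreeGroup (Fin nB) →* FreeGroup (Fin nA))
      (h₁ : Function.Injective f₁) (h₂ : Function.Injective f₂),
      Nonempty (ArtinGroup Γ M ≃*
        HNNExtension (FreeGroup (Fin nA)) f₁.range f₂.range
          ((MonoidHom.ofInjective h₁).symm.trans (MonoidHom.ofInjective h₂)))) := by
  obtain ⟨nA, nB, Λ, φ, t, hP, hinj⟩ := exists_data hconn hsymm h3 hpo htotal hdir
  by_cases hex : ∃ β₀, (Λ β₀).s = true
  · left
    obtain ⟨β₀, h₀⟩ := hex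
    let C : Subgroup (FreeGroup (Fin nB)) := (Wr.sign.comp Λ).ker
    have hmem : ∀ β, β ∈ C ↔ (Λ β).s = false := by
      intro β
      rw [MonoidHom.mem_ker, MonoidHom.comp_apply, Wr.sign_eq_one]
    have hidx : C.index ≠ 0 := by
      rw [Subgroup.index_ker]
      exact Nat.card_pos.ne'
    obtain ⟨nC, ⟨e⟩⟩ := exists_freeGroup_equiv C hidx
    let j : FreeGroup (Fin nC) →* FreeGroup (Fin nB) := C.subtype.comp e.toMonoidHom
    have hj : ∀ c, (Λ (j c)).s = false := fun c => (hmem _).1 (e c).2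
    let i : FreeGroup (Fin nC) →* FreeGroup (Fin nA) := MonoidHom.mk' (fun c => (Λ (j c)).p) (by
      intro c d
      rw [map_mul, map_mul, Wr.mul_p, hj c]
      simp)
    have hji : Function.Injective j := fun c d hcd => e.injective (Subtype.ext hcd)
    have hii : Function.Injective i := by
      rw [injective_iff_map_eq_one]
      intro c hc
      apply hji
      rw [map_one]
      exact hinj _ (hj c) (Or.inl hc)
    obtain ⟨φ', t', hP'⟩ := amalgam_isP Λ i j hj (fun _ => rfl) (fun β hβ =>
      ⟨e.symm ⟨β, (hmem β).2 hβ⟩, by simp [j]⟩) β₀ h₀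
    exact ⟨nA, nB, nC, i, j, hii, hji, hP.equiv hP'⟩
  · right
    have hs : ∀ β, (Λ β).s = false := by
      intro β
      by_contra hb
      exact hex ⟨β, by simpa using hb⟩
    let f₁ : FreeGroup (Fin nB) →* FreeGroup (Fin nA) := MonoidHom.mk' (fun c => (Λ c).q) (by
      intro c d
      rw [map_mul, Wr.mul_q, hs c]
      simp)
    let f₂ : FreeGroup (Fin nB) →* FreeGroup (Fin nA) := MonoidHom.mk' (fun c => (Λ c).p) (by
      intro c d
      rw [map_mul, Wr.mul_p, hs c]
      simp)
    have h₁ : Function.Injective f₁ := by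
      rw [injective_iff_map_eq_one]
      intro c hc
      exact hinj _ (hs c) (Or.inr hc)
    have h₂ : Function.Injective f₂ := by
      rw [injective_iff_map_eq_one]
      intro c hc
      exact hinj _ (hs c) (Or.inl hc)
    obtain ⟨φ', t', hP'⟩ := hnn_isP Λ hs f₁ f₂ (fun _ => rfl) (fun _ => rfl) h₁ h₂
    exact ⟨nA, nB, f₁, f₂, h₁, h₂, hP.equiv hP'⟩
end
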